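/- Let (W,S) be a finite irreducible Coxeter system of rank n with Coxeter number h. Let E(W) be the number of edges of the Hasse diagram of the noncrossing partition lattice L_W, i.e., the number of pairs (x,y) with x, y ∈ L_W, x ≤ y in absolute order, and ℓ_T(y) = ℓ_T(x) + 1, and let NC(W) be the number of elements of L_W. Then (h + 2) · E(W) = n · h · NC(W). -/

import Mathlib

open scoped BigOperators

section Defs

variable {G : Type*} [Group G]

/-- `t` is a reflection with respect to the generating set `S`:
a conjugate of an element of `S`. -/
def IsReflectionOf (S : Set G) (t : G) : Prop :=
  ∃ g : G, ∃ s ∈ S, t = g * s * g⁻¹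

/-- The absolute length of `w`: the minimal length of a word in the
reflections (conjugates of elements of `S`) whose product is `w`. -/
noncomputable def absLength (S : Set G) (w : G) : ℕ :=
  sInf {k | ∃ l : List G, (∀ t ∈ l, IsReflectionOf S t) ∧ l.length = k ∧ l.prod = w}

/-- The absolute order: `u ≤ v` iff `ℓ_T(u) + ℓ_T(u⁻¹v) = ℓ_T(v)`. -/
def absLe (S : Set G) (u v : G) : Prop :=
  absLength S u + absLength S (u⁻¹ * v) = absLength S v

/-- `c` is a Coxeter element with respect to the set `S` of simple reflections:
a product of all the elements of `S`, each occurring exactly once, in some order. -/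
def IsCoxeterElementOf (S : Set G) (c : G) : Prop :=
  ∃ l : List G, l.Nodup ∧ (∀ x, x ∈ l ↔ x ∈ S) ∧ l.prod = c

/-- The rank-selected multichain count `C_{(j₁,…,j_m)}(W)`: the number of multichains
`x₁ ≤ ⋯ ≤ x_{m-1}` in the interval `[1,c]` of the absolute order whose sequence of
rank jumps (prepending `1` and appending `c`) is given by `j`. -/
noncomputable def chainCount (S : Set G) (c : G) {m : ℕ} (j : Fin m → ℕ) : ℕ :=
  Nat.card {y : Fin (m + 1) → G //
    y 0 = 1 ∧ y (Fin.last m) = c ∧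
    (∀ i, absLe S (y i) c) ∧
    (∀ i : Fin m, absLe S (y i.castSucc) (y i.succ)) ∧
    (∀ i : Fin m, absLength S (y i.succ) = absLength S (y i.castSucc) + j i)}

end Defs

section Cox

variable {B : Type*} {W : Type*} [Group W] {M : CoxeterMatrix B}

/-- The set of simple reflections of a Coxeter system. -/
def simpleSet (cs : CoxeterSystem M W) : Set W := Set.range cs.simple

/-- A Coxeter system is irreducible if its set of simple reflections is nonempty and cannot
be partitioned into two nonempty subsets such that every simple reflection in one commutes
with every simple reflection in the other. -/
def IsIrreducibleCS (cs : CoxeterSystem M W) : Prop :=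
  Nonempty B ∧
    ∀ A : Set B, (∀ a ∈ A, ∀ b ∈ Aᶜ, Commute (cs.simple a) (cs.simple b)) →
      A = ∅ ∨ A = Set.univ

/-- The standard parabolic subgroup `W_⟨s⟩` generated by the simple reflections
other than `cs.simple s`. -/
def parabolic (cs : CoxeterSystem M W) (s : B) : Subgroup W :=
  Subgroup.closure (Set.range cs.simple \ {cs.simple s})

/-- The set of simple reflections of the parabolic subgroup `W_⟨s⟩`, viewed as
elements of that subgroup. -/
def parabolicGens (cs : CoxeterSystem M W) (s : B) : Set (parabolic cs s) :=
  {x | (x : W) ∈ Set.range cs.simple \ {cs.simple s}}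

end Cox

section MoreCounts

variable {G : Type*} [Group G]

/-- `TW_k(W)`: the number of chains `1 = x₀ < x₁ < ⋯ < x_k` in the noncrossing partition
lattice `[1,c]` with `ℓ_T(xᵢ) = i` for all `i` (equivalently, the number of reduced
`T`-words of elements of absolute length `k` in `[1,c]`). -/
noncomputable def twCount (S : Set G) (c : G) (k : ℕ) : ℕ :=
  Nat.card {y : Fin (k + 1) → G //
    y 0 = 1 ∧ (∀ i, absLe S (y i) c) ∧
    (∀ i : Fin k, absLe S (y i.castSucc) (y i.succ)) ∧
    (∀ i : Fin (k + 1), absLength S (y i) = (i : ℕ))}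

/-- `NC(W)`: the number of elements of the noncrossing partition lattice `[1,c]`. -/
noncomputable def ncCount (S : Set G) (c : G) : ℕ :=
  Nat.card {w : G // absLe S w c}

/-- `E(W)`: the number of edges of the Hasse diagram of the noncrossing partition lattice
`[1,c]`, i.e. pairs `(x,y)` with `x ≤ y` in `[1,c]` and `ℓ_T(y) = ℓ_T(x) + 1`. -/
noncomputable def edgeCount (S : Set G) (c : G) : ℕ :=
  Nat.card {p : G × G // absLe S p.1 c ∧ absLe S p.2 c ∧ absLe S p.1 p.2 ∧
    absLength S p.2 = absLength S p.1 + 1}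

/-- `SC_k(W)`: the number of saturated chains `x₀ < x₁ < ⋯ < x_k` of length `k` in the
noncrossing partition lattice `[1,c]`, i.e. with `ℓ_T(xᵢ) = ℓ_T(x₀) + i` for all `i`. -/
noncomputable def scCount (S : Set G) (c : G) (k : ℕ) : ℕ :=
  Nat.card {y : Fin (k + 1) → G //
    (∀ i, absLe S (y i) c) ∧
    (∀ i : Fin k, absLe S (y i.castSucc) (y i.succ)) ∧
    (∀ i : Fin k, absLength S (y i.succ) = absLength S (y i.castSucc) + 1)}

end MoreCounts

set_option linter.unusedSectionVars false

section EulerSystems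

open Module Submodule
open scoped Classical in
/-- The number of sublists of `A` of length `dim U` contained in `U` whose entries are pairwise
orthogonal, later entries being on the left of the form. -/
noncomputable def cliqueCount {V : Type*} [AddCommGroup V] [Module ℝ V]
    (E : V →ₗ[ℝ] V →ₗ[ℝ] ℝ) (U : Submodule ℝ V) (A : List V) : ℕ :=
  A.sublists.countP (fun C => decide (C.Pairwise (fun γ δ => E δ γ = 0) ∧ (∀ v ∈ C, v ∈ U) ∧
    C.length = finrank ℝ U))

variable {V : Type*} [AddCommGroup V] [Module ℝ V] [FiniteDimensional ℝ V]

theorem mem_inf_ker {E : V →ₗ[ℝ] V →ₗ[ℝ] ℝ} {U : Submodule ℝ V} {p v : V} :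
    v ∈ U ⊓ LinearMap.ker (E p) ↔ v ∈ U ∧ E p v = 0 := by
  simp

theorem finrank_inf_ker {E : V →ₗ[ℝ] V →ₗ[ℝ] ℝ} {U : Submodule ℝ V} {p : V} (hp : p ∈ U)
    (h1 : E p p = 1) : finrank ℝ (U ⊓ LinearMap.ker (E p) : Submodule ℝ V) + 1 = finrank ℝ U := by
  have hp0 : p ≠ 0 := by rintro rfl; simp at h1
  have hsup : (U ⊓ LinearMap.ker (E p)) ⊔ span ℝ {p} = U := by
    apply le_antisymm
    · exact sup_le inf_le_left (by simpa [span_le] using hp)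
    · intro v hv
      have : v = (v - E p v • p) + E p v • p := by abel
      rw [this]
      apply Submodule.add_mem_sup
      · rw [mem_inf_ker]
        exact ⟨sub_mem hv (smul_mem _ _ hp), by simp [h1]⟩
      · exact smul_mem _ _ (mem_span_singleton_self p)
  have hinf : (U ⊓ LinearMap.ker (E p)) ⊓ span ℝ {p} = ⊥ := by
    rw [eq_bot_iff]
    rintro v ⟨hv, hv'⟩
    obtain ⟨a, rfl⟩ := mem_span_singleton.1 hv'
    have := (mem_inf_ker.1 hv).2
    simp [h1] at this
    simp [this]
  have := Submodule.finrank_sup_add_finrank_inf_eq (U ⊓ LinearMap.ker (E p)) (span ℝ {p})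
  rw [hsup, hinf, finrank_bot, finrank_span_singleton hp0] at this
  omega

open scoped Classical in
theorem cliqueCount_concat (E : V →ₗ[ℝ] V →ₗ[ℝ] ℝ) (U : Submodule ℝ V) (A : List V) {p : V}
    (h1 : E p p = 1) : cliqueCount E U (A ++ [p]) = cliqueCount E U A +
      if p ∈ U then cliqueCount E (U ⊓ LinearMap.ker (E p)) A else 0 := by
  unfold cliqueCount
  rw [List.sublists_concat, List.countP_append, List.countP_map]
  congr 1
  split_ifs with hp
  · apply List.countP_congr
    intro C _
    have := finrank_inf_ker hp h1
    simp only [Function.comp_apply, decide_eq_true_eq, mem_inf_ker, List.pairwise_append,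
      List.length_append, List.length_singleton, List.mem_append, List.mem_singleton]
    constructor
    · rintro ⟨⟨h2, -, h3⟩, h4, h5⟩
      exact ⟨h2, fun v hv => ⟨h4 v (Or.inl hv), h3 v hv p rfl⟩, by omega⟩
    · rintro ⟨h2, h3, h4⟩
      refine ⟨⟨h2, List.pairwise_singleton _ _, ?_⟩, ?_, by omega⟩
      · rintro a ha b rfl
        exact (h3 a ha).2
      · rintro v (hv | rfl)
        · exact (h3 v hv).1
        · exact hp
  · rw [List.countP_eq_zero]
    intro C _
    simp only [Function.comp_apply, decide_eq_true_eq]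
    rintro ⟨-, h2, -⟩
    exact hp (h2 p (by simp))

theorem cliqueCount_nil_of_ne {E : V →ₗ[ℝ] V →ₗ[ℝ] ℝ} {U : Submodule ℝ V} (hU : U ≠ ⊥) :
    cliqueCount E U [] = 0 := by
  have : finrank ℝ U ≠ 0 := by simpa [Submodule.finrank_eq_zero] using hU
  simp [cliqueCount, this.symm]

theorem cliqueCount_nil_bot {E : V →ₗ[ℝ] V →ₗ[ℝ] ℝ} :
    cliqueCount E (⊥ : Submodule ℝ V) [] = 1 := by
  simp [cliqueCount]

/-- Triangular families have at most `dim U` elements. -/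
theorem clique_length_le {E : V →ₗ[ℝ] V →ₗ[ℝ] ℝ} (l : List V) :
    ∀ (U : Submodule ℝ V), l.Pairwise (fun γ δ => E δ γ = 0) → (∀ v ∈ l, E v v = 1) →
      (∀ v ∈ l, v ∈ U) → l.length ≤ finrank ℝ U ∧
        (l.length = finrank ℝ U → ∀ Y : Submodule ℝ V, (∀ v ∈ l, v ∈ Y) → U ≤ Y) := by
  induction l using List.reverseRecOn with
  | nil =>
    intro U _ _ _
    refine ⟨by simp, fun h Y _ => ?_⟩
    have : U = ⊥ := Submodule.finrank_eq_zero.1 (by simpa using h.symm)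
    simp [this]
  | append_singleton l p ih =>
    intro U hl h1 hU
    rw [List.pairwise_append] at hl
    have hpU : p ∈ U := hU p (by simp)
    have hp1 : E p p = 1 := h1 p (by simp)
    have hd := finrank_inf_ker hpU hp1
    obtain ⟨i1, i2⟩ := ih (U ⊓ LinearMap.ker (E p)) hl.1 (fun v hv => h1 v (by simp [hv]))
      (fun v hv => mem_inf_ker.2 ⟨hU v (by simp [hv]), hl.2.2 v hv p (by simp)⟩)
    rw [List.length_append, List.length_singleton]
    refine ⟨by omega, fun h Y hY v hv => ?_⟩
    have := i2 (by omega) Y (fun v hv => hY v (by simp [hv]))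
    have hv' : v - E p v • p ∈ Y := this (mem_inf_ker.2
      ⟨sub_mem hv (smul_mem _ _ hpU), by simp [hp1]⟩)
    have := Y.add_mem hv' (Y.smul_mem (E p v) (hY p (by simp)))
    simpa using this

theorem List.exists_first {α : Type*} (L : List α) (P : α → Prop) (h : ∃ x ∈ L, P x) :
    ∃ A p B, L = A ++ p :: B ∧ P p ∧ ∀ a ∈ A, ¬ P a := by
  induction L with
  | nil => simp at h
  | cons x L ih =>
    by_cases hx : P x
    · exact ⟨[], x, L, rfl, hx, by simp⟩
    · obtain ⟨y, hy, hPy⟩ := h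
      rcases List.mem_cons.1 hy with rfl | hy
      · exact absurd hPy hx
      · obtain ⟨A, p, B, rfl, hp, hA⟩ := ih ⟨y, hy, hPy⟩
        refine ⟨x :: A, p, B, rfl, hp, ?_⟩
        simpa using ⟨hx, hA⟩

/-- A finite root system with a non-symmetric positive form whose symmetrisation is the usual
invariant form, together with a finite family of subspaces playing the role of the
noncrossing partition lattice. -/
structure EulerSystem (V : Type*) [AddCommGroup V] [Module ℝ V] where
  E : V →ₗ[ℝ] V →ₗ[ℝ] ℝ
  Φ : Set V
  lat : Finset (Submodule ℝ V)
  E_pos : ∀ v, v ≠ 0 → 0 < E v v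
  E_root : ∀ β ∈ Φ, E β β = 1
  neg_mem : ∀ β ∈ Φ, -β ∈ Φ
  refl_mem : ∀ β ∈ Φ, ∀ γ ∈ Φ, γ - (E γ β + E β γ) • β ∈ Φ
  top_mem : ⊤ ∈ lat
  bot_mem : ⊥ ∈ lat
  inf_right : ∀ U ∈ lat, ∀ β ∈ Φ, β ∈ U → U ⊓ LinearMap.ker (E β) ∈ lat
  inf_left : ∀ U ∈ lat, ∀ β ∈ Φ, β ∈ U → U ⊓ LinearMap.ker (E.flip β) ∈ lat
  sup_right : ∀ U ∈ lat, ∀ β ∈ Φ, (∀ u ∈ U, E β u = 0) → span ℝ {β} ⊔ U ∈ lat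
  span_roots : ∀ U ∈ lat, U ≤ span ℝ {β | β ∈ Φ ∧ β ∈ U}
  dual : ∀ U ∈ lat, ∀ P ∈ Φ, P ∈ U → ∃ ι ∈ Φ, ι ∈ U ∧ ∀ v ∈ U, E P v = E v ι
  compl_right : ∀ X ∈ lat, ∀ Z ∈ lat, Z ≤ X →
    ∃ Y ∈ lat, ∀ v, v ∈ Y ↔ v ∈ X ∧ ∀ z ∈ Z, E z v = 0
  compl_left : ∀ X ∈ lat, ∀ Z ∈ lat, Z ≤ X →
    ∃ Y ∈ lat, ∀ v, v ∈ Y ↔ v ∈ X ∧ ∀ z ∈ Z, E v z = 0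

namespace EulerSystem

variable (S : EulerSystem V)

/-- `L` enumerates a positive system, compatibly with the signs of the form. -/
structure IsPosList (L : List V) : Prop where
  nodup : L.Nodup
  mem : ∀ β, β ∈ S.Φ ↔ β ∈ L ∨ -β ∈ L
  disj : ∀ β ∈ L, -β ∉ L
  pw : L.Pairwise (fun γ δ => 0 ≤ S.E γ δ ∧ S.E δ γ ≤ 0)

open scoped Classical in
/-- The positive roots of `U` whose dual root is positive. -/
noncomputable def initial (L : List V) (U : Submodule ℝ V) : Finset V :=
  L.toFinset.filter (fun P => P ∈ U ∧ ∃ ι ∈ L, ι ∈ U ∧ ∀ v ∈ U, S.E P v = S.E v ι)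

variable {S}

theorem mem_initial {L : List V} {U : Submodule ℝ V} {P : V} : P ∈ S.initial L U ↔
    P ∈ L ∧ P ∈ U ∧ ∃ ι ∈ L, ι ∈ U ∧ ∀ v ∈ U, S.E P v = S.E v ι := by
  simp [initial]

theorem eq_zero_of_forall_right {U : Submodule ℝ V} {v : V} (hv : v ∈ U)
    (h : ∀ u ∈ U, S.E u v = 0) : v = 0 := by
  by_contra h0
  exact (S.E_pos v h0).ne' (h v hv)

theorem eq_of_forall {U : Submodule ℝ V} {v w : V} (hv : v ∈ U) (hw : w ∈ U)
    (h : ∀ u ∈ U, S.E u v = S.E u w) : v = w := by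
  have := eq_zero_of_forall_right (S := S) (sub_mem hv hw) (fun u hu => by simp [h u hu])
  exact sub_eq_zero.1 this

theorem eq_of_forall' {U : Submodule ℝ V} {v w : V} (hv : v ∈ U) (hw : w ∈ U)
    (h : ∀ u ∈ U, S.E v u = S.E w u) : v = w := by
  by_contra h0
  have := S.E_pos (v - w) (sub_ne_zero.2 h0)
  have h2 := h _ (sub_mem hv hw)
  simp only [map_sub, LinearMap.sub_apply] at this h2
  linarith

namespace IsPosList

variable {L : List V} (hL : S.IsPosList L)
include hL

theorem root {β : V} (h : β ∈ L) : β ∈ S.Φ := (hL.mem β).2 (Or.inl h)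

theorem E_self {β : V} (h : β ∈ L) : S.E β β = 1 := S.E_root _ (hL.root h)

theorem before {A B : List V} {p δ : V} (h : L = A ++ p :: B) (hδ : δ ∈ A) :
    0 ≤ S.E δ p ∧ S.E p δ ≤ 0 := by
  have := hL.pw
  rw [h, List.pairwise_append] at this
  exact this.2.2 δ hδ p (by simp)

theorem after {A B : List V} {p δ : V} (h : L = A ++ p :: B) (hδ : δ ∈ B) :
    0 ≤ S.E p δ ∧ S.E δ p ≤ 0 := by
  have := hL.pw
  rw [h, List.pairwise_append, List.pairwise_cons] at this
  exact this.2.1.1 δ hδ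

theorem E_nonneg_of_not_before {A B : List V} {p δ : V} (h : L = A ++ p :: B) (hδ : δ ∈ L)
    (hδ' : δ ∉ A) : 0 ≤ S.E p δ := by
  rw [h] at hδ
  rcases List.mem_append.1 hδ with h' | h'
  · exact absurd h' hδ'
  rcases List.mem_cons.1 h' with rfl | h'
  · rw [hL.E_self (by rw [h]; simp)]; norm_num
  · exact (hL.after h h').1

theorem mem_initial_iff {A B : List V} {P : V} {U : Submodule ℝ V} (hU : U ∈ S.lat)
    (h : L = A ++ P :: B) (hP : P ∈ U) :
    P ∈ S.initial L U ↔ ∀ δ ∈ A, δ ∈ U → S.E P δ = 0 := by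
  have hPL : P ∈ L := by rw [h]; simp
  rw [mem_initial]
  constructor
  · rintro ⟨-, -, ι, hι, hιU, hd⟩ δ hδ hδU
    apply le_antisymm (hL.before h hδ).2
    rw [hd δ hδU]
    have h1 : S.E P ι = 1 := by rw [hd ι hιU, hL.E_self hι]
    have hιA : ι ∉ A := fun h' => by
      have := (hL.before h h').2
      linarith
    have := hL.pw
    rw [h, List.pairwise_append] at this
    refine (this.2.2 δ hδ ι ?_).1
    rw [h] at hι
    exact (List.mem_append.1 hι).resolve_left hιA
  · intro hA
    refine ⟨hPL, hP, ?_⟩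
    obtain ⟨ι, hι, hιU, hd⟩ := S.dual U hU P (hL.root hPL) hP
    rcases (hL.mem ι).1 hι with h' | h'
    · exact ⟨ι, h', hιU, hd⟩
    · exfalso
      have h1 : S.E P (-ι) = -1 := by rw [map_neg, hd ι hιU, S.E_root _ hι]
      by_cases hιA : -ι ∈ A
      · have := hA _ hιA (U.neg_mem hιU)
        linarith
      · have := hL.E_nonneg_of_not_before h h' hιA
        linarith

theorem initial_nonneg {P δ : V} {U : Submodule ℝ V} (hU : U ∈ S.lat) (hP : P ∈ S.initial L U)
    (hδ : δ ∈ L) (hδU : δ ∈ U) : 0 ≤ S.E P δ := by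
  obtain ⟨hPL, hPU, -⟩ := mem_initial.1 hP
  obtain ⟨A, B, h⟩ := List.append_of_mem hPL
  by_cases hA : δ ∈ A
  · rw [(hL.mem_initial_iff hU h hPU).1 hP δ hA hδU]
  · exact hL.E_nonneg_of_not_before h hδ hA

theorem initial_mono {P : V} {U U' : Submodule ℝ V} (hU : U ∈ S.lat) (hU' : U' ∈ S.lat)
    (hle : U' ≤ U) (hP : P ∈ S.initial L U) (hPU' : P ∈ U') : P ∈ S.initial L U' := by
  obtain ⟨hPL, hPU, -⟩ := mem_initial.1 hP
  obtain ⟨A, B, h⟩ := List.append_of_mem hPL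
  rw [hL.mem_initial_iff hU' h hPU']
  exact fun δ hδ hδU => (hL.mem_initial_iff hU h hPU).1 hP δ hδ (hle hδU)

theorem initial_filter_pairwise {U : Submodule ℝ V} (hU : U ∈ S.lat) (M : List V)
    (hM : M.Sublist L) (hMU : ∀ v ∈ M, v ∈ S.initial L U) :
    M.Pairwise (fun γ δ => S.E δ γ = 0) := by
  have key : L.Pairwise (fun γ δ => γ ∈ S.initial L U → δ ∈ S.initial L U → S.E δ γ = 0) := by
    rw [List.pairwise_iff_forall_sublist]
    intro a b hab ha hb
    obtain ⟨-, haU, -⟩ := mem_initial.1 ha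
    obtain ⟨hbL, hbU, -⟩ := mem_initial.1 hb
    obtain ⟨A, B, h⟩ := List.append_of_mem hbL
    rw [h] at hab
    refine (hL.mem_initial_iff hU h hbU).1 hb a ?_ haU
    have hn := hL.nodup
    rw [h, List.nodup_append] at hn
    obtain ⟨l1, l2, e, s1, s2⟩ := List.sublist_append_iff.1 hab
    rcases l1 with _ | ⟨x, l1⟩
    · simp at e
      subst e
      exfalso
      rw [List.sublist_cons_iff] at s2
      have hnb : b ∉ B := (List.nodup_cons.1 hn.2.1).1
      rcases s2 with s2 | ⟨r, hr, s2⟩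
      · exact hnb (s2.subset (by simp))
      · simp at hr
        exact hnb (s2.subset (by simp [← hr.2]))
    · simp at e
      exact s1.subset (by simp [e.1])
  have := key.sublist hM
  refine this.imp_of_mem ?_
  intro a b ha hb h
  exact h (hMU a ha) (hMU b hb)

open scoped Classical in
theorem card_initial_le {U : Submodule ℝ V} (hU : U ∈ S.lat) :
    (S.initial L U).card ≤ finrank ℝ U := by
  set M := L.filter (fun v => v ∈ S.initial L U) with hM
  have hMm : ∀ v, v ∈ M ↔ v ∈ S.initial L U := by
    intro v
    simp only [hM, List.mem_filter, decide_eq_true_eq, and_iff_right_iff_imp]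
    exact fun h => (mem_initial.1 h).1
  have h1 := (clique_length_le M U (hL.initial_filter_pairwise hU M List.filter_sublist
    (fun v hv => (hMm v).1 hv)) (fun v hv => hL.E_self (mem_initial.1 ((hMm v).1 hv)).1)
    (fun v hv => (mem_initial.1 ((hMm v).1 hv)).2.1)).1
  have h2 : M.toFinset = S.initial L U := by ext v; simp [hMm]
  rw [← h2, List.toFinset_card_of_nodup (hL.nodup.filter _)]
  exact h1

theorem ne_neg {γ δ : V} (hγ : γ ∈ L) (hδ : δ ∈ L) : γ ≠ -δ := by
  rintro rfl
  exact hL.disj δ hδ hγ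

theorem ne_zero {γ : V} (hγ : γ ∈ L) : γ ≠ 0 := by
  rintro rfl
  have := hL.E_self hγ
  simp at this

theorem mem_or_neg_mem {γ : V} (hγ : γ ∈ S.Φ) : γ ∈ L ∨ -γ ∈ L := (hL.mem γ).1 hγ

theorem neg_not_mem_of_before {A B : List V} {p : V} (h : L = A ++ p :: B) {γ : V} {a : ℝ}
    (ha : 0 ≤ a) (hγ : S.E p γ = 0) (hδ : -(γ - a • p) ∈ A) : a = 0 := by
  have h1 := (hL.before h hδ).2
  have hp : S.E p p = 1 := hL.E_self (by rw [h]; simp)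
  simp [hγ, hp] at h1
  linarith

theorem rotate {A B : List V} (h : L = A ++ B) : S.IsPosList (B ++ A.map Neg.neg) := by
  have hn := hL.nodup
  rw [h, List.nodup_append'] at hn
  have hpw := hL.pw
  rw [h, List.pairwise_append] at hpw
  constructor
  · rw [List.nodup_append']
    refine ⟨hn.2.1, hn.1.map neg_injective, ?_⟩
    intro b hb hb'
    obtain ⟨a, ha, rfl⟩ := List.mem_map.1 hb'
    exact hL.disj a (by simp [h, ha]) (by simp [h, hb])
  · intro β
    rw [hL.mem, h]
    simp only [List.mem_append, List.mem_map]
    constructor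
    · rintro ((h1 | h1) | (h1 | h1))
      · exact Or.inr (Or.inr ⟨β, h1, rfl⟩)
      · exact Or.inl (Or.inl h1)
      · exact Or.inl (Or.inr ⟨_, h1, by simp⟩)
      · exact Or.inr (Or.inl h1)
    · rintro ((h1 | ⟨a, ha, rfl⟩) | (h1 | ⟨a, ha, h1⟩))
      · exact Or.inl (Or.inr h1)
      · exact Or.inr (Or.inl (by simpa using ha))
      · exact Or.inr (Or.inr h1)
      · rw [neg_inj] at h1
        exact Or.inl (Or.inl (h1 ▸ ha))
  · intro β hβ hβ'
    simp only [List.mem_append, List.mem_map] at hβ hβ'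
    rcases hβ with h1 | ⟨a, ha, rfl⟩ <;> rcases hβ' with h2 | ⟨b, hb, h2⟩
    · exact hL.disj β (by simp [h, h1]) (by simp [h, h2])
    · rw [neg_inj] at h2
      subst h2
      exact hn.2.2 hb h1
    · rw [neg_neg] at h2
      exact hn.2.2 ha h2
    · rw [neg_neg] at h2
      subst h2
      exact hL.disj b (by simp [h, hb]) (by simp [h, ha])
  · rw [List.pairwise_append]
    refine ⟨hpw.2.1, ?_, ?_⟩
    · rw [List.pairwise_map]
      exact hpw.1.imp (by intro a b; simp)
    · intro b hb a ha
      obtain ⟨a', ha', rfl⟩ := List.mem_map.1 ha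
      have := hpw.2.2 a' ha' b hb
      simpa [and_comm] using this

end IsPosList

end EulerSystem

end EulerSystems

section EulerSystems

open Module Submodule

variable {V : Type*} [AddCommGroup V] [Module ℝ V] [FiniteDimensional ℝ V]

theorem expand_of_dual {ι : Type*} [Fintype ι] [DecidableEq ι] {U : Submodule ℝ V}
    (f : ι → V →ₗ[ℝ] ℝ) (α : ι → V) (hc : Fintype.card ι = finrank ℝ U) (hα : ∀ i, α i ∈ U)
    (hf : ∀ i j, f i (α j) = if i = j then 1 else 0) {v : V} (hv : v ∈ U) :
    v = ∑ i, f i v • α i := by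
  have hli : LinearIndependent ℝ α := by
    rw [Fintype.linearIndependent_iff]
    intro g hg i
    have := congrArg (f i) hg
    simpa [hf] using this
  have hspan : span ℝ (Set.range α) = U := by
    apply Submodule.eq_of_le_of_finrank_eq
    · rw [span_le]
      rintro _ ⟨i, rfl⟩
      exact hα i
    · rw [finrank_span_eq_card hli, hc]
  rw [← hspan, mem_span_range_iff_exists_fun] at hv
  obtain ⟨g, rfl⟩ := hv
  simp [hf]

namespace EulerSystem

variable {S : EulerSystem V}

namespace IsPosList

variable {L : List V} (hL : S.IsPosList L)
include hL

theorem exists_pos_mem {U : Submodule ℝ V} (hU : U ∈ S.lat) (h : U ≠ ⊥) : ∃ p ∈ L, p ∈ U := by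
  by_contra! hcon
  apply h
  rw [eq_bot_iff]
  refine (S.span_roots U hU).trans ?_
  rw [span_le]
  rintro β ⟨hβ, hβU⟩
  rcases hL.mem_or_neg_mem hβ with h' | h'
  · exact absurd hβU (hcon _ h')
  · exact absurd (U.neg_mem hβU) (hcon _ h')

/-- Reflecting a later positive root that is orthogonal to `p` stays positive, provided the
negative would not lie before `p`. -/
theorem reflect_mem {A B : List V} {p Q : V} (h : L = A ++ p :: B) (hQ : Q ∈ B)
    (hpQ : S.E p Q = 0) (hA : -(Q - S.E Q p • p) ∉ A) : Q - S.E Q p • p ∈ L := by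
  have hp : p ∈ L := by rw [h]; simp
  have hQL : Q ∈ L := by rw [h]; simp [hQ]
  have h1 := S.refl_mem p (hL.root hp) Q (hL.root hQL)
  rw [hpQ, add_zero] at h1
  rcases hL.mem_or_neg_mem h1 with h2 | h2
  · exact h2
  exfalso
  have h3 := hL.E_nonneg_of_not_before h h2 hA
  have h4 := (hL.after h hQ).2
  simp only [map_neg, map_sub, map_smul, hpQ, hL.E_self hp, smul_eq_mul] at h3
  have h5 : S.E Q p = 0 := by linarith
  rw [h5] at h2
  simp at h2
  exact hL.disj Q hQL h2

theorem exists_dual_basis (d : ℕ) : ∀ U ∈ S.lat, finrank ℝ U = d → ∃ P α : Fin d → V,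
    (∀ i, P i ∈ S.initial L U) ∧ (∀ i, α i ∈ L ∧ α i ∈ U) ∧
      ∀ i j, S.E (P i) (α j) = if i = j then 1 else 0 := by
  induction d with
  | zero => exact fun U _ _ => ⟨Fin.elim0, Fin.elim0, fun i => i.elim0, fun i => i.elim0,
      fun i => i.elim0⟩
  | succ d ih =>
    intro U hU hd
    have hU0 : U ≠ ⊥ := by rintro rfl; simp at hd
    obtain ⟨A, p, B, h, hpU, hA⟩ := List.exists_first L (· ∈ U) (hL.exists_pos_mem hU hU0)
    have hp : p ∈ L := by rw [h]; simp
    have hp1 := hL.E_self hp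
    have hfr := finrank_inf_ker (E := S.E) hpU hp1
    have hU' := S.inf_right U hU p (hL.root hp) hpU
    obtain ⟨Q, α, hQ, hα, hd'⟩ := ih _ hU' (by omega)
    refine ⟨Fin.cons p (fun i => Q i - S.E (Q i) p • p), Fin.cons p α, ?_, ?_, ?_⟩
    · intro i
      refine Fin.cases ?_ (fun i => ?_) i
      · rw [Fin.cons_zero, hL.mem_initial_iff hU h hpU]
        exact fun δ hδ hδU => absurd hδU (hA δ hδ)
      · rw [Fin.cons_succ]
        obtain ⟨hQL, hQU, κ, hκ, hκU, hκd⟩ := mem_initial.1 (hQ i)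
        rw [mem_inf_ker] at hQU hκU
        have hQB : Q i ∈ B := by
          rw [h] at hQL
          rcases List.mem_append.1 hQL with h' | h'
          · exact absurd hQU.1 (hA _ h')
          rcases List.mem_cons.1 h' with h' | h'
          · rw [h', hp1] at hQU
            norm_num at hQU
          · exact h'
        have hmem : Q i - S.E (Q i) p • p ∈ U := sub_mem hQU.1 (U.smul_mem _ hpU)
        rw [mem_initial]
        refine ⟨hL.reflect_mem h hQB hQU.2 (fun h' => hA _ h' (U.neg_mem hmem)), hmem, κ, hκ,
          hκU.1, fun v hv => ?_⟩
        have hv' : v - S.E p v • p ∈ U ⊓ LinearMap.ker (S.E p) := mem_inf_ker.2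
          ⟨sub_mem hv (U.smul_mem _ hpU), by simp [hp1]⟩
        have h1 := hκd _ hv'
        simp only [map_sub, map_smul, LinearMap.sub_apply, LinearMap.smul_apply, smul_eq_mul,
          hκU.2] at h1 ⊢
        linarith
    · intro i
      refine Fin.cases ?_ (fun i => ?_) i
      · exact ⟨hp, hpU⟩
      · exact ⟨(hα i).1, (hα i).2.1⟩
    · intro i j
      have hα0 : ∀ j, S.E p (α j) = 0 := fun j => (mem_inf_ker.1 (hα j).2).2
      refine Fin.cases ?_ (fun i => ?_) i <;> refine Fin.cases ?_ (fun j => ?_) j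
      · simp [hp1]
      · simp [hα0, (Fin.succ_ne_zero j).symm]
      · simp [hp1]
      · simp [hα0, hd']

/-- Expansion of the elements of `U` in the dual basis. -/
theorem exists_dual_basis_expand {U : Submodule ℝ V} (hU : U ∈ S.lat) :
    ∃ P α : Fin (finrank ℝ U) → V,
    (∀ i, P i ∈ S.initial L U) ∧ (∀ Q ∈ S.initial L U, ∃ i, P i = Q) ∧
    (∀ i, α i ∈ L ∧ α i ∈ U) ∧
      (∀ i j, S.E (P i) (α j) = if i = j then 1 else 0) ∧
      (∀ v ∈ U, v = ∑ i, S.E (P i) v • α i) := by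
  classical
  obtain ⟨P, α, h1, h2, h3⟩ := hL.exists_dual_basis _ U hU rfl
  refine ⟨P, α, h1, ?_, h2, h3, fun v hv => ?_⟩
  · have hinj : Function.Injective P := by
      intro i j hij
      by_contra hne
      have e1 := h3 i i
      have e2 := h3 j i
      rw [if_neg (Ne.symm hne), ← hij] at e2
      rw [e2] at e1
      simp at e1
    have hsub : Finset.univ.image P ⊆ S.initial L U := by
      intro x hx
      obtain ⟨i, -, rfl⟩ := Finset.mem_image.1 hx
      exact h1 i
    have heq := Finset.eq_of_subset_of_card_le hsub (by
      rw [Finset.card_image_of_injective _ hinj, Finset.card_univ, Fintype.card_fin]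
      exact hL.card_initial_le hU)
    intro Q hQ
    rw [← heq] at hQ
    obtain ⟨i, -, hi⟩ := Finset.mem_image.1 hQ
    exact ⟨i, hi⟩
  · exact expand_of_dual (fun i => S.E (P i)) α (by simp) (fun i => (h2 i).2) h3 hv

theorem card_initial {U : Submodule ℝ V} (hU : U ∈ S.lat) :
    (S.initial L U).card = finrank ℝ U := by
  classical
  apply le_antisymm (hL.card_initial_le hU)
  obtain ⟨P, α, h1, h2, h3⟩ := hL.exists_dual_basis _ U hU rfl
  have hinj : Function.Injective P := by
    intro i j hij
    by_contra hne
    have e1 := h3 i i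
    have e2 := h3 j i
    rw [if_neg (Ne.symm hne), ← hij] at e2
    rw [e2] at e1
    simp at e1
  have := Finset.card_le_card_of_injOn (s := Finset.univ) (t := S.initial L U) P
    (fun i _ => h1 i) (hinj.injOn)
  simpa using this

/-- An element of `U` on which all initial roots vanish is zero. -/
theorem eq_zero_of_initial {U : Submodule ℝ V} (hU : U ∈ S.lat) {v : V} (hv : v ∈ U)
    (h : ∀ P ∈ S.initial L U, S.E P v = 0) : v = 0 := by
  obtain ⟨P, α, h1, -, -, -, h4⟩ := hL.exists_dual_basis_expand hU
  rw [h4 v hv]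
  exact Finset.sum_eq_zero fun i _ => by rw [h _ (h1 i), zero_smul]

theorem eq_of_eq_smul {p ε : V} (hp : p ∈ L) (hε : ε ∈ L) {a : ℝ} (h : ε = a • p) : ε = p := by
  have h1 := hL.E_self hε
  rw [h] at h1
  simp [hL.E_self hp] at h1
  rcases mul_self_eq_one_iff.1 h1 with rfl | rfl
  · simpa using h
  · exact absurd (by simpa using h) (hL.ne_neg hε hp)

/-- If some positive root of `Z` follows `p`, then the next one satisfies `E ε p = 0`. -/
theorem exists_adjacent {A B : List V} {p : V} (h : L = A ++ p :: B) {Z : Submodule ℝ V}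
    (hZ : Z ∈ S.lat) (hp : p ∈ Z) (hex : ∃ ε ∈ B, ε ∈ Z) : ∃ ε ∈ B, ε ∈ Z ∧ S.E ε p = 0 := by
  obtain ⟨B1, ε, B2, rfl, hεZ, hB1⟩ := List.exists_first B (· ∈ Z) hex
  refine ⟨ε, by simp, hεZ, ?_⟩
  have hL' := hL.rotate h
  set L' := (p :: (B1 ++ ε :: B2)) ++ A.map Neg.neg with hL'def
  have e1 : L' = [] ++ p :: (B1 ++ ε :: B2 ++ A.map Neg.neg) := by simp [hL'def]
  have e2 : L' = (p :: B1) ++ ε :: (B2 ++ A.map Neg.neg) := by simp [hL'def]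
  have hpL : p ∈ L' := by simp [e1]
  have hεL : ε ∈ L' := by simp [e2]
  have hn := hL'.nodup
  by_cases hεI : ε ∈ S.initial L' Z
  · exact (hL'.mem_initial_iff hZ e2 hεZ).1 hεI p (by simp) hp
  exfalso
  have key : ∀ P ∈ S.initial L' Z, P ≠ p → S.E P p = 0 ∧ S.E P ε = 0 := by
    intro P hP hPp
    obtain ⟨hPL, hPZ, -⟩ := mem_initial.1 hP
    have hPε : P ≠ ε := by rintro rfl; exact hεI hP
    have hP2 : P ∈ B2 ++ A.map Neg.neg := by
      rw [e2] at hPL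
      rcases List.mem_append.1 hPL with h' | h'
      · rcases List.mem_cons.1 h' with h' | h'
        · exact absurd h' hPp
        · exact absurd hPZ (hB1 _ h')
      · exact (List.mem_cons.1 h').resolve_left hPε
    obtain ⟨C, D, hCD⟩ := List.append_of_mem hP2
    have e3 : L' = (p :: B1 ++ ε :: C) ++ P :: D := by rw [e2, hCD]; simp
    have := (hL'.mem_initial_iff hZ e3 hPZ).1 hP
    exact ⟨this p (by simp) hp, this ε (by simp) hεZ⟩
  have hz : ε - S.E p ε • p = 0 := by
    refine hL'.eq_zero_of_initial hZ (sub_mem hεZ (Z.smul_mem _ hp)) fun P hP => ?_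
    by_cases hPp : P = p
    · subst hPp
      simp [hL'.E_self hpL]
    · obtain ⟨k1, k2⟩ := key P hP hPp
      simp [k1, k2]
  have := hL'.eq_of_eq_smul hpL hεL (sub_eq_zero.1 hz)
  subst this
  rw [e2] at hn
  simp at hn

end IsPosList

end EulerSystem

end EulerSystems

section EulerSystems

open Module Submodule

variable {V : Type*} [AddCommGroup V] [Module ℝ V] [FiniteDimensional ℝ V]

namespace EulerSystem

variable {S : EulerSystem V}

open scoped Classical in
/-- The members of the lattice below `U` whose positive roots lie in `A` and are not initial
for `U`. -/
noncomputable def initialFree (S : EulerSystem V) (L : List V) (U : Submodule ℝ V) (A : List V) :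
    Finset (Submodule ℝ V) :=
  S.lat.filter (fun Z => Z ≤ U ∧ ∀ γ ∈ L, γ ∈ Z → γ ∈ A ∧ γ ∉ S.initial L U)

theorem mem_initialFree {L : List V} {U : Submodule ℝ V} {A : List V} {Z : Submodule ℝ V} :
    Z ∈ S.initialFree L U A ↔
      Z ∈ S.lat ∧ Z ≤ U ∧ ∀ γ ∈ L, γ ∈ Z → γ ∈ A ∧ γ ∉ S.initial L U := by
  simp [initialFree]

theorem dual_reflect {U : Submodule ℝ V} {p β κ : V} (hp : p ∈ U) (hp1 : S.E p p = 1)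
    (hκ : S.E p κ = 0) {s : ℝ}
    (h : ∀ v ∈ U ⊓ LinearMap.ker (S.E p), S.E β v = s * S.E v κ) :
    ∀ v ∈ U, S.E (β - S.E β p • p) v = s * S.E v κ := by
  intro v hv
  have h1 := h _ (mem_inf_ker.2
    ⟨sub_mem hv (U.smul_mem (S.E p v) hp), by simp [hp1]⟩)
  simp only [map_sub, map_smul, LinearMap.sub_apply, LinearMap.smul_apply, smul_eq_mul,
    hκ] at h1 ⊢
  linarith

namespace IsPosList

variable {L : List V} (hL : S.IsPosList L)
include hL

theorem exists_pos_functional : ∃ f : V →ₗ[ℝ] ℝ, ∀ γ ∈ L, 0 < f γ := by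
  refine ⟨∑ P ∈ S.initial L ⊤, S.E P, fun γ hγ => ?_⟩
  have h0 : ∀ P ∈ S.initial L ⊤, 0 ≤ S.E P γ := fun P hP =>
    hL.initial_nonneg S.top_mem hP hγ mem_top
  rw [LinearMap.sum_apply]
  apply lt_of_le_of_ne (Finset.sum_nonneg h0)
  intro h
  have := (Finset.sum_eq_zero_iff_of_nonneg h0).1 h.symm
  exact hL.ne_zero hγ (hL.eq_zero_of_initial S.top_mem mem_top this)

theorem initial_span {U : Submodule ℝ V} (hU : U ∈ S.lat) (Y : Submodule ℝ V)
    (h : ∀ P ∈ S.initial L U, P ∈ Y) : U ≤ Y := by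
  classical
  set M := L.filter (fun v => v ∈ S.initial L U) with hM
  have hMm : ∀ v, v ∈ M ↔ v ∈ S.initial L U := by
    intro v
    simp only [hM, List.mem_filter, decide_eq_true_eq, and_iff_right_iff_imp]
    exact fun h => (mem_initial.1 h).1
  have h2 : M.toFinset = S.initial L U := by ext v; simp [hMm]
  refine (clique_length_le M U (hL.initial_filter_pairwise hU M List.filter_sublist
    (fun v hv => (hMm v).1 hv)) (fun v hv => hL.E_self (mem_initial.1 ((hMm v).1 hv)).1)
    (fun v hv => (mem_initial.1 ((hMm v).1 hv)).2.1)).2 ?_ Y fun v hv => h v ((hMm v).1 hv)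
  rw [← hL.card_initial hU, ← h2, List.toFinset_card_of_nodup (hL.nodup.filter _)]

theorem neg_dual_of_not_initial {U : Submodule ℝ V} (hU : U ∈ S.lat) {γ : V} (hγ : γ ∈ L)
    (hγU : γ ∈ U) (h : γ ∉ S.initial L U) :
    ∃ κ ∈ L, κ ∈ U ∧ ∀ v ∈ U, S.E γ v = -S.E v κ := by
  obtain ⟨ι, hι, hιU, hd⟩ := S.dual U hU γ (hL.root hγ) hγU
  rcases hL.mem_or_neg_mem hι with h' | h'
  · exact absurd (mem_initial.2 ⟨hγ, hγU, ι, h', hιU, hd⟩) h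
  · exact ⟨-ι, h', U.neg_mem hιU, fun v hv => by rw [hd v hv]; simp⟩

theorem not_initial_of_neg_dual {U : Submodule ℝ V} {γ κ : V} (hκ : κ ∈ L) (hκU : κ ∈ U)
    (hd : ∀ v ∈ U, S.E γ v = -S.E v κ) : γ ∉ S.initial L U := by
  intro hγ
  obtain ⟨-, -, ι, hι, hιU, hd'⟩ := mem_initial.1 hγ
  have : ι = -κ := eq_of_forall (S := S) hιU (U.neg_mem hκU) fun u hu => by
    rw [← hd' u hu, hd u hu, map_neg]
  exact hL.ne_neg hι hκ this

section Step

variable {A B : List V} {p : V} (h : L = A ++ p :: B) {U : Submodule ℝ V} (hU : U ∈ S.lat)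
  (hp : p ∈ U)
include h hU hp

theorem initial_inf_ker_subset (hI : ∀ P ∈ S.initial L U, P ∈ A) {β : V}
    (hβ : β ∈ S.initial L (U ⊓ LinearMap.ker (S.E p))) : β ∈ A := by
  have hpL : p ∈ L := by rw [h]; simp
  have hp1 := hL.E_self hpL
  obtain ⟨hβL, hβU, ι, hι, hιU, hd⟩ := mem_initial.1 hβ
  rw [mem_inf_ker] at hβU hιU
  by_contra hβA
  have hβB : β ∈ B := by
    rw [h] at hβL
    rcases List.mem_cons.1 ((List.mem_append.1 hβL).resolve_left hβA) with h' | h'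
    · rw [h', hp1] at hβU
      norm_num at hβU
    · exact h'
  have hn := hL.nodup
  rw [h, List.nodup_append'] at hn
  have hpA : p ∉ A := fun h' => hn.2.2 h' (by simp)
  have h0 := (hL.after h hβB).2
  have h1 := dual_reflect (s := 1) hp hp1 hιU.2 (fun v hv => by rw [one_mul, hd v hv])
  obtain ⟨κ, hκ, hκU, hκd⟩ := hL.neg_dual_of_not_initial hU hβL hβU.1 (fun h' => hβA (hI _ h'))
  obtain ⟨μ, hμ, hμU, hμd⟩ := hL.neg_dual_of_not_initial hU hpL hp (fun h' => hpA (hI _ h'))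
  have h2 : ι = -κ + S.E β p • μ := by
    refine eq_of_forall (S := S) hιU.1 (U.add_mem (U.neg_mem hκU) (U.smul_mem _ hμU))
      fun u hu => ?_
    have h3 := h1 u hu
    have h4 := hκd u hu
    have h5 := hμd u hu
    simp only [map_sub, map_smul, LinearMap.sub_apply, LinearMap.smul_apply, smul_eq_mul,
      h4, h5, map_add, map_neg] at h3 ⊢
    linarith
  obtain ⟨f, hf⟩ := hL.exists_pos_functional
  have h3 := congrArg f h2
  simp only [map_add, map_neg, map_smul, smul_eq_mul] at h3
  nlinarith [hf ι hι, hf κ hκ, mul_nonneg (neg_nonneg.2 h0) (hf μ hμ).le]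

theorem inf_ker_mem_initialFree {Z : Submodule ℝ V}
    (hZ : Z ∈ S.initialFree L U (A ++ [p])) (hpZ : p ∈ Z) :
    Z ⊓ LinearMap.ker (S.E p) ∈ S.initialFree L (U ⊓ LinearMap.ker (S.E p)) A := by
  have hpL : p ∈ L := by rw [h]; simp
  have hp1 := hL.E_self hpL
  obtain ⟨hZl, hZU, hZr⟩ := mem_initialFree.1 hZ
  refine mem_initialFree.2 ⟨S.inf_right Z hZl p (hL.root hpL) hpZ, inf_le_inf_right _ hZU, ?_⟩
  intro γ hγ hγZ
  rw [mem_inf_ker] at hγZ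
  have hγA : γ ∈ A := by
    rcases List.mem_append.1 (hZr γ hγ hγZ.1).1 with h' | h'
    · exact h'
    · rw [List.mem_singleton.1 h', hp1] at hγZ
      norm_num at hγZ
  refine ⟨hγA, fun hγI => ?_⟩
  obtain ⟨-, hγU, κ, hκ, hκU, hd⟩ := mem_initial.1 hγI
  rw [mem_inf_ker] at hγU hκU
  have ha := (hL.before h hγA).1
  have h1 := dual_reflect (s := 1) hp hp1 hκU.2 (fun v hv => by rw [one_mul, hd v hv])
  have hr := S.refl_mem p (hL.root hpL) γ (hL.root hγ)
  rw [hγU.2, add_zero] at hr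
  have hτZ : γ - S.E γ p • p ∈ Z := sub_mem hγZ.1 (Z.smul_mem _ hpZ)
  rcases hL.mem_or_neg_mem hr with h' | h'
  · exact (hZr _ h' hτZ).2 (mem_initial.2 ⟨h', hZU hτZ, κ, hκ, hκU.1, fun v hv => by
      rw [h1 v hv, one_mul]⟩)
  · rcases List.mem_append.1 (hZr _ h' (Z.neg_mem hτZ)).1 with h2 | h2
    · have h3 := hL.neg_not_mem_of_before h ha hγU.2 h2
      rw [h3] at h'
      simp at h'
      exact hL.disj γ hγ h'
    · have h3 : S.E p (-(γ - S.E γ p • p)) = S.E γ p := by simp [hγU.2, hp1]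
      rw [List.mem_singleton.1 h2, hp1] at h3
      rw [← h3] at h2
      simp at h2
      exact hL.ne_zero hγ h2

/-- The reflection in `p` of a positive root of `Z'`, where `Z'` is initial-free. -/
theorem reflect_of_initialFree (hI : ∀ P ∈ S.initial L U, P ∈ A) {Z : Submodule ℝ V}
    (hZ : Z ∈ S.initialFree L (U ⊓ LinearMap.ker (S.E p)) A) {γ : V} (hγ : γ ∈ L)
    (hγZ : γ ∈ Z) :
    γ - S.E γ p • p ∈ A ∧ γ - S.E γ p • p ∉ S.initial L U := by
  have hpL : p ∈ L := by rw [h]; simp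
  have hp1 := hL.E_self hpL
  have hU' := S.inf_right U hU p (hL.root hpL) hp
  obtain ⟨hZl, hZU, hZr⟩ := mem_initialFree.1 hZ
  have hγU := mem_inf_ker.1 (hZU hγZ)
  obtain ⟨hγA, hγI⟩ := hZr γ hγ hγZ
  obtain ⟨κ, hκ, hκU, hκd⟩ := hL.neg_dual_of_not_initial hU' hγ (hZU hγZ) hγI
  rw [mem_inf_ker] at hκU
  have ha := (hL.before h hγA).1
  have h1 := dual_reflect (s := -1) hp hp1 hκU.2 (fun v hv => by rw [hκd v hv]; ring)
  have hr := S.refl_mem p (hL.root hpL) γ (hL.root hγ)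
  rw [hγU.2, add_zero] at hr
  have hτU : γ - S.E γ p • p ∈ U := sub_mem hγU.1 (U.smul_mem _ hp)
  have hτL : γ - S.E γ p • p ∈ L := by
    refine (hL.mem_or_neg_mem hr).resolve_right fun h' => ?_
    have h2 : -(γ - S.E γ p • p) ∈ S.initial L U := mem_initial.2
      ⟨h', U.neg_mem hτU, κ, hκ, hκU.1, fun v hv => by
        rw [map_neg, LinearMap.neg_apply, h1 v hv]; ring⟩
    have h3 := hL.neg_not_mem_of_before h ha hγU.2 (hI _ h2)
    rw [h3] at h'
    simp at h'
    exact hL.disj γ hγ h'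
  refine ⟨?_, hL.not_initial_of_neg_dual hκ hκU.1 fun v hv => by rw [h1 v hv]; ring⟩
  have h2 : S.E p (γ - S.E γ p • p) = -S.E γ p := by simp [hγU.2, hp1]
  by_contra hA
  have h3 := hL.E_nonneg_of_not_before h hτL hA
  have h4 : S.E γ p = 0 := by linarith
  rw [h4] at hA
  simp at hA
  exact hA hγA

theorem initial_or_orthogonal (hI : ∀ P ∈ S.initial L U, P ∈ A) {Z : Submodule ℝ V}
    (hZ : Z ∈ S.initialFree L (U ⊓ LinearMap.ker (S.E p)) A) {ε : V} (hε : ε ∈ L)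
    (hεZ : ε ∈ span ℝ {p} ⊔ Z) (hεp : S.E ε p = 0) : ε ∈ A ∧ ε ∉ S.initial L U := by
  have hpL : p ∈ L := by rw [h]; simp
  have hp1 := hL.E_self hpL
  obtain ⟨hZl, hZU, hZr⟩ := mem_initialFree.1 hZ
  have hr := S.refl_mem p (hL.root hpL) ε (hL.root hε)
  rw [hεp, zero_add] at hr
  have hγZ : ε - S.E p ε • p ∈ Z := by
    obtain ⟨x, hx, z, hz, rfl⟩ := Submodule.mem_sup.1 hεZ
    obtain ⟨a, rfl⟩ := mem_span_singleton.1 hx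
    have := (mem_inf_ker.1 (hZU hz)).2
    simpa [hp1, this] using hz
  have e : ∀ s : ℝ, s • (ε - S.E p ε • p) - S.E (s • (ε - S.E p ε • p)) p • p = s • ε := by
    intro s
    simp only [map_smul, map_sub, LinearMap.sub_apply, LinearMap.smul_apply, hεp, hp1,
      smul_eq_mul]
    module
  rcases hL.mem_or_neg_mem hr with h' | h'
  · have h2 := hL.reflect_of_initialFree h hU hp hI hZ h' hγZ
    have h3 := e 1
    rw [one_smul, one_smul] at h3
    rwa [h3] at h2
  · have h2 := hL.reflect_of_initialFree h hU hp hI hZ h' (Z.neg_mem hγZ)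
    have h3 := e (-1)
    rw [neg_one_smul, neg_one_smul] at h3
    rw [h3] at h2
    have : -ε ∈ L := by rw [h]; simp [h2.1]
    exact absurd this (hL.disj ε hε)

theorem sup_mem_initialFree (hI : ∀ P ∈ S.initial L U, P ∈ A) {Z : Submodule ℝ V}
    (hZ : Z ∈ S.initialFree L (U ⊓ LinearMap.ker (S.E p)) A) :
    span ℝ {p} ⊔ Z ∈ S.initialFree L U (A ++ [p]) := by
  have hpL : p ∈ L := by rw [h]; simp
  have hp1 := hL.E_self hpL
  obtain ⟨hZl, hZU, hZr⟩ := mem_initialFree.1 hZ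
  have hn := hL.nodup
  rw [h, List.nodup_append', List.nodup_cons] at hn
  have hpA : p ∉ A := fun h' => hn.2.2 h' (by simp)
  have hpI : p ∉ S.initial L U := fun h' => hpA (hI p h')
  have hZ'l := S.sup_right Z hZl p (hL.root hpL) (fun u hu => (mem_inf_ker.1 (hZU hu)).2)
  have hpZ' : p ∈ span ℝ {p} ⊔ Z := Submodule.mem_sup_left (mem_span_singleton_self p)
  have hZ'U : span ℝ {p} ⊔ Z ≤ U :=
    sup_le (by simpa [span_le] using hp) (hZU.trans inf_le_left)
  set Y := span ℝ {p} ⊔ Z with hY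
  have hlast : ∀ δ ∈ L, δ ∈ Y → δ ∈ A ∨ δ = p := by
    intro δ hδ hδY
    have hδ' := hδ
    rw [h] at hδ'
    rcases List.mem_append.1 hδ' with h' | h'
    · exact Or.inl h'
    rcases List.mem_cons.1 h' with h' | h'
    · exact Or.inr h'
    exfalso
    obtain ⟨ε, hεB, hεY, hεp⟩ := hL.exists_adjacent h hZ'l hpZ' ⟨δ, h', hδY⟩
    have := (hL.initial_or_orthogonal h hU hp hI hZ (by rw [h]; simp [hεB]) hεY hεp).1
    exact hn.2.2 this (by simp [hεB])
  have hnn : ∀ δ ∈ L, δ ∈ Y → 0 ≤ S.E δ p := by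
    intro δ hδ hδY
    rcases hlast δ hδ hδY with h' | rfl
    · exact (hL.before h h').1
    · rw [hp1]; norm_num
  obtain ⟨P, α, hPI, -, hα, hPα, hexp⟩ := hL.exists_dual_basis_expand hZ'l
  have hi0 : ∃ i, α i = p := by
    by_contra! hcon
    have h1 := congrArg (S.E p) (hexp p hpZ')
    rw [hp1, map_sum] at h1
    have : ∑ i, S.E p (S.E (P i) p • α i) ≤ 0 := by
      refine Finset.sum_nonpos fun i _ => ?_
      rw [map_smul, smul_eq_mul]
      refine mul_nonpos_of_nonneg_of_nonpos (hL.initial_nonneg hZ'l (hPI i) hpL hpZ') ?_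
      exact (hL.before h ((hlast _ (hα i).1 (hα i).2).resolve_right (hcon i))).2
    linarith
  obtain ⟨i0, hi0⟩ := hi0
  have horth : ∀ k, k ≠ i0 → S.E (α k) p = 0 := by
    intro k hk
    by_contra hne
    have hZ'' := S.inf_left Y hZ'l p (hL.root hpL) hpZ'
    have hpos : 0 < S.E (α k) p := lt_of_le_of_ne (hnn _ (hα k).1 (hα k).2) (Ne.symm hne)
    have hle : Y ⊓ LinearMap.ker (S.E.flip p) ≤ LinearMap.ker (S.E (P k)) := by
      refine (S.span_roots _ hZ'').trans ?_
      rw [span_le]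
      have main : ∀ δ ∈ L, δ ∈ Y → S.E δ p = 0 → S.E (P k) δ = 0 := by
        intro δ hδ hδY hδp
        have h1 := congrArg (S.E.flip p) (hexp δ hδY)
        rw [LinearMap.flip_apply, hδp, map_sum] at h1
        have h2 := (Finset.sum_eq_zero_iff_of_nonneg (fun i _ => by
          rw [map_smul, smul_eq_mul, LinearMap.flip_apply]
          exact mul_nonneg (hL.initial_nonneg hZ'l (hPI i) hδ hδY) (hnn _ (hα i).1 (hα i).2))).1
          h1.symm k (Finset.mem_univ _)
        rw [map_smul, smul_eq_mul, LinearMap.flip_apply] at h2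
        exact (mul_eq_zero.1 h2).resolve_right hne
      rintro δ ⟨hδ, hδY, hδp⟩
      simp only [SetLike.mem_coe, LinearMap.mem_ker, LinearMap.flip_apply] at hδp ⊢
      rcases hL.mem_or_neg_mem hδ with h' | h'
      · exact main δ h' hδY hδp
      · have := main (-δ) h' (Y.neg_mem hδY) (by simp [hδp])
        simpa using this
    have h1 : α k - S.E (α k) p • p ∈ Y ⊓ LinearMap.ker (S.E.flip p) := by
      refine ⟨sub_mem (hα k).2 (Y.smul_mem _ hpZ'), ?_⟩
      simp [hp1]
    have h2 := hle h1
    have h3 : S.E (P k) p = 0 := by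
      have := hPα k i0
      rwa [hi0, if_neg hk] at this
    simp [h3, hPα] at h2
  have hαI : ∀ i, α i ∉ S.initial L U := by
    intro i
    by_cases hi : i = i0
    · rw [hi, hi0]
      exact hpI
    · exact (hL.initial_or_orthogonal h hU hp hI hZ (hα i).1 (hα i).2 (horth i hi)).2
  refine mem_initialFree.2 ⟨hZ'l, hZ'U, fun δ hδ hδY => ⟨?_, fun hδI => ?_⟩⟩
  · rcases hlast δ hδ hδY with h' | h' <;> simp [h']
  · have := fun i => hL.neg_dual_of_not_initial hU (hα i).1 (hZ'U (hα i).2) (hαI i)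
    choose κ hκ hκU hκd using this
    obtain ⟨-, -, ι, hι, hιU, hd⟩ := mem_initial.1 hδI
    have h1 : ι = -∑ i, S.E (P i) δ • κ i := by
      refine eq_of_forall (S := S) hιU
        (U.neg_mem (U.sum_mem fun i _ => U.smul_mem _ (hκU i))) fun u hu => ?_
      rw [← hd u hu]
      conv_lhs => rw [hexp δ hδY]
      simp only [map_sum, map_smul, LinearMap.sum_apply, LinearMap.smul_apply, map_neg,
        smul_eq_mul, hκd _ u hu, mul_neg, Finset.sum_neg_distrib]
    obtain ⟨f, hf⟩ := hL.exists_pos_functional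
    have h2 := congrArg f h1
    rw [map_neg, map_sum] at h2
    have h3 : 0 ≤ ∑ i, f (S.E (P i) δ • κ i) := Finset.sum_nonneg fun i _ => by
      rw [map_smul, smul_eq_mul]
      exact mul_nonneg (hL.initial_nonneg hZ'l (hPI i) hδ hδY) (hf _ (hκ i)).le
    linarith [hf ι hι]

end Step

end IsPosList

end EulerSystem

end EulerSystems

section EulerSystems

open Module Submodule

variable {V : Type*} [AddCommGroup V] [Module ℝ V] [FiniteDimensional ℝ V]

namespace EulerSystem

variable {S : EulerSystem V}

namespace IsPosList

variable {L : List V} (hL : S.IsPosList L)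
include hL

theorem initial_bot : S.initial L ⊥ = ∅ := by
  ext P
  simp only [mem_initial, Finset.notMem_empty, iff_false, not_and]
  intro hP hP0
  exact absurd ((mem_bot ℝ).1 hP0) (hL.ne_zero hP)

theorem le_of_roots {Z U : Submodule ℝ V} (hZ : Z ∈ S.lat) (h : ∀ γ ∈ L, γ ∈ Z → γ ∈ U) :
    Z ≤ U := by
  refine (S.span_roots Z hZ).trans ?_
  rw [span_le]
  rintro β ⟨hβ, hβZ⟩
  rcases hL.mem_or_neg_mem hβ with h' | h'
  · exact h _ h' hβZ
  · simpa using U.neg_mem (h _ h' (Z.neg_mem hβZ))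

open scoped Classical in
theorem card_initialFree_concat {A B : List V} {p : V} (h : L = A ++ p :: B)
    {U : Submodule ℝ V} (hU : U ∈ S.lat) (hp : p ∈ U) (hI : ∀ P ∈ S.initial L U, P ∈ A) :
    (S.initialFree L U (A ++ [p])).card = (S.initialFree L U A).card +
      (S.initialFree L (U ⊓ LinearMap.ker (S.E p)) A).card := by
  have hpL : p ∈ L := by rw [h]; simp
  have hp1 := hL.E_self hpL
  have hn := hL.nodup
  rw [h, List.nodup_append', List.nodup_cons] at hn
  have hpA : p ∉ A := fun h' => hn.2.2 h' (by simp)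
  rw [← Finset.card_filter_add_card_filter_not (p ∈ ·), add_comm]
  congr 1
  · congr 1
    ext Z
    simp only [Finset.mem_filter, mem_initialFree]
    constructor
    · rintro ⟨⟨h1, h2, h3⟩, h4⟩
      refine ⟨h1, h2, fun γ hγ hγZ => ⟨?_, (h3 γ hγ hγZ).2⟩⟩
      rcases List.mem_append.1 (h3 γ hγ hγZ).1 with h' | h'
      · exact h'
      · rw [List.mem_singleton.1 h'] at hγZ
        exact absurd hγZ h4
    · rintro ⟨h1, h2, h3⟩
      exact ⟨⟨h1, h2, fun γ hγ hγZ => ⟨List.mem_append_left _ (h3 γ hγ hγZ).1,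
        (h3 γ hγ hγZ).2⟩⟩, fun hpZ => hpA (h3 p hpL hpZ).1⟩
  · refine Finset.card_nbij' (fun Z => Z ⊓ LinearMap.ker (S.E p)) (fun Z => span ℝ {p} ⊔ Z)
      ?_ ?_ ?_ ?_
    · intro Z hZ
      obtain ⟨h1, h2⟩ := Finset.mem_filter.1 hZ
      exact hL.inf_ker_mem_initialFree h hU hp h1 h2
    · intro Z hZ
      exact Finset.mem_filter.2 ⟨hL.sup_mem_initialFree h hU hp hI hZ,
        Submodule.mem_sup_left (mem_span_singleton_self p)⟩
    · intro Z hZ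
      obtain ⟨h1, h2⟩ := Finset.mem_filter.1 hZ
      apply le_antisymm
      · exact sup_le (by simpa [span_le] using h2) inf_le_left
      · intro v hv
        have : v = S.E p v • p + (v - S.E p v • p) := by abel
        rw [this]
        refine Submodule.add_mem_sup (smul_mem _ _ (mem_span_singleton_self p)) ?_
        exact mem_inf_ker.2 ⟨sub_mem hv (Z.smul_mem _ h2), by simp [hp1]⟩
    · intro Z hZ
      have hZp : ∀ z ∈ Z, S.E p z = 0 := fun z hz =>
        (mem_inf_ker.1 ((mem_initialFree.1 hZ).2.1 hz)).2
      apply le_antisymm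
      · intro v hv
        obtain ⟨hv1, hv2⟩ := mem_inf_ker.1 hv
        obtain ⟨x, hx, z, hz, rfl⟩ := Submodule.mem_sup.1 hv1
        obtain ⟨a, rfl⟩ := mem_span_singleton.1 hx
        simp only [map_add, map_smul, hp1, hZp z hz, smul_eq_mul, mul_one, add_zero] at hv2
        simpa [hv2] using hz
      · exact fun z hz => mem_inf_ker.2 ⟨Submodule.mem_sup_right hz, hZp z hz⟩

open scoped Classical in
theorem cliqueCount_prefix (A : List V) : ∀ B, L = A ++ B → ∀ U ∈ S.lat,
    cliqueCount S.E U A =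
      if ∀ P ∈ S.initial L U, P ∈ A then (S.initialFree L U A).card else 0 := by
  induction A using List.reverseRecOn with
  | nil =>
    intro B _ U hU
    by_cases hU0 : U = ⊥
    · subst hU0
      rw [cliqueCount_nil_bot, if_pos (by simp [hL.initial_bot])]
      symm
      rw [Finset.card_eq_one]
      refine ⟨⊥, ?_⟩
      ext Z
      rw [mem_initialFree, Finset.mem_singleton]
      constructor
      · exact fun h => le_bot_iff.1 h.2.1
      · rintro rfl
        exact ⟨S.bot_mem, le_rfl, fun γ hγ hγ0 => absurd ((mem_bot ℝ).1 hγ0) (hL.ne_zero hγ)⟩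
    · rw [cliqueCount_nil_of_ne hU0, if_neg]
      intro hcon
      have h1 := hL.card_initial hU
      have h2 : S.initial L U = ∅ := Finset.eq_empty_of_forall_notMem (by simpa using hcon)
      rw [h2, Finset.card_empty] at h1
      exact hU0 (Submodule.finrank_eq_zero.1 h1.symm)
  | append_singleton A p ih =>
    intro B h U hU
    have h' : L = A ++ p :: B := by simp [h]
    have hpL : p ∈ L := by rw [h']; simp
    have hp1 := hL.E_self hpL
    have hn := hL.nodup
    rw [h', List.nodup_append', List.nodup_cons] at hn
    have hpA : p ∉ A := fun h' => hn.2.2 h' (by simp)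
    rw [cliqueCount_concat _ _ _ hp1, ih _ h' U hU]
    by_cases hpU : p ∈ U
    swap
    · rw [if_neg hpU, add_zero]
      congr 1
      · apply propext
        refine forall₂_congr fun P hP => ?_
        have : P ≠ p := by rintro rfl; exact hpU (mem_initial.1 hP).2.1
        simp [this]
      · congr 1
        ext Z
        simp only [mem_initialFree]
        refine and_congr_right fun _ => and_congr_right fun hZU => ?_
        refine forall₃_congr fun γ _ hγZ => ?_
        have : γ ≠ p := by rintro rfl; exact hpU (hZU hγZ)
        simp [this]
    rw [if_pos hpU]
    set U' := U ⊓ LinearMap.ker (S.E p) with hU'def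
    have hU' : U' ∈ S.lat := S.inf_right U hU p (hL.root hpL) hpU
    have hfr := finrank_inf_ker (E := S.E) hpU hp1
    rw [← hU'def] at hfr
    rw [ih _ h' U' hU']
    by_cases hI : ∀ P ∈ S.initial L U, P ∈ A ++ [p]
    swap
    · rw [if_neg hI, if_neg (fun h1 => hI fun P hP => List.mem_append_left _ (h1 P hP)), zero_add,
        if_neg]
      intro hcon
      push Not at hI
      obtain ⟨q, hqI, hqA⟩ := hI
      obtain ⟨hqL, hqU, -⟩ := mem_initial.1 hqI
      have hqB : q ∈ B := by
        rw [h] at hqL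
        exact (List.mem_append.1 hqL).resolve_left hqA
      obtain ⟨C, D, rfl⟩ := List.append_of_mem hqB
      have e : L = (A ++ p :: C) ++ q :: D := by simp [h']
      have hq := (hL.mem_initial_iff hU e hqU).1 hqI
      have h1 : U' ≤ LinearMap.ker (S.E q) := hL.initial_span hU' _ fun P hP => by
        rw [LinearMap.mem_ker]
        exact hq P (by simp [hcon P hP]) (mem_inf_ker.1 (mem_initial.1 hP).2.1).1
      have h2 : q - S.E p q • p ∈ U' := mem_inf_ker.2
        ⟨sub_mem hqU (U.smul_mem _ hpU), by simp [hp1]⟩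
      have h3 := h1 h2
      have h4 := hq p (by simp) hpU
      simp [hL.E_self hqL, h4] at h3
    rw [if_pos hI]
    by_cases hpI : p ∈ S.initial L U
    · rw [if_neg (fun h1 => hpA (h1 p hpI)), zero_add]
      have hp0 := (hL.mem_initial_iff hU h' hpU).1 hpI
      have hIA : ∀ P ∈ S.initial L U, P ≠ p → P ∈ A := fun P hP hPp => by
        simpa [hPp] using hI P hP
      have hsub : (S.initial L U).erase p ⊆ S.initial L U' := by
        intro P hP
        obtain ⟨hPp, hP⟩ := Finset.mem_erase.1 hP
        have hPU := (mem_initial.1 hP).2.1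
        exact hL.initial_mono hU hU' inf_le_left hP
          (mem_inf_ker.2 ⟨hPU, hp0 P (hIA P hP hPp) hPU⟩)
      have heq := Finset.eq_of_subset_of_card_le hsub (by
        rw [Finset.card_erase_of_mem hpI, hL.card_initial hU, hL.card_initial hU']
        omega)
      have hmem : ∀ P, P ∈ S.initial L U' ↔ P ≠ p ∧ P ∈ S.initial L U := fun P => by
        rw [← heq, Finset.mem_erase]
      rw [if_pos (fun P hP => hIA P ((hmem P).1 hP).2 ((hmem P).1 hP).1)]
      congr 1
      ext Z
      simp only [mem_initialFree]
      constructor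
      · rintro ⟨h1, h2, h3⟩
        refine ⟨h1, h2.trans inf_le_left, fun γ hγ hγZ => ?_⟩
        obtain ⟨h4, h5⟩ := h3 γ hγ hγZ
        refine ⟨List.mem_append_left _ h4, fun h6 => h5 ((hmem γ).2 ⟨?_, h6⟩)⟩
        rintro rfl
        exact hpA h4
      · rintro ⟨h1, h2, h3⟩
        have h4 : ∀ γ ∈ L, γ ∈ Z → γ ∈ A := fun γ hγ hγZ => by
          obtain ⟨h5, h6⟩ := h3 γ hγ hγZ
          have : γ ≠ p := by rintro rfl; exact h6 hpI
          simpa [this] using h5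
        refine ⟨h1, hL.le_of_roots h1 fun γ hγ hγZ => mem_inf_ker.2
          ⟨h2 hγZ, hp0 γ (h4 γ hγ hγZ) (h2 hγZ)⟩, fun γ hγ hγZ => ⟨h4 γ hγ hγZ, fun h5 => ?_⟩⟩
        exact (h3 γ hγ hγZ).2 ((hmem γ).1 h5).2
    · have hIA : ∀ P ∈ S.initial L U, P ∈ A := fun P hP => by
        have : P ≠ p := by rintro rfl; exact hpI hP
        simpa [this] using hI P hP
      rw [if_pos hIA, if_pos (fun P hP => hL.initial_inf_ker_subset h' hU hpU hIA hP),
        hL.card_initialFree_concat h' hU hpU hIA]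

end IsPosList

end EulerSystem

end EulerSystems

section EulerSystems

open Module Submodule

variable {V : Type*} [AddCommGroup V] [Module ℝ V] [FiniteDimensional ℝ V]

theorem exists_repr_right {E : V →ₗ[ℝ] V →ₗ[ℝ] ℝ} (hE : ∀ v, v ≠ 0 → 0 < E v v)
    (Z : Submodule ℝ V) (φ : V →ₗ[ℝ] ℝ) : ∃ z ∈ Z, ∀ u ∈ Z, E u z = φ u := by
  let T : Z →ₗ[ℝ] Dual ℝ Z := (Z.dualRestrict.comp E.flip).comp Z.subtype
  have hT : Function.Injective T := by
    rw [← LinearMap.ker_eq_bot, LinearMap.ker_eq_bot']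
    intro z hz
    by_contra h0
    have h1 := LinearMap.congr_fun hz z
    have h2 : E (z : V) (z : V) = 0 := by simpa [T] using h1
    exact (hE z (by simpa using h0)).ne' h2
  have hT' := (LinearMap.injective_iff_surjective_of_finrank_eq_finrank
    (Subspace.dual_finrank_eq (K := ℝ) (V := Z)).symm).1 hT
  obtain ⟨z, hz⟩ := hT' (Z.dualRestrict φ)
  refine ⟨z, z.2, fun u hu => ?_⟩
  have := LinearMap.congr_fun hz ⟨u, hu⟩
  simpa [T] using this

theorem exists_repr_left {E : V →ₗ[ℝ] V →ₗ[ℝ] ℝ} (hE : ∀ v, v ≠ 0 → 0 < E v v)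
    (Z : Submodule ℝ V) (φ : V →ₗ[ℝ] ℝ) : ∃ z ∈ Z, ∀ u ∈ Z, E z u = φ u :=
  exists_repr_right (E := E.flip) (by simpa using hE) Z φ

theorem mem_of_double_perp {E : V →ₗ[ℝ] V →ₗ[ℝ] ℝ} (hE : ∀ v, v ≠ 0 → 0 < E v v)
    {X Z : Submodule ℝ V} (hZ : Z ≤ X) {v : V} (hv : v ∈ X)
    (h : ∀ y ∈ X, (∀ z ∈ Z, E z y = 0) → E v y = 0) : v ∈ Z := by
  obtain ⟨z, hz, hzu⟩ := exists_repr_right hE Z (E.flip v)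
  have h1 : ∀ u ∈ Z, E u (v - z) = 0 := fun u hu => by rw [map_sub, hzu u hu]; simp
  have h2 := h (v - z) (sub_mem hv (hZ hz)) h1
  have h3 := h1 z hz
  by_contra hcon
  have h4 : v - z ≠ 0 := fun h0 => hcon (by rwa [sub_eq_zero.1 h0])
  have h5 := hE _ h4
  rw [map_sub E v z, LinearMap.sub_apply, h2, h3] at h5
  simp at h5

/-- The part of `X` orthogonal to `Z` on the right. -/
def rightPerp (E : V →ₗ[ℝ] V →ₗ[ℝ] ℝ) (X Z : Submodule ℝ V) : Submodule ℝ V :=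
  X ⊓ ⨅ z : Z, LinearMap.ker (E z)

theorem mem_rightPerp {E : V →ₗ[ℝ] V →ₗ[ℝ] ℝ} {X Z : Submodule ℝ V} {v : V} :
    v ∈ rightPerp E X Z ↔ v ∈ X ∧ ∀ z ∈ Z, E z v = 0 := by
  simp [rightPerp]

theorem rightPerp_flip_rightPerp {E : V →ₗ[ℝ] V →ₗ[ℝ] ℝ} (hE : ∀ v, v ≠ 0 → 0 < E v v)
    {X Z : Submodule ℝ V} (hZ : Z ≤ X) : rightPerp E.flip X (rightPerp E X Z) = Z := by
  apply le_antisymm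
  · intro v hv
    obtain ⟨h1, h2⟩ := mem_rightPerp.1 hv
    exact mem_of_double_perp hE hZ h1 fun y hy hyz => h2 y (mem_rightPerp.2 ⟨hy, hyz⟩)
  · exact fun v hv => mem_rightPerp.2 ⟨hZ hv, fun y hy => (mem_rightPerp.1 hy).2 v hv⟩

namespace EulerSystem

variable {S : EulerSystem V}

theorem rightPerp_mem {X Z : Submodule ℝ V} (hX : X ∈ S.lat) (hZ : Z ∈ S.lat) (h : Z ≤ X) :
    rightPerp S.E X Z ∈ S.lat := by
  obtain ⟨Y, hY, hYm⟩ := S.compl_right X hX Z hZ h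
  have : rightPerp S.E X Z = Y := by ext v; rw [mem_rightPerp, hYm]
  rwa [this]

theorem rightPerp_flip_mem {X Z : Submodule ℝ V} (hX : X ∈ S.lat) (hZ : Z ∈ S.lat) (h : Z ≤ X) :
    rightPerp S.E.flip X Z ∈ S.lat := by
  obtain ⟨Y, hY, hYm⟩ := S.compl_left X hX Z hZ h
  have : rightPerp S.E.flip X Z = Y := by ext v; rw [mem_rightPerp, hYm]; simp
  rwa [this]

namespace IsPosList

variable {L : List V} (hL : S.IsPosList L)
include hL

open scoped Classical in
/-- The number of maximal cliques of the whole positive list. -/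
theorem cliqueCount_full {X : Submodule ℝ V} (hX : X ∈ S.lat) : cliqueCount S.E X L =
    (S.lat.filter fun Y => Y ≤ X ∧ ∀ P ∈ S.initial L X, ∃ v ∈ Y, S.E P v ≠ 0).card := by
  rw [hL.cliqueCount_prefix L [] (by simp) X hX, if_pos (fun P hP => (mem_initial.1 hP).1)]
  have hE' : ∀ v, v ≠ 0 → 0 < S.E.flip v v := by simpa using S.E_pos
  refine Finset.card_nbij' (fun Z => rightPerp S.E X Z) (fun Z => rightPerp S.E.flip X Z)
      ?_ ?_ ?_ ?_
  · intro Z hZ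
    obtain ⟨h1, h2, h3⟩ := mem_initialFree.1 hZ
    refine Finset.mem_filter.2 ⟨rightPerp_mem hX h1 h2, inf_le_left, fun P hP => ?_⟩
    obtain ⟨hPL, hPX, -⟩ := mem_initial.1 hP
    by_contra! hcon
    have : P ∈ Z := mem_of_double_perp S.E_pos h2 hPX
      fun y hy hyz => hcon y (mem_rightPerp.2 ⟨hy, hyz⟩)
    exact (h3 P hPL this).2 hP
  · intro Y hY
    obtain ⟨h1, h2, h3⟩ := Finset.mem_filter.1 hY
    refine mem_initialFree.2 ⟨rightPerp_flip_mem hX h1 h2, inf_le_left, fun γ hγ hγZ =>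
      ⟨hγ, fun hγI => ?_⟩⟩
    obtain ⟨v, hv, hv0⟩ := h3 γ hγI
    exact hv0 ((mem_rightPerp.1 hγZ).2 v hv)
  · intro Z hZ
    exact rightPerp_flip_rightPerp S.E_pos (mem_initialFree.1 hZ).2.1
  · intro Y hY
    exact rightPerp_flip_rightPerp hE' (Finset.mem_filter.1 hY).2.1

/-- Two families of functionals, nonnegative on the positive roots of `U` and admitting dual
bases of positive roots, agree on `U`. -/
theorem functional_unique {U : Submodule ℝ V} {ι κ : Type} [Fintype ι] [Fintype κ]
    [DecidableEq ι] [DecidableEq κ] (f : ι → V →ₗ[ℝ] ℝ) (α : ι → V) (g : κ → V →ₗ[ℝ] ℝ)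
    (β : κ → V) (hι : Fintype.card ι = finrank ℝ U) (hκ : Fintype.card κ = finrank ℝ U)
    (hα : ∀ i, α i ∈ L ∧ α i ∈ U) (hβ : ∀ i, β i ∈ L ∧ β i ∈ U)
    (hf : ∀ i j, f i (α j) = if i = j then 1 else 0)
    (hg : ∀ i j, g i (β j) = if i = j then 1 else 0)
    (hf0 : ∀ i, ∀ γ ∈ L, γ ∈ U → 0 ≤ f i γ) (hg0 : ∀ i, ∀ γ ∈ L, γ ∈ U → 0 ≤ g i γ) (i : ι) :
    ∃ j, ∀ v ∈ U, f i v = g j v := by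
  have key : ∀ {ι κ : Type} [Fintype ι] [Fintype κ]
    [DecidableEq ι] [DecidableEq κ] (f : ι → V →ₗ[ℝ] ℝ) (α : ι → V) (g : κ → V →ₗ[ℝ] ℝ)
    (β : κ → V) (_ : Fintype.card ι = finrank ℝ U) (_ : Fintype.card κ = finrank ℝ U)
    (_ : ∀ i, α i ∈ L ∧ α i ∈ U) (_ : ∀ i, β i ∈ L ∧ β i ∈ U)
    (_ : ∀ i j, f i (α j) = if i = j then 1 else 0)
    (_ : ∀ i j, g i (β j) = if i = j then 1 else 0)
    (_ : ∀ i, ∀ γ ∈ L, γ ∈ U → 0 ≤ f i γ) (_ : ∀ i, ∀ γ ∈ L, γ ∈ U → 0 ≤ g i γ) (i : ι),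
    ∃ j, β j = α i := by
    intro ι κ _ _ _ _ f α g β hι hκ hα hβ hf hg hf0 hg0 i
    have e1 := expand_of_dual g β hκ (fun i => (hβ i).2) hg (hα i).2
    have : ∃ j, g j (α i) ≠ 0 := by
      by_contra! hcon
      apply hL.ne_zero (hα i).1
      rw [e1]
      exact Finset.sum_eq_zero fun j _ => by rw [hcon j, zero_smul]
    obtain ⟨j, hj⟩ := this
    refine ⟨j, ?_⟩
    have h0 : ∀ i', i' ≠ i → f i' (β j) = 0 := by
      intro i' hi'
      have e2 := congrArg (f i') e1
      rw [hf, if_neg hi', map_sum] at e2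
      have := (Finset.sum_eq_zero_iff_of_nonneg (fun j _ => by
        rw [map_smul, smul_eq_mul]
        exact mul_nonneg (hg0 j _ (hα i).1 (hα i).2) (hf0 i' _ (hβ j).1 (hβ j).2))).1 e2.symm j
        (Finset.mem_univ _)
      rw [map_smul, smul_eq_mul] at this
      exact (mul_eq_zero.1 this).resolve_left hj
    have e3 := expand_of_dual f α hι (fun i => (hα i).2) hf (hβ j).2
    rw [Finset.sum_eq_single i (fun i' _ hi' => by rw [h0 i' hi', zero_smul])
      (fun h => absurd (Finset.mem_univ _) h)] at e3
    exact hL.eq_of_eq_smul (hα i).1 (hβ j).1 e3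
  obtain ⟨j, hj⟩ := key f α g β hι hκ hα hβ hf hg hf0 hg0 i
  refine ⟨j, fun v hv => ?_⟩
  have e := congrArg (f i) (expand_of_dual g β hκ (fun i => (hβ i).2) hg hv)
  rw [e, map_sum, Finset.sum_eq_single j]
  · rw [hj, map_smul, hf, if_pos rfl, smul_eq_mul, mul_one]
  · intro j' _ hj'
    obtain ⟨i', hi'⟩ := key g β f α hκ hι hβ hα hg hf hg0 hf0 j'
    have : i ≠ i' := by
      rintro rfl
      have h1 := hg j' j
      rw [hj, hi', hg, if_pos rfl, if_neg hj'] at h1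
      norm_num at h1
    rw [← hi', map_smul, hf, if_neg this, smul_zero]
  · exact fun h => absurd (Finset.mem_univ _) h

theorem initial_restrict {X : Submodule ℝ V} (hX : X ∈ S.lat) {p : V}
    (hp : p ∈ S.initial L X) :
    (∀ P ∈ S.initial L X, P ≠ p → ∃ Q ∈ S.initial L (X ⊓ LinearMap.ker (S.E p)),
      ∀ v ∈ X ⊓ LinearMap.ker (S.E p), S.E P v = S.E Q v) ∧
    (∀ Q ∈ S.initial L (X ⊓ LinearMap.ker (S.E p)), ∃ P ∈ S.initial L X, P ≠ p ∧
      ∀ v ∈ X ⊓ LinearMap.ker (S.E p), S.E P v = S.E Q v) := by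
  obtain ⟨hpL, hpX, -⟩ := mem_initial.1 hp
  have hp1 := hL.E_self hpL
  have hX' := S.inf_right X hX p (hL.root hpL) hpX
  have hfr := finrank_inf_ker (E := S.E) hpX hp1
  set X' := X ⊓ LinearMap.ker (S.E p) with hX'def
  obtain ⟨P, α, h1, h2, h3, h4, -⟩ := hL.exists_dual_basis_expand hX
  obtain ⟨Q, β, g1, g2, g3, g4, -⟩ := hL.exists_dual_basis_expand hX'
  obtain ⟨i0, hi0⟩ := h2 p hp
  have hcard : Fintype.card {i // i ≠ i0} = finrank ℝ X' := by
    rw [Fintype.card_subtype_compl, Fintype.card_fin, Fintype.card_subtype_eq]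
    omega
  have hα : ∀ i : {i // i ≠ i0}, α i ∈ L ∧ α i ∈ X' := fun i => ⟨(h3 i).1, mem_inf_ker.2
    ⟨(h3 i).2, by rw [← hi0, h4, if_neg i.2.symm]⟩⟩
  have hd : ∀ i j : {i // i ≠ i0}, S.E (P i) (α j) = if i = j then 1 else 0 := fun i j => by
    rw [h4]
    simp only [Subtype.ext_iff]
  have hn : ∀ i : {i // i ≠ i0}, ∀ γ ∈ L, γ ∈ X' → 0 ≤ S.E (P i) γ := fun i γ hγ hγX =>
    hL.initial_nonneg hX (h1 i) hγ (mem_inf_ker.1 hγX).1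
  have gn : ∀ i, ∀ γ ∈ L, γ ∈ X' → 0 ≤ S.E (Q i) γ := fun i γ hγ hγX =>
    hL.initial_nonneg hX' (g1 i) hγ hγX
  constructor
  · intro P' hP' hP'p
    obtain ⟨i, rfl⟩ := h2 P' hP'
    have hi : i ≠ i0 := by rintro rfl; exact hP'p hi0
    obtain ⟨j, hj⟩ := hL.functional_unique (U := X') (fun i : {i // i ≠ i0} => S.E (P i))
      (fun i => α i) (fun j => S.E (Q j)) β hcard (by simp) hα g3 hd g4 hn gn ⟨i, hi⟩
    exact ⟨Q j, g1 j, hj⟩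
  · intro Q' hQ'
    obtain ⟨j, rfl⟩ := g2 Q' hQ'
    obtain ⟨i, hi⟩ := hL.functional_unique (U := X') (fun j => S.E (Q j)) β
      (fun i : {i // i ≠ i0} => S.E (P i)) (fun i => α i) (by simp) hcard g3 hα g4 hd gn hn j
    refine ⟨P i, h1 i, fun h => ?_, fun v hv => (hi v hv).symm⟩
    have e := h4 i i
    rw [h, ← hi0, h4, if_neg i.2.symm] at e
    norm_num at e

open scoped Classical in
theorem cliqueCount_extended_aux (K : List V) : ∀ X ∈ S.lat, K.Nodup →
    (∀ P ∈ K, P ∈ S.initial L X) → K.Pairwise (fun γ δ => S.E δ γ = 0) →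
    cliqueCount S.E X (L ++ K) =
      (S.lat.filter fun Y => Y ≤ X ∧ ∀ P ∈ S.initial L X, P ∉ K →
        ∃ v ∈ Y, S.E P v ≠ 0).card := by
  induction K using List.reverseRecOn with
  | nil =>
    intro X hX _ _ _
    rw [List.append_nil, hL.cliqueCount_full hX]
    simp
  | append_singleton K p ih =>
    intro X hX hK hKI hpw
    rw [List.nodup_append'] at hK
    rw [List.pairwise_append] at hpw
    have hpK : p ∉ K := fun h => hK.2.2 h (by simp)
    have hpI : p ∈ S.initial L X := hKI p (by simp)
    obtain ⟨hpL, hpX, -⟩ := mem_initial.1 hpI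
    have hp1 := hL.E_self hpL
    have hX' := S.inf_right X hX p (hL.root hpL) hpX
    have hKI' : ∀ P ∈ K, P ∈ S.initial L (X ⊓ LinearMap.ker (S.E p)) := fun P hP => by
      have h1 := hKI P (by simp [hP])
      exact hL.initial_mono hX hX' inf_le_left h1 (mem_inf_ker.2
        ⟨(mem_initial.1 h1).2.1, hpw.2.2 P hP p (by simp)⟩)
    obtain ⟨r1, r2⟩ := hL.initial_restrict hX hpI
    rw [← List.append_assoc, cliqueCount_concat _ _ _ hp1, if_pos hpX,
      ih X hX hK.1 (fun P hP => hKI P (by simp [hP])) hpw.1,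
      ih _ hX' hK.1 hKI' hpw.1, ← Finset.card_filter_add_card_filter_not
        (s := S.lat.filter fun Y => Y ≤ X ∧ ∀ P ∈ S.initial L X, P ∉ K ++ [p] →
          ∃ v ∈ Y, S.E P v ≠ 0) (fun Y => ∃ v ∈ Y, S.E p v ≠ 0)]
    congr 2
    · ext Y
      simp only [Finset.mem_filter, List.mem_append, List.mem_singleton, not_or]
      constructor
      · rintro ⟨h1, h2, h3⟩
        exact ⟨⟨h1, h2, fun P hP hPK => h3 P hP hPK.1⟩, h3 p hpI hpK⟩
      · rintro ⟨⟨h1, h2, h3⟩, h4⟩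
        refine ⟨h1, h2, fun P hP hPK => ?_⟩
        by_cases hPp : P = p
        · rwa [hPp]
        · exact h3 P hP ⟨hPK, hPp⟩
    · ext Y
      simp only [Finset.mem_filter, List.mem_append, List.mem_singleton, not_or]
      have hdual : ∀ P ∈ S.initial L X, ∀ Q ∈ S.initial L X, P ≠ p → Q ≠ p →
          (∀ v ∈ X ⊓ LinearMap.ker (S.E p), S.E P v = S.E Q v) → P = Q := by
        intro P hP Q hQ hPp hQp hPQ
        obtain ⟨P', α, h1, h2, h3, h4, -⟩ := hL.exists_dual_basis_expand hX
        obtain ⟨i, rfl⟩ := h2 P hP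
        obtain ⟨j, rfl⟩ := h2 Q hQ
        obtain ⟨k, hk⟩ := h2 p hpI
        by_contra hne
        have hij : j ≠ i := by rintro rfl; exact hne rfl
        have hki : k ≠ i := by rintro rfl; exact hPp hk
        have := hPQ (α i) (mem_inf_ker.2 ⟨(h3 i).2, by rw [← hk, h4, if_neg hki]⟩)
        rw [h4, h4, if_pos rfl, if_neg hij] at this
        norm_num at this
      constructor
      · rintro ⟨h1, h2, h3⟩
        refine ⟨⟨h1, h2.trans inf_le_left, fun P hP hPK => ?_⟩, ?_⟩
        · obtain ⟨Q, hQ, hPQ⟩ := r1 P hP hPK.2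
          by_cases hQK : Q ∈ K
          · have hQp : Q ≠ p := by rintro rfl; exact hpK hQK
            have := hdual P hP Q (hKI Q (by simp [hQK])) hPK.2 hQp hPQ
            subst this
            exact absurd hQK hPK.1
          · obtain ⟨v, hv, hv0⟩ := h3 Q hQ hQK
            exact ⟨v, hv, by rwa [hPQ v (h2 hv)]⟩
        · push Not
          exact fun v hv => (mem_inf_ker.1 (h2 hv)).2
      · rintro ⟨⟨h1, h2, h3⟩, h4⟩
        push Not at h4
        have hYX' : Y ≤ X ⊓ LinearMap.ker (S.E p) := fun v hv =>
          mem_inf_ker.2 ⟨h2 hv, h4 v hv⟩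
        refine ⟨h1, hYX', fun Q hQ hQK => ?_⟩
        obtain ⟨P, hP, hPp, hPQ⟩ := r2 Q hQ
        have hPK : P ∉ K := by
          intro hPK
          have : P = Q := eq_of_forall' (S := S) (mem_initial.1 (hKI' P hPK)).2.1
            (mem_initial.1 hQ).2.1 hPQ
          exact hQK (this ▸ hPK)
        obtain ⟨v, hv, hv0⟩ := h3 P hP ⟨hPK, hPp⟩
        exact ⟨v, hv, by rwa [← hPQ v (hYX' hv)]⟩

open scoped Classical in
/-- Cliques in the list `L` extended by a second copy of the initial roots of `X` are
equinumerous with the members of the lattice below `X`. -/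
theorem cliqueCount_extended {K : List V} {X : Submodule ℝ V} (hX : X ∈ S.lat) (hK : K.Nodup)
    (hKI : ∀ P, P ∈ K ↔ P ∈ S.initial L X) (hpw : K.Pairwise (fun γ δ => S.E δ γ = 0)) :
    cliqueCount S.E X (L ++ K) = (S.lat.filter fun Y => Y ≤ X).card := by
  rw [hL.cliqueCount_extended_aux K X hX hK (fun P hP => (hKI P).1 hP) hpw]
  congr 1
  refine Finset.filter_congr fun Y _ => and_iff_left fun P hP hPK => absurd ((hKI P).2 hP) hPK

end IsPosList

end EulerSystem

end EulerSystems

section SublistSums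

variable {α β : Type*}

theorem List.sum_map_sum_map_comm (l : List α) (m : List β) (f : α → β → ℕ) :
    (l.map fun a => (m.map fun b => f a b).sum).sum =
      (m.map fun b => (l.map fun a => f a b).sum).sum := by
  induction l with
  | nil => simp
  | cons a l ih => simp [ih, List.sum_map_add]

theorem List.sum_sublists'_append (f : List α → ℕ) (A B : List α) :
    ((A ++ B).sublists'.map f).sum =
      (A.sublists'.map fun C => (B.sublists'.map fun D => f (C ++ D)).sum).sum := by
  induction A generalizing f with
  | nil => simp
  | cons a A ih =>
    simp only [List.cons_append, List.sublists'_cons, List.map_append, List.sum_append,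
      List.map_map, Function.comp_def, ih]

/-- Summing the lengths of weighted sublists by their entries. -/
theorem List.sum_sublists'_length (W : List α) : ∀ (f : List α → ℕ) (g : α → ℕ),
    (∀ A x B, W = A ++ x :: B →
      (A.sublists'.map fun C => (B.sublists'.map fun D => f (C ++ x :: D)).sum).sum = g x) →
    (W.sublists'.map fun C => C.length * f C).sum = (W.map g).sum := by
  induction W with
  | nil => simp
  | cons a W ih =>
    intro f g h
    have h0 := h [] a W rfl
    simp only [List.sublists'_nil, List.map_cons, List.map_nil, List.sum_cons, List.sum_nil,
      add_zero, List.nil_append] at h0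
    have h1 := ih (fun C => f C + f (a :: C)) g (by
      rintro A x B rfl
      have := h (a :: A) x B rfl
      simp only [List.sublists'_cons, List.map_append, List.sum_append,
        List.map_map, Function.comp_def, List.cons_append] at this
      simp only [List.sum_map_add]
      exact this)
    simp only [List.sublists'_cons, List.map_append, List.sum_append, List.map_map,
      Function.comp_def, List.length_cons, List.map_cons, List.sum_cons, ← h0, ← h1, mul_add,
      add_mul, one_mul, List.sum_map_add]
    omega

theorem List.flatMap_eq_append_cons {l : List α} {R : α → List β} {A B : List β} {x : β}
    (h : l.flatMap R = A ++ x :: B) : ∃ l₁ k l₂ A₁ B₁, l = l₁ ++ k :: l₂ ∧ R k = A₁ ++ x :: B₁ ∧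
      A = l₁.flatMap R ++ A₁ ∧ B = B₁ ++ l₂.flatMap R := by
  induction l generalizing A with
  | nil => simp at h
  | cons k l ih =>
    rw [List.flatMap_cons, List.append_eq_append_iff] at h
    rcases h with ⟨as, h1, h2⟩ | ⟨bs, h1, h2⟩
    · obtain ⟨l₁, k', l₂, A₁, B₁, rfl, h4, h5, h6⟩ := ih h2
      exact ⟨k :: l₁, k', l₂, A₁, B₁, rfl, h4, by simp [h1, h5], h6⟩
    · rcases List.cons_eq_append_iff.1 h2 with ⟨rfl, h3⟩ | ⟨as, rfl, h3⟩
      · obtain ⟨l₁, k', l₂, A₁, B₁, rfl, h4, h5, h6⟩ := ih (A := []) (by simpa using h3)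
        refine ⟨k :: l₁, k', l₂, A₁, B₁, rfl, h4, ?_, h6⟩
        have : R k = A := by simpa using h1
        rw [List.flatMap_cons, ← this, List.append_assoc, ← h5, List.append_nil]
      · exact ⟨[], k, l, A, as, rfl, h1, by simp, h3⟩

end SublistSums

section EulerSystems

open Module Submodule

variable {V : Type*} [AddCommGroup V] [Module ℝ V] [FiniteDimensional ℝ V]

open scoped Classical in
theorem cliqueCount_eq_sum (E : V →ₗ[ℝ] V →ₗ[ℝ] ℝ) (U : Submodule ℝ V) (A : List V) :
    cliqueCount E U A = (A.sublists'.map fun C => if C.Pairwise (fun γ δ => E δ γ = 0) ∧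
      (∀ v ∈ C, v ∈ U) ∧ C.length = finrank ℝ U then 1 else 0).sum := by
  rw [cliqueCount, (List.sublists_perm_sublists' A).countP_eq]
  generalize A.sublists' = l
  induction l with
  | nil => simp
  | cons a l ih =>
    rw [List.countP_cons, List.map_cons, List.sum_cons, ih, add_comm]
    simp

theorem cliqueCount_drop (E : V →ₗ[ℝ] V →ₗ[ℝ] ℝ) (A B : List V) {x : V} (hx : E x x = 1)
    (hB : ∀ b ∈ B, E b b = 1) : ∀ U : Submodule ℝ V, x ∉ U →
    cliqueCount E U (A ++ x :: B) = cliqueCount E U (A ++ B) := by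
  induction B using List.reverseRecOn with
  | nil =>
    intro U hU
    rw [cliqueCount_concat E U A hx, if_neg hU]
    simp
  | append_singleton B p ih =>
    intro U hU
    have hp : E p p = 1 := hB p (by simp)
    have ih' := ih fun b hb => hB b (by simp [hb])
    rw [← List.cons_append, ← List.append_assoc, ← List.append_assoc,
      cliqueCount_concat E U _ hp, cliqueCount_concat E U _ hp, ih' U hU,
      ih' _ (fun h => hU (mem_inf_ker.1 h).1)]

theorem cliqueCount_map_neg (E : V →ₗ[ℝ] V →ₗ[ℝ] ℝ) (A B : List V)
    (hB : ∀ b ∈ B, E b b = 1) : ∀ U : Submodule ℝ V,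
    cliqueCount E U (A ++ B.map Neg.neg) = cliqueCount E U (A ++ B) := by
  induction B using List.reverseRecOn with
  | nil => simp
  | append_singleton B p ih =>
    intro U
    have hp : E p p = 1 := hB p (by simp)
    have hp' : E (-p) (-p) = 1 := by simpa using hp
    have ih' := ih fun b hb => hB b (by simp [hb])
    have hk : LinearMap.ker (E (-p)) = LinearMap.ker (E p) := by ext; simp
    rw [List.map_append, List.map_cons, List.map_nil, ← List.append_assoc, ← List.append_assoc,
      cliqueCount_concat E U _ hp, cliqueCount_concat E U _ hp', ih' U, ih', hk]
    have hm : -p ∈ U ↔ p ∈ U := by simp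
    by_cases h : p ∈ U
    · rw [if_pos h, if_pos (hm.2 h)]
    · rw [if_neg h, if_neg (mt hm.1 h)]

/-- Left perpendicular of a vector. -/
def leftPerp (E : V →ₗ[ℝ] V →ₗ[ℝ] ℝ) (x : V) : Submodule ℝ V := ⊤ ⊓ LinearMap.ker (E.flip x)

theorem mem_leftPerp {E : V →ₗ[ℝ] V →ₗ[ℝ] ℝ} {x v : V} : v ∈ leftPerp E x ↔ E v x = 0 := by
  simp [leftPerp]

theorem finrank_leftPerp {E : V →ₗ[ℝ] V →ₗ[ℝ] ℝ} {x : V} (hx : E x x = 1) :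
    finrank ℝ (leftPerp E x) + 1 = finrank ℝ (⊤ : Submodule ℝ V) :=
  finrank_inf_ker (E := E.flip) (p := x) trivial hx

open scoped Classical in
/-- Maximal cliques through `x`, transported by the cyclic rotation of the list. -/
theorem sum_cliques_through {E : V →ₗ[ℝ] V →ₗ[ℝ] ℝ} {c : V →ₗ[ℝ] V}
    (hc : ∀ u v, E (c u) v = -E v u) (A B : List V) {x : V} (hx : E x x = 1) :
    (A.sublists'.map fun C => (B.sublists'.map fun D =>
      if (C ++ x :: D).Pairwise (fun γ δ => E δ γ = 0) ∧
      (∀ v ∈ C ++ x :: D, v ∈ (⊤ : Submodule ℝ V)) ∧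
      (C ++ x :: D).length = finrank ℝ (⊤ : Submodule ℝ V) then 1 else 0).sum).sum =
    cliqueCount E (leftPerp E x) (B ++ A.map fun a => -c a) := by
  rw [cliqueCount_eq_sum, List.sum_sublists'_append, List.sum_map_sum_map_comm,
    List.sublists'_map]
  have hcc : ∀ u v, E (c u) (c v) = E u v := fun u v => by rw [hc, hc, neg_neg]
  have hf := finrank_leftPerp hx
  simp only [List.map_map, Function.comp_def]
  congr 1
  refine List.map_congr_left fun D _ => ?_
  congr 1
  refine List.map_congr_left fun C _ => ?_
  refine if_congr ?_ rfl rfl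
  simp only [List.pairwise_append, List.pairwise_cons, List.mem_append, List.mem_cons,
    List.pairwise_map, List.mem_map, mem_leftPerp, List.length_append, List.length_cons,
    List.length_map, map_neg, LinearMap.neg_apply, neg_neg, hcc]
  constructor
  · rintro ⟨⟨h1, ⟨h2, h3⟩, h4⟩, -, h5⟩
    refine ⟨⟨h3, h1, ?_⟩, ?_, by omega⟩
    · rintro d hd _ ⟨a, ha, rfl⟩
      simp [hc, h4 a ha d (Or.inr hd)]
    · rintro v (hv | ⟨a, ha, rfl⟩)
      · exact h2 v hv
      · simp [hc, h4 a ha x (Or.inl rfl)]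
  · rintro ⟨⟨h3, h1, h4⟩, h5, h6⟩
    refine ⟨⟨h1, ⟨fun d hd => h5 d (Or.inl hd), h3⟩, ?_⟩, by simp, by omega⟩
    rintro a ha d (rfl | hd)
    · simpa [hc] using h5 _ (Or.inr ⟨a, ha, rfl⟩)
    · simpa [hc] using h4 d hd _ ⟨a, ha, rfl⟩

theorem finrank_mul_cliqueCount {E : V →ₗ[ℝ] V →ₗ[ℝ] ℝ} {c : V →ₗ[ℝ] V}
    (hc : ∀ u v, E (c u) v = -E v u) (W : List V) (hW : ∀ x ∈ W, E x x = 1) (g : V → ℕ)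
    (hg : ∀ A x B, W = A ++ x :: B →
      cliqueCount E (leftPerp E x) (B ++ A.map fun a => -c a) = g x) :
    finrank ℝ V * cliqueCount E ⊤ W = (W.map g).sum := by
  classical
  rw [← List.sum_sublists'_length W (fun C => if C.Pairwise (fun γ δ => E δ γ = 0) ∧
      (∀ v ∈ C, v ∈ (⊤ : Submodule ℝ V)) ∧ C.length = finrank ℝ (⊤ : Submodule ℝ V)
      then 1 else 0) g (fun A x B h => (sum_cliques_through hc A B
    (hW x (by simp [h]))).trans (hg A x B h)), cliqueCount_eq_sum, ← List.sum_map_mul_left]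
  congr 1
  refine List.map_congr_left fun C _ => ?_
  split_ifs with h
  · rw [h.2.2, finrank_top]
  · simp

end EulerSystems

section EulerSystems

open Module Submodule

variable {V : Type*} [AddCommGroup V] [Module ℝ V] [FiniteDimensional ℝ V]

theorem cliqueCount_swap (E : V →ₗ[ℝ] V →ₗ[ℝ] ℝ) {x y : V} (hx : E x x = 1) (hy : E y y = 1)
    (hxy : E x y = 0) (hyx : E y x = 0) (A B : List V) (hB : ∀ b ∈ B, E b b = 1) :
    ∀ U : Submodule ℝ V, cliqueCount E U (A ++ x :: y :: B) = cliqueCount E U (A ++ y :: x :: B) := by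
  induction B using List.reverseRecOn with
  | nil =>
    intro U
    have e : ∀ u v : V, A ++ [u, v] = (A ++ [u]) ++ [v] := by simp
    have hx' : x ∈ U ⊓ LinearMap.ker (E y) ↔ x ∈ U := by simp [hyx]
    have hy' : y ∈ U ⊓ LinearMap.ker (E x) ↔ y ∈ U := by simp [hxy]
    rw [e, e, cliqueCount_concat _ U _ hx, cliqueCount_concat _ U _ hy,
      cliqueCount_concat _ U _ hy, cliqueCount_concat _ U _ hx, cliqueCount_concat _ _ _ hx,
      cliqueCount_concat _ _ _ hy, inf_right_comm]
    by_cases h1 : x ∈ U <;> by_cases h2 : y ∈ U <;>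
      simp only [hx', hy', h1, h2, if_true, if_false] <;> omega
  | append_singleton B p ih =>
    intro U
    have hp : E p p = 1 := hB p (by simp)
    have ih' := ih fun b hb => hB b (by simp [hb])
    have e : ∀ u v : V, A ++ u :: v :: (B ++ [p]) = (A ++ u :: v :: B) ++ [p] := by simp
    rw [e, e, cliqueCount_concat _ _ _ hp, cliqueCount_concat _ _ _ hp, ih', ih']

theorem cliqueCount_perm (E : V →ₗ[ℝ] V →ₗ[ℝ] ℝ) (U : Submodule ℝ V) {P P' : List V}
    (h : P.Perm P') : ∀ A B : List V, (∀ b ∈ A ++ P ++ B, E b b = 1) →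
    P.Pairwise (fun γ δ => E γ δ = 0 ∧ E δ γ = 0) →
    cliqueCount E U (A ++ P ++ B) = cliqueCount E U (A ++ P' ++ B) := by
  induction h with
  | nil => intros; rfl
  | cons x h ih =>
    rename_i l₁ l₂
    intro A B hB hP
    have := ih (A ++ [x]) B (by simpa using hB) (List.pairwise_cons.1 hP).2
    simpa using this
  | swap x y l =>
    intro A B hB hP
    have h1 := (List.pairwise_cons.1 hP).1 x (by simp)
    have := cliqueCount_swap E (hB y (by simp)) (hB x (by simp)) h1.1 h1.2 A (l ++ B)
      (fun b hb => hB b (by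
        simp only [List.mem_append, List.mem_cons] at hb ⊢; tauto)) U
    simpa using this
  | trans h1 h2 ih1 ih2 =>
    intro A B hB hP
    rw [ih1 A B hB hP]
    refine ih2 A B (fun b hb => hB b ?_) ((h1.pairwise_iff fun h => ⟨h.2, h.1⟩).1 hP)
    simpa [h1.mem_iff] using hb

namespace EulerSystem

/-- A Coxeter-type automorphism of an Euler system together with the cyclic enumeration of the
roots by consecutive blocks. -/
structure CyclicBlocks (S : EulerSystem V) (c : V →ₗ[ℝ] V) (H : ℕ) (R : ℕ → List V) : Prop where
  E_c : ∀ u v, S.E (c u) v = -S.E v u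
  c_lat : ∀ U ∈ S.lat, U.map c ∈ S.lat
  step : ∀ k, R (k + 2) = (R k).map c
  half : ∀ k, (R (k + H)).Perm ((R k).map Neg.neg)
  orth : ∀ k, (R k).Pairwise (fun γ δ => S.E γ δ = 0 ∧ S.E δ γ = 0)
  pos : S.IsPosList ((List.range' 0 H).flatMap R)
  pw : (R 0 ++ R 1).Pairwise (fun γ δ => S.E δ γ = 0)
  card : (R 0).length + (R 1).length = finrank ℝ V
  two_le : 2 ≤ H
  rank_of_two : H = 2 → finrank ℝ V = 1

variable {S : EulerSystem V}

theorem leftPerp_mem {x : V} (hx : x ∈ S.Φ) : leftPerp S.E x ∈ S.lat :=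
  S.inf_left ⊤ S.top_mem x hx trivial

open scoped Classical in
/-- The number of members of the lattice to the left of a vector. -/
noncomputable def perpCount (S : EulerSystem V) (x : V) : ℕ :=
  (S.lat.filter fun Y => Y ≤ leftPerp S.E x).card

theorem perpCount_neg (x : V) : S.perpCount (-x) = S.perpCount x := by
  have : leftPerp S.E (-x) = leftPerp S.E x := by ext v; simp [mem_leftPerp]
  rw [perpCount, perpCount, this]

/-- An orthogonal initial segment of a positive list with enough elements in `X` is its
set of initial roots. -/
theorem IsPosList.mem_iff_initial {L : List V} (hL : S.IsPosList L) {X : Submodule ℝ V}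
    (hX : X ∈ S.lat) (A K B : List V) (h : L = A ++ K ++ B) (hKX : ∀ P ∈ K, P ∈ X)
    (hA : ∀ a ∈ A, a ∉ X)
    (hK : K.Pairwise (fun γ δ => S.E δ γ = 0)) (hcard : finrank ℝ X ≤ K.length) (P : V) :
    P ∈ K ↔ P ∈ S.initial L X := by
  classical
  have hsub : ∀ P ∈ K, P ∈ S.initial L X := by
    intro P hP
    obtain ⟨K1, K2, rfl⟩ := List.append_of_mem hP
    rw [hL.mem_initial_iff hX (A := A ++ K1) (B := K2 ++ B) (by simp [h]) (hKX P hP)]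
    intro δ hδ hδX
    rw [List.pairwise_append] at hK
    rcases List.mem_append.1 hδ with h' | h'
    · exact absurd hδX (hA δ h')
    · exact hK.2.2 δ h' P (by simp)
  refine ⟨hsub P, fun hP => ?_⟩
  have hnd : K.Nodup := by
    have := hL.nodup
    rw [h] at this
    exact (this.of_append_left).of_append_right
  have hle : K.toFinset ⊆ S.initial L X := fun Q hQ => hsub Q (List.mem_toFinset.1 hQ)
  have := Finset.eq_of_subset_of_card_le hle (by
    rw [List.toFinset_card_of_nodup hnd]
    exact (hL.card_initial hX).le.trans hcard)
  rw [← this] at hP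
  exact List.mem_toFinset.1 hP

theorem IsPosList.perm_right {A P P' : List V} (hL : S.IsPosList (A ++ P)) (hP : P.Perm P')
    (ho : P'.Pairwise (fun γ δ => S.E γ δ = 0 ∧ S.E δ γ = 0)) : S.IsPosList (A ++ P') := by
  have hm : ∀ x, x ∈ A ++ P' ↔ x ∈ A ++ P := fun x => by simp [hP.mem_iff]
  refine ⟨((hP.append_left A).nodup_iff).1 hL.nodup, fun β => by rw [hm, hm]; exact hL.mem β,
    fun β hβ => by rw [hm] at hβ ⊢; exact hL.disj β hβ, ?_⟩
  have := hL.pw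
  rw [List.pairwise_append] at this ⊢
  exact ⟨this.1, ho.imp fun h => ⟨h.1.ge, h.2.le⟩, fun a ha b hb =>
    this.2.2 a ha b (hP.mem_iff.2 hb)⟩

namespace CyclicBlocks

variable {c : V →ₗ[ℝ] V} {H : ℕ} {R : ℕ → List V} (h : S.CyclicBlocks c H R)
include h

theorem E_cc (u v : V) : S.E (c u) (c v) = S.E u v := by rw [h.E_c, h.E_c, neg_neg]

theorem c_injective : Function.Injective c := by
  rw [← LinearMap.ker_eq_bot, LinearMap.ker_eq_bot']
  intro v hv
  by_contra h0
  have := S.E_pos v h0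
  rw [← h.E_cc, hv] at this
  simp at this

open scoped Classical in
theorem image_lat : S.lat.image (Submodule.map c) = S.lat := by
  apply Finset.eq_of_subset_of_card_le
  · intro U hU
    obtain ⟨Y, hY, rfl⟩ := Finset.mem_image.1 hU
    exact h.c_lat Y hY
  · rw [Finset.card_image_of_injective _ (Submodule.map_injective_of_injective h.c_injective)]

open scoped Classical in
theorem perpCount_eq (x : V) :
    S.perpCount x = (S.lat.filter fun Y => ∀ y ∈ Y, S.E x y = 0).card := by
  rw [perpCount, ← h.image_lat, Finset.filter_image, Finset.card_image_of_injective _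
    (Submodule.map_injective_of_injective h.c_injective), h.image_lat]
  congr 1
  refine Finset.filter_congr fun Y _ => ?_
  rw [Submodule.map_le_iff_le_comap]
  exact forall₂_congr fun y _ => by rw [Submodule.mem_comap, mem_leftPerp, h.E_c, neg_eq_zero]

theorem perpCount_c (x : V) : S.perpCount (c x) = S.perpCount x := by
  classical
  rw [perpCount, ← h.image_lat, Finset.filter_image, Finset.card_image_of_injective _
    (Submodule.map_injective_of_injective h.c_injective), perpCount]
  congr 1
  refine Finset.filter_congr fun Y _ => ?_
  rw [Submodule.map_le_iff_le_comap]
  exact forall₂_congr fun y _ => by rw [Submodule.mem_comap, mem_leftPerp, h.E_cc, mem_leftPerp]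

open scoped Classical in
/-- Members of the lattice containing a root. -/
theorem card_mem_eq_perpCount {β : V} (hβ : β ∈ S.Φ) :
    (S.lat.filter fun Y => β ∈ Y).card = S.perpCount β := by
  rw [h.perpCount_eq]
  have h1 := S.E_root β hβ
  refine Finset.card_nbij' (fun Y => Y ⊓ LinearMap.ker (S.E β)) (fun Z => span ℝ {β} ⊔ Z)
    ?_ ?_ ?_ ?_
  · intro Y hY
    obtain ⟨hY, hβY⟩ := Finset.mem_filter.1 hY
    exact Finset.mem_filter.2 ⟨S.inf_right Y hY β hβ hβY, fun y hy => (mem_inf_ker.1 hy).2⟩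
  · intro Z hZ
    obtain ⟨hZ, hβZ⟩ := Finset.mem_filter.1 hZ
    exact Finset.mem_filter.2 ⟨S.sup_right Z hZ β hβ hβZ,
      (le_sup_left : span ℝ {β} ≤ _) (mem_span_singleton_self β)⟩
  · intro Y hY
    obtain ⟨hY, hβY⟩ := Finset.mem_filter.1 hY
    apply le_antisymm
    · exact sup_le (by simpa [span_le] using hβY) inf_le_left
    · intro y hy
      have : y = S.E β y • β + (y - S.E β y • β) := by abel
      rw [this]
      exact Submodule.add_mem_sup (smul_mem _ _ (mem_span_singleton_self β))
        (mem_inf_ker.2 ⟨sub_mem hy (smul_mem _ _ hβY), by simp [h1]⟩)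
  · intro Z hZ
    obtain ⟨hZ, hβZ⟩ := Finset.mem_filter.1 hZ
    apply le_antisymm
    · intro y hy
      obtain ⟨hy, hy0⟩ := mem_inf_ker.1 hy
      obtain ⟨s, hs, z, hz, rfl⟩ := Submodule.mem_sup.1 hy
      obtain ⟨a, rfl⟩ := mem_span_singleton.1 hs
      simp [h1, hβZ z hz] at hy0
      simpa [hy0] using hz
    · exact fun z hz => mem_inf_ker.2 ⟨(le_sup_right : Z ≤ _) hz, hβZ z hz⟩

theorem pairwise_succ (k : ℕ) : (R k ++ R (k + 1)).Pairwise (fun γ δ => S.E δ γ = 0) := by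
  induction k with
  | zero => exact h.pw
  | succ k ih =>
    rw [List.pairwise_append] at ih ⊢
    refine ⟨ih.2.1, ?_, ?_⟩
    · rw [h.step k, List.pairwise_map]
      simpa only [h.E_cc] using ih.1
    · intro a ha b hb
      rw [h.step k] at hb
      obtain ⟨d, hd, rfl⟩ := List.mem_map.1 hb
      rw [h.E_c, ih.2.2 d hd a ha, neg_zero]

theorem card_succ (k : ℕ) : (R k).length + (R (k + 1)).length = finrank ℝ V := by
  induction k with
  | zero => exact h.card
  | succ k ih => rw [h.step k, List.length_map]; omega

theorem flatMap_split (k m : ℕ) (hm : m ≤ H) : (List.range' k H).flatMap R =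
    (List.range' k m).flatMap R ++ (List.range' (k + m) (H - m)).flatMap R := by
  rw [← List.flatMap_append, List.range'_append_1, Nat.add_sub_cancel' hm]

theorem pos_shift (k : ℕ) : S.IsPosList ((List.range' k H).flatMap R) := by
  induction k with
  | zero => exact h.pos
  | succ k ih =>
    have h2 := h.two_le
    have := ih.rotate (A := R k) (B := (List.range' (k + 1) (H - 1)).flatMap R) (by
      rw [h.flatMap_split k 1 (by omega)]; simp)
    have this := this.perm_right (h.half k).symm (h.orth _)
    convert this using 1
    have e : H = (H - 1) + 1 := by omega
    conv_lhs => rw [e]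
    rw [List.range'_1_concat, List.flatMap_append]
    simp only [List.flatMap_cons, List.flatMap_nil, List.append_nil]
    congr 2
    omega

theorem root {k : ℕ} {x : V} (hx : x ∈ R k) : x ∈ S.Φ := by
  have h2 := h.two_le
  refine (h.pos_shift k).root (List.mem_flatMap.2 ⟨k, ?_, hx⟩)
  rw [List.mem_range'_1]; omega

theorem pos_at {k : ℕ} {A B : List V} {x : V} (hR : R k = A ++ x :: B) :
    S.IsPosList (x :: B ++ (List.range' (k + 1) (H - 1)).flatMap R ++ A.map Neg.neg) := by
  have h2 := h.two_le
  refine (h.pos_shift k).rotate (A := A) ?_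
  rw [h.flatMap_split k 1 (by omega)]
  simp [hR]

theorem map_c_flatMap (k m : ℕ) :
    ((List.range' k m).flatMap R).map c = (List.range' (k + 2) m).flatMap R := by
  induction m generalizing k with
  | zero => simp
  | succ m ih => 
    rw [List.range'_succ, List.range'_succ, List.flatMap_cons, List.flatMap_cons,
      List.map_append, ih, h.step]

theorem E_root_append {A B : List V} (hA : ∀ a ∈ A, S.E a a = 1) (hB : ∀ a ∈ B, S.E a a = 1) :
    ∀ a ∈ A ++ B, S.E a a = 1 := fun a ha => (List.mem_append.1 ha).elim (hA a) (hB a)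

theorem E_root_flatMap (k m : ℕ) : ∀ a ∈ (List.range' k m).flatMap R, S.E a a = 1 := by
  intro a ha
  obtain ⟨k, -, hk⟩ := List.mem_flatMap.1 ha
  exact S.E_root a (h.root hk)

theorem E_root_map_neg {A : List V} (hA : ∀ a ∈ A, S.E a a = 1) :
    ∀ a ∈ A.map Neg.neg, S.E a a = 1 := by
  intro a ha
  obtain ⟨a', ha', rfl⟩ := List.mem_map.1 ha
  simpa using hA a' ha'

theorem cliqueCount_map_neg_flatMap (U : Submodule ℝ V) (k m : ℕ) : ∀ A B : List V,
    (∀ a ∈ A, S.E a a = 1) → (∀ a ∈ B, S.E a a = 1) →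
    cliqueCount S.E U (A ++ ((List.range' k m).flatMap R).map Neg.neg ++ B) =
      cliqueCount S.E U (A ++ (List.range' (k + H) m).flatMap R ++ B) := by
  induction m generalizing k with
  | zero => simp
  | succ m ih =>
    intro A B hA hB
    have h1 : ∀ a ∈ R (k + H), S.E a a = 1 := fun a ha => S.E_root a (h.root ha)
    have e := cliqueCount_perm S.E U (h.half k) A
      (((List.range' (k + 1) m).flatMap R).map Neg.neg ++ B)
      (h.E_root_append (h.E_root_append hA h1)
        (h.E_root_append (h.E_root_map_neg (h.E_root_flatMap _ _)) hB)) (h.orth _)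
    have := ih (k + 1) (A ++ R (k + H)) B (h.E_root_append hA h1) hB
    rw [List.range'_succ, List.range'_succ, List.flatMap_cons, List.flatMap_cons,
      List.map_append]
    rw [show k + 1 + H = k + H + 1 by omega] at this
    simp only [List.append_assoc] at this e ⊢
    rw [← e, this]

/-- The number of maximal cliques through an entry of the window. -/
theorem cliqueCount_through {k : ℕ} {A B : List V} {x : V} (hk : k ≤ H + 1)
    (hR : R k = A ++ x :: B) :
    cliqueCount S.E (leftPerp S.E x) ((B ++ (List.range' (k + 1) (H + 1 - k)).flatMap R) ++
      ((List.range' 0 k).flatMap R ++ A).map fun a => -c a) = S.perpCount x := by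
  have h2 := h.two_le
  set M := (List.range' (k + 1) (H - 1)).flatMap R with hM
  set K := B ++ R (k + 1) ++ A.map c with hK
  have hxR : x ∈ R k := by simp [hR]
  have hx1 := S.E_root x (h.root hxR)
  have hxP : x ∉ leftPerp S.E x := fun hx => by
    rw [mem_leftPerp, hx1] at hx
    norm_num at hx
  have hA1 : ∀ a ∈ A, a ∈ R k := fun a ha => by simp [hR, ha]
  have hB1 : ∀ b ∈ B, b ∈ R k := fun b hb => by simp [hR, hb]
  have hAc : ∀ a ∈ A.map c, a ∈ R (k + 2) := fun a ha => by
    rw [h.step]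
    obtain ⟨a', ha', rfl⟩ := List.mem_map.1 ha
    exact List.mem_map_of_mem (hA1 a' ha')
  have hK1 : ∀ p ∈ K, S.E p p = 1 := by
    intro p hp
    simp only [hK, List.mem_append] at hp
    rcases hp with (hp | hp) | hp
    · exact S.E_root p (h.root (hB1 p hp))
    · exact S.E_root p (h.root hp)
    · exact S.E_root p (h.root (hAc p hp))
  have hL := h.pos_at hR
  have hp1 := h.pairwise_succ k
  have hp2 := h.pairwise_succ (k + 1)
  rw [h.step] at hp2
  have hxK : (x :: K).Pairwise (fun γ δ => S.E δ γ = 0) := by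
    rw [hR, List.append_assoc, List.pairwise_append] at hp1
    rw [hR, List.map_append, ← List.append_assoc, List.pairwise_append] at hp2
    have hp3 := hp2.1
    rw [List.pairwise_append] at hp3
    rw [hK, ← List.cons_append, ← List.cons_append, List.pairwise_append]
    refine ⟨by simpa using hp1.2.1, hp3.2.1, fun y hy d hd => ?_⟩
    rcases List.mem_append.1 hy with hy | hy
    · obtain ⟨a, ha, rfl⟩ := List.mem_map.1 hd
      rw [h.E_c, hp1.2.2 a ha y (List.mem_append_left _ hy), neg_zero]
    · exact hp3.2.2 y hy d hd
  rw [List.pairwise_cons] at hxK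
  have hA0 : ∀ a ∈ A, S.E a a = 1 := fun a ha => S.E_root a (h.root (hA1 a ha))
  have hB0 : ∀ a ∈ B, S.E a a = 1 := fun a ha => S.E_root a (h.root (hB1 a ha))
  have hAc0 : ∀ a ∈ (A.map c).map Neg.neg, S.E a a = 1 :=
    h.E_root_map_neg fun a ha => S.E_root a (h.root (hAc a ha))
  have hlist : cliqueCount S.E (leftPerp S.E x)
      ((B ++ (List.range' (k + 1) (H + 1 - k)).flatMap R) ++
      ((List.range' 0 k).flatMap R ++ A).map (fun a => -c a)) =
      cliqueCount S.E (leftPerp S.E x) ((B ++ M ++ A.map Neg.neg) ++ (-x) :: K.map Neg.neg) := by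
    have e1 : ((List.range' 0 k).flatMap R ++ A).map (fun a => -c a) =
        ((List.range' 2 k).flatMap R).map Neg.neg ++ (A.map c).map Neg.neg := by
      have : (fun a => -c a) = Neg.neg ∘ c := rfl
      rw [this, ← List.map_map, List.map_append, List.map_append, h.map_c_flatMap]
    have e2 : (List.range' (k + 1) (H + 1 - k)).flatMap R ++ (List.range' (2 + H) k).flatMap R =
        M ++ (List.range' (k + H) 2).flatMap R := by
      rw [← List.flatMap_append]
      have e3 : List.range' (k + 1) (H + 1 - k) ++ List.range' (2 + H) k =
          List.range' (k + 1) (H - 1) ++ List.range' (k + H) 2 := by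
        have := List.range'_append_1 (s := k + 1) (m := H + 1 - k) (n := k)
        rw [show k + 1 + (H + 1 - k) = 2 + H by omega] at this
        rw [this]
        have := List.range'_append_1 (s := k + 1) (m := H - 1) (n := 2)
        rw [show k + 1 + (H - 1) = k + H by omega] at this
        rw [this]
        congr 1
        omega
      rw [e3, List.flatMap_append]
    rw [e1, ← List.append_assoc, h.cliqueCount_map_neg_flatMap _ 2 k _ _
      (h.E_root_append hB0 (h.E_root_flatMap _ _)) hAc0, List.append_assoc B, e2,
      ← List.append_assoc, ← h.cliqueCount_map_neg_flatMap _ k 2 _ _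
      (h.E_root_append hB0 (h.E_root_flatMap _ _)) hAc0]
    congr 1
    simp [List.range'_succ, hR, hK, hM]
  have hKn : K.Nodup ∧ ∀ P, P ∈ K ↔ P ∈ S.initial (x :: B ++ M ++ A.map Neg.neg)
      (leftPerp S.E x) := by
    have hrest : ∃ Z, x :: B ++ M ++ A.map Neg.neg = [x] ++ K ++ Z := by
      by_cases hH : H = 2
      · refine ⟨[], ?_⟩
        have e := h.card_succ k
        rw [h.rank_of_two hH, hR] at e
        simp only [List.length_append, List.length_cons] at e
        have : A = [] := List.length_eq_zero_iff.1 (by omega)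
        subst hH
        simp [hM, hK, this]
      · refine ⟨(x :: B).map c ++ (List.range' (k + 3) (H - 3)).flatMap R ++ A.map Neg.neg, ?_⟩
        have : H - 1 = (H - 3) + 1 + 1 := by omega
        rw [hM, this, List.range'_succ, List.range'_succ, List.flatMap_cons, List.flatMap_cons,
          show k + 1 + 1 = k + 2 by rfl, h.step, hR, hK]
        simp
    obtain ⟨Z, hZ⟩ := hrest
    constructor
    · have := hL.nodup
      rw [hZ] at this
      exact (this.of_append_left).of_append_right
    · refine hL.mem_iff_initial (leftPerp_mem (h.root hxR)) [x] K Z hZ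
        (fun P hP => mem_leftPerp.2 (hxK.1 P hP)) (by simpa using hxP) hxK.2 ?_
      have e1 := finrank_leftPerp hx1
      have e2 := h.card_succ k
      rw [finrank_top] at e1
      rw [hR] at e2
      simp only [hK, List.length_append, List.length_map, List.length_cons] at e2 ⊢
      omega
  rw [hlist, cliqueCount_drop, cliqueCount_map_neg _ _ _ hK1]
  · rw [perpCount, ← hL.cliqueCount_extended (leftPerp_mem (h.root hxR)) hKn.1 hKn.2 hxK.2]
    have := cliqueCount_drop S.E [] (B ++ M ++ A.map Neg.neg ++ K) hx1 (by
      intro b hb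
      rcases List.mem_append.1 hb with hb | hb
      · exact hL.E_self (List.mem_cons_of_mem _ hb)
      · exact hK1 b hb) (leftPerp S.E x) hxP
    exact this.symm
  · simpa using hx1
  · intro b hb
    obtain ⟨b', hb', rfl⟩ := List.mem_map.1 hb
    simpa using hK1 b' hb'
  · simpa using hxP

theorem cliqueCount_window :
    cliqueCount S.E ⊤ ((List.range' 0 (H + 2)).flatMap R) = S.lat.card := by
  classical
  have h2 := h.two_le
  have e : cliqueCount S.E ⊤ ((List.range' 0 (H + 2)).flatMap R) =
      cliqueCount S.E ⊤ ((List.range' 0 H).flatMap R ++ (R 0 ++ R 1).map Neg.neg) := by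
    have := h.cliqueCount_map_neg_flatMap ⊤ 0 2 ((List.range' 0 H).flatMap R) []
      (h.E_root_flatMap _ _) (by simp)
    rw [List.append_nil, List.append_nil, ← List.flatMap_append, List.range'_append_1] at this
    rw [← this]
    simp [List.range'_succ]
  have hs : (List.range' 0 H).flatMap R = [] ++ (R 0 ++ R 1) ++
      (List.range' 2 (H - 2)).flatMap R := by
    rw [h.flatMap_split 0 2 h2]
    simp [List.range'_succ]
  have hI := h.pos.mem_iff_initial S.top_mem [] (R 0 ++ R 1) _ hs (by simp) (by simp) h.pw (by
    rw [finrank_top, List.length_append]; exact h.card.ge)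
  have hnd : (R 0 ++ R 1).Nodup := by
    have := h.pos.nodup
    rw [hs] at this
    exact (this.of_append_left).of_append_right
  rw [e, cliqueCount_map_neg, h.pos.cliqueCount_extended S.top_mem hnd hI h.pw]
  · simp
  · intro b hb
    rcases List.mem_append.1 hb with hb | hb <;> exact S.E_root b (h.root hb)

theorem finrank_mul_card_lat : finrank ℝ V * S.lat.card =
    (((List.range' 0 (H + 2)).flatMap R).map S.perpCount).sum := by
  rw [← h.cliqueCount_window]
  refine finrank_mul_cliqueCount h.E_c _ (fun x hx => ?_) _ fun A x B hW => ?_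
  · obtain ⟨k, -, hk⟩ := List.mem_flatMap.1 hx
    exact S.E_root x (h.root hk)
  · obtain ⟨l₁, k, l₂, A₁, B₁, h1, hR, rfl, rfl⟩ := List.flatMap_eq_append_cons hW
    obtain ⟨m, hm, rfl, h3⟩ := List.range'_eq_append_iff.1 h1
    obtain ⟨h4, h5, rfl⟩ := List.range'_eq_cons_iff.1 h3.symm
    have hmk : m = k := by omega
    subst hmk
    have := h.cliqueCount_through (k := m) (by omega) hR
    convert this using 6
    omega

theorem sum_flatMap (m : ℕ) : (((List.range' 0 m).flatMap R).map S.perpCount).sum * 2 =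
    if Even m then m * (((R 0).map S.perpCount).sum + ((R 1).map S.perpCount).sum)
    else (m + 1) * ((R 0).map S.perpCount).sum + (m - 1) * ((R 1).map S.perpCount).sum := by
  have hs : ∀ k, ((R k).map S.perpCount).sum =
      if Even k then ((R 0).map S.perpCount).sum else ((R 1).map S.perpCount).sum := by
    intro k
    induction k using Nat.twoStepInduction with
    | zero => simp
    | one => simp
    | more k ih _ =>
      rw [h.step, List.map_map]
      have : S.perpCount ∘ c = S.perpCount := funext h.perpCount_c
      rw [this, ih]
      simp [Nat.even_add]
  induction m with
  | zero => simp
  | succ m ih =>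
    rw [List.range'_1_concat, List.flatMap_append, List.map_append, List.sum_append, add_mul, ih]
    simp only [List.flatMap_cons, List.flatMap_nil, List.append_nil, zero_add, hs m]
    by_cases hm : Even m
    · rw [if_pos hm, if_pos hm, if_neg (by simpa [Nat.even_add_one] using hm), Nat.add_sub_cancel]
      ring
    · rw [if_neg hm, if_neg hm, if_pos (by simpa [Nat.even_add_one] using hm)]
      obtain ⟨j, rfl⟩ := Nat.not_even_iff_odd.1 hm
      rw [Nat.add_sub_cancel]
      ring

open scoped Classical in
/-- The count of members of the lattice through the positive roots, compared with the size of the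
lattice. -/
theorem two_counts : (H + 2) * (((List.range' 0 H).flatMap R).map
      fun β => (S.lat.filter fun Y => β ∈ Y).card).sum = finrank ℝ V * H * S.lat.card := by
  have e : ((List.range' 0 H).flatMap R).map (fun β => (S.lat.filter fun Y => β ∈ Y).card) =
      ((List.range' 0 H).flatMap R).map S.perpCount := List.map_congr_left fun β hβ => by
    obtain ⟨k, -, hk⟩ := List.mem_flatMap.1 hβ
    exact h.card_mem_eq_perpCount (h.root hk)
  rw [e, mul_right_comm, h.finrank_mul_card_lat]
  have h1 := h.sum_flatMap H
  have h2 := h.sum_flatMap (H + 2)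
  by_cases hH : Even H
  · rw [if_pos hH] at h1
    rw [if_pos (by simpa [Nat.even_add] using hH)] at h2
    apply Nat.eq_of_mul_eq_mul_right (Nat.succ_pos 1)
    simp only [Nat.succ_eq_add_one, Nat.reduceAdd]
    rw [mul_assoc, h1, mul_right_comm, h2]
    ring
  · have hab : ((R 0).map S.perpCount).sum = ((R 1).map S.perpCount).sum := by
      have e1 : ((R H).map S.perpCount).sum = ((R 0).map S.perpCount).sum := by
        have := h.half 0
        rw [zero_add] at this
        rw [(this.map _).sum_eq, List.map_map]
        congr 2
        exact funext perpCount_neg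
      have e2 := h.sum_flatMap (H + 1)
      rw [List.range'_1_concat, List.flatMap_append, List.map_append, List.sum_append, add_mul, h1,
        if_neg hH, if_pos (by simpa [Nat.even_add_one] using hH)] at e2
      simp only [List.flatMap_cons, List.flatMap_nil, List.append_nil, zero_add, e1] at e2
      have hH1 := h.two_le
      obtain ⟨j, hj⟩ : ∃ j, H = j + 1 := ⟨H - 1, by omega⟩
      subst hj
      rw [Nat.add_sub_cancel] at e2
      nlinarith
    rw [if_neg hH, hab] at h1
    rw [if_neg (by simpa [Nat.even_add] using hH), hab] at h2
    apply Nat.eq_of_mul_eq_mul_right (Nat.succ_pos 1)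
    simp only [Nat.succ_eq_add_one, Nat.reduceAdd]
    rw [mul_assoc, h1, mul_right_comm, h2]
    have hH1 := h.two_le
    obtain ⟨j, hj⟩ : ∃ j, H = j + 1 := ⟨H - 1, by omega⟩
    subst hj
    rw [Nat.add_sub_cancel, show j + 1 + 2 - 1 = j + 2 by omega]
    ring

end CyclicBlocks

end EulerSystem

end EulerSystems

section FormReflections

open Real

variable {V : Type*} [AddCommGroup V] [Module ℝ V]

/-- The linear map `v ↦ v - F(x, v) x`; it is the orthogonal reflection in `x` when `F` is
symmetric and `F(x, x) = 2`. -/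
noncomputable def formReflection (F : V →ₗ[ℝ] V →ₗ[ℝ] ℝ) (x : V) : Module.End ℝ V :=
  LinearMap.id - (F x).smulRight x

@[simp]
theorem formReflection_apply (F : V →ₗ[ℝ] V →ₗ[ℝ] ℝ) (x v : V) :
    formReflection F x v = v - F x v • x := by
  simp [formReflection]

theorem formReflection_mul_self (F : V →ₗ[ℝ] V →ₗ[ℝ] ℝ) {x : V} (hx : F x x = 2) :
    formReflection F x * formReflection F x = 1 := by
  ext v
  simp only [Module.End.mul_apply, formReflection_apply, map_sub, map_smul, hx,
    Module.End.one_apply]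
  module

theorem formReflection_isometry (F : V →ₗ[ℝ] V →ₗ[ℝ] ℝ) (hF : ∀ u v, F u v = F v u) {x : V}
    (hx : F x x = 2) (u v : V) :
    F (formReflection F x u) (formReflection F x v) = F u v := by
  simp only [formReflection_apply, map_sub, map_smul, hx, smul_eq_mul, LinearMap.sub_apply,
    LinearMap.smul_apply, hF u x]
  ring

/-- The action of powers of a product of two reflections on the roots. -/
theorem formReflection_mul_pow_apply (F : V →ₗ[ℝ] V →ₗ[ℝ] ℝ) {x y : V} {θ : ℝ} (hx : F x x = 2)
    (hy : F y y = 2) (hxy : F x y = -2 * cos θ) (hyx : F y x = -2 * cos θ) (k : ℕ) :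
    sin θ • ((formReflection F x * formReflection F y) ^ k) x =
        sin ((2 * k + 1) * θ) • x + sin (2 * k * θ) • y ∧
      sin θ • ((formReflection F x * formReflection F y) ^ k) y =
        -(sin (2 * k * θ) • x) - sin ((2 * k - 1) * θ) • y := by
  induction k with
  | zero => simp
  | succ k ih =>
    have h1 : sin ((2 * (k + 1 : ℕ) + 1) * θ) =
        (4 * cos θ ^ 2 - 1) * sin ((2 * k + 1) * θ) - 2 * cos θ * sin (2 * k * θ) := by
      have e1 : (2 * (k + 1 : ℕ) + 1) * θ = 2 * k * θ + (3 * θ) := by push_cast; ring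
      have e2 : (2 * k + 1) * θ = 2 * k * θ + θ := by ring
      rw [e1, e2, sin_add, sin_add, sin_three_mul, cos_three_mul]
      linear_combination (-cos (2 * k * θ) * sin θ * 4) * (sin_sq_add_cos_sq θ)
    have h2 : sin (2 * (k + 1 : ℕ) * θ) = 2 * cos θ * sin ((2 * k + 1) * θ) - sin (2 * k * θ) := by
      have e1 : 2 * (k + 1 : ℕ) * θ = 2 * k * θ + (2 * θ) := by push_cast; ring
      have e2 : (2 * k + 1) * θ = 2 * k * θ + θ := by ring
      rw [e1, e2, sin_add, sin_add, sin_two_mul, cos_two_mul]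
      ring
    have h3 : sin ((2 * (k + 1 : ℕ) - 1) * θ) = sin ((2 * k + 1) * θ) := by
      congr 1; push_cast; ring
    have h4 : 2 * cos θ * sin (2 * k * θ) = sin ((2 * k + 1) * θ) + sin ((2 * k - 1) * θ) := by
      have e1 : (2 * k - 1) * θ = 2 * k * θ - θ := by ring
      have e2 : (2 * k + 1) * θ = 2 * k * θ + θ := by ring
      rw [e1, e2, sin_add, sin_sub]
      ring
    have ex : (formReflection F x * formReflection F y) x =
        (4 * cos θ ^ 2 - 1) • x + (2 * cos θ) • y := by
      simp only [Module.End.mul_apply, formReflection_apply, map_sub, map_smul, hx, hxy, hyx]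
      module
    have ey : (formReflection F x * formReflection F y) y = -((2 * cos θ) • x) - y := by
      simp only [Module.End.mul_apply, formReflection_apply, map_sub, map_smul, hy, hxy]
      module
    have h5 : sin ((2 * k - 1) * θ) = 2 * cos θ * sin (2 * k * θ) - sin ((2 * k + 1) * θ) := by
      linarith
    obtain ⟨ih1, ih2⟩ := ih
    generalize formReflection F x * formReflection F y = R at ex ey ih1 ih2 ⊢
    rw [h5] at ih2
    rw [pow_succ, Module.End.mul_apply, Module.End.mul_apply, ex, ey]
    simp only [map_add, map_sub, map_neg, map_smul, smul_add, smul_sub, smul_neg,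
      smul_comm (sin θ) (_ : ℝ), ih1, ih2, h1, h2, h3]
    constructor <;> module

/-- The product of two reflections in roots at angle `π - π / m` has order dividing `m`. -/
theorem formReflection_mul_pow_eq_one (F : V →ₗ[ℝ] V →ₗ[ℝ] ℝ) (hF : ∀ u v, F u v = F v u)
    {x y : V} {m : ℕ} (hm : 2 ≤ m) (hx : F x x = 2)
    (hy : F y y = 2) (hxy : F x y = -2 * cos (π / m)) :
    (formReflection F x * formReflection F y) ^ m = 1 := by
  have hyx : F y x = -2 * cos (π / m) := by rw [hF, hxy]
  have hm' : (2 : ℝ) ≤ m := by exact_mod_cast hm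
  have hs : sin (π / m) ≠ 0 := by
    refine (sin_pos_of_pos_of_lt_pi (by positivity) ?_).ne'
    rw [div_lt_iff₀ (by linarith)]
    nlinarith [pi_pos]
  obtain ⟨h1, h2⟩ := formReflection_mul_pow_apply F hx hy hxy hyx m
  set θ := π / m with hθ
  have hmθ : m * θ = π := by rw [hθ]; field_simp
  have e1 : sin ((2 * m + 1) * θ) = sin θ := by
    rw [show (2 * m + 1) * θ = θ + 2 * (m * θ) by ring, hmθ, sin_add_two_pi]
  have e2 : sin (2 * m * θ) = 0 := by
    rw [show 2 * m * θ = 2 * (m * θ) by ring, hmθ, sin_two_pi]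
  have e3 : sin ((2 * m - 1) * θ) = - sin θ := by
    rw [show (2 * m - 1) * θ = 2 * (m * θ) - θ by ring, hmθ, sin_two_pi_sub]
  rw [e1, e2, zero_smul, add_zero] at h1
  rw [e2, e3, zero_smul, neg_zero, zero_sub, neg_smul, neg_neg] at h2
  have h1' := smul_right_injective V hs h1
  have h2' := smul_right_injective V hs h2
  ext v
  have hcs := sin_sq_add_cos_sq θ
  have hs2 : sin θ ^ 2 ≠ 0 := pow_ne_zero _ hs
  set a := (F x v + cos θ * F y v) / (2 * sin θ ^ 2) with ha
  set b := (F y v + cos θ * F x v) / (2 * sin θ ^ 2) with hb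
  have ha' : a * (2 * sin θ ^ 2) = F x v + cos θ * F y v := by rw [ha]; field_simp
  have hb' : b * (2 * sin θ ^ 2) = F y v + cos θ * F x v := by rw [hb]; field_simp
  obtain ⟨u, hu⟩ : ∃ u, v = u + (a • x + b • y) := ⟨v - (a • x + b • y), by abel⟩
  have hxu : F x u = 0 := by
    have : F x v = F x u + (a * 2 + b * (-2 * cos θ)) := by
      conv_lhs => rw [hu]
      simp [hx, hxy]
    refine mul_left_cancel₀ hs2 ?_
    linear_combination (-sin θ ^ 2) * this - ha' + cos θ * hb' + F x v * hcs
  have hyu : F y u = 0 := by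
    have : F y v = F y u + (a * (-2 * cos θ) + b * 2) := by
      conv_lhs => rw [hu]
      simp [hy, hyx]
    refine mul_left_cancel₀ hs2 ?_
    linear_combination (-sin θ ^ 2) * this - hb' + cos θ * ha' + F y v * hcs
  have hfix : ∀ k : ℕ, ((formReflection F x * formReflection F y) ^ k) u = u := by
    intro k
    induction k with
    | zero => rfl
    | succ k ih => rw [pow_succ, Module.End.mul_apply]; simp [hxu, hyu, ih]
  rw [hu]
  simp only [map_add, map_smul, hfix, h1', h2', Module.End.one_apply]

end FormReflections

section GeometricRepresentation

open Real

variable {B : Type*} [Fintype B] [DecidableEq B] (M : CoxeterMatrix B)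

/-- The symmetric bilinear form of a Coxeter matrix, normalised so that roots have norm `2`. -/
noncomputable def coxeterForm : (B → ℝ) →ₗ[ℝ] (B → ℝ) →ₗ[ℝ] ℝ :=
  Matrix.toLinearMap₂' ℝ (Matrix.of fun i j => -2 * cos (π / M i j))

/-- The simple root attached to an index, as a standard basis vector. -/
def simpleRoot (i : B) : B → ℝ := Pi.single i 1

@[simp]
theorem coxeterForm_simpleRoot (i j : B) :
    coxeterForm M (simpleRoot i) (simpleRoot j) = -2 * cos (π / M i j) := by
  simp [coxeterForm, simpleRoot, Matrix.toLinearMap₂'_apply']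

theorem sum_smul_simpleRoot (v : B → ℝ) : ∑ i, v i • simpleRoot i = v := by
  ext j
  simp [simpleRoot, Finset.sum_apply, Pi.single_apply]

theorem span_simpleRoot : Submodule.span ℝ (Set.range (simpleRoot : B → B → ℝ)) = ⊤ := by
  rw [eq_top_iff]
  intro v _
  rw [← sum_smul_simpleRoot v]
  exact Submodule.sum_mem _ fun i _ => Submodule.smul_mem _ _ (Submodule.subset_span ⟨i, rfl⟩)

theorem linearMap_ext_simpleRoot {N : Type*} [AddCommGroup N] [Module ℝ N]
    {f g : (B → ℝ) →ₗ[ℝ] N} (h : ∀ i, f (simpleRoot i) = g (simpleRoot i)) : f = g :=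
  LinearMap.ext_on_range span_simpleRoot h

theorem coxeterForm_eq_sum (u v : B → ℝ) :
    coxeterForm M u v = ∑ i, u i * coxeterForm M (simpleRoot i) v := by
  rw [← congrArg (fun w => coxeterForm M w v) (sum_smul_simpleRoot u)]
  simp only [map_sum, map_smul, LinearMap.sum_apply, LinearMap.smul_apply, smul_eq_mul]

theorem coxeterForm_comm (u v : B → ℝ) : coxeterForm M u v = coxeterForm M v u := by
  have : coxeterForm M = (coxeterForm M).flip := by
    refine linearMap_ext_simpleRoot fun i => linearMap_ext_simpleRoot fun j => ?_
    simp [M.symmetric i j]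
  exact LinearMap.congr_fun₂ this u v

@[simp]
theorem coxeterForm_simpleRoot_self (i : B) :
    coxeterForm M (simpleRoot i) (simpleRoot i) = 2 := by
  simp

theorem isLiftable_formReflection :
    M.IsLiftable fun i => formReflection (coxeterForm M) (simpleRoot i) := by
  intro i j
  rcases eq_or_ne i j with rfl | hij
  · simp only [M.diagonal, pow_one]
    exact formReflection_mul_self _ (coxeterForm_simpleRoot_self M i)
  · rcases Nat.eq_zero_or_pos (M i j) with h0 | h0
    · rw [h0, pow_zero]
    · have h1 := M.off_diagonal i j hij
      exact formReflection_mul_pow_eq_one _ (coxeterForm_comm M) (by omega)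
        (coxeterForm_simpleRoot_self M i) (coxeterForm_simpleRoot_self M j)
        (coxeterForm_simpleRoot M i j)

variable {M} {W : Type*} [Group W] (cs : CoxeterSystem M W)

/-- The geometric representation of a Coxeter group. -/
noncomputable def geomRep : W →* Module.End ℝ (B → ℝ) :=
  cs.lift ⟨_, isLiftable_formReflection M⟩

@[simp]
theorem geomRep_simple (i : B) :
    geomRep cs (cs.simple i) = formReflection (coxeterForm M) (simpleRoot i) :=
  cs.lift_apply_simple (isLiftable_formReflection M) i

theorem geomRep_mul_apply (w x : W) (v : B → ℝ) :
    geomRep cs (w * x) v = geomRep cs w (geomRep cs x v) := by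
  rw [map_mul, Module.End.mul_apply]

theorem geomRep_inv_apply_self (w : W) (v : B → ℝ) :
    geomRep cs w⁻¹ (geomRep cs w v) = v := by
  rw [← geomRep_mul_apply, inv_mul_cancel, map_one, Module.End.one_apply]

theorem geomRep_apply_inv_self (w : W) (v : B → ℝ) :
    geomRep cs w (geomRep cs w⁻¹ v) = v := by
  rw [← geomRep_mul_apply, mul_inv_cancel, map_one, Module.End.one_apply]

theorem coxeterForm_geomRep (w : W) (u v : B → ℝ) :
    coxeterForm M (geomRep cs w u) (geomRep cs w v) = coxeterForm M u v := by
  induction w using cs.simple_induction_left generalizing u v with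
  | one => simp
  | mul_simple_left w i ih =>
    rw [geomRep_mul_apply, geomRep_mul_apply, geomRep_simple,
      formReflection_isometry _ (coxeterForm_comm M) (coxeterForm_simpleRoot_self M i), ih]

theorem coxeterForm_geomRep_left (w : W) (u v : B → ℝ) :
    coxeterForm M (geomRep cs w u) v = coxeterForm M u (geomRep cs w⁻¹ v) := by
  rw [← coxeterForm_geomRep cs w u, geomRep_apply_inv_self]

theorem cos_pi_div_eq_zero {m : ℕ} (h : cos (π / m) = 0) : m = 2 := by
  rcases m with _ | _ | _ | m
  · simp at h
  · simp at h
  · rfl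
  · exfalso
    have : (0 : ℝ) ≤ m := Nat.cast_nonneg m
    refine (cos_pos_of_mem_Ioo ⟨?_, ?_⟩).ne' h
    · have : 0 < π / ((m + 1 + 1 + 1 : ℕ) : ℝ) := by positivity
      linarith [pi_pos]
    · push_cast
      rw [div_lt_div_iff₀ (by linarith) two_pos]
      nlinarith [pi_pos]

theorem cos_pi_div_nonneg {m : ℕ} (h : m ≠ 1) : 0 ≤ cos (π / m) := by
  rcases m with _ | _ | m
  · simp
  · exact absurd rfl h
  · have : (0 : ℝ) ≤ m := Nat.cast_nonneg m
    refine cos_nonneg_of_mem_Icc ⟨?_, ?_⟩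
    · have : 0 < π / ((m + 1 + 1 : ℕ) : ℝ) := by positivity
      linarith [pi_pos]
    · push_cast
      rw [div_le_div_iff₀ (by linarith) two_pos]
      nlinarith [pi_pos]

theorem commute_simple_of_eq_two {i j : B} (h : M i j = 2) :
    Commute (cs.simple i) (cs.simple j) := by
  have h1 := cs.simple_mul_simple_pow i j
  rw [h, pow_two] at h1
  have h2 : cs.simple i * cs.simple j = (cs.simple i * cs.simple j)⁻¹ := eq_inv_of_mul_eq_one_left h1
  rwa [mul_inv_rev, cs.inv_simple, cs.inv_simple] at h2

theorem commute_simple_of_coxeterForm_eq_zero {i j : B}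
    (h : coxeterForm M (simpleRoot i) (simpleRoot j) = 0) :
    Commute (cs.simple i) (cs.simple j) := by
  refine commute_simple_of_eq_two cs (cos_pi_div_eq_zero ?_)
  simpa using h

/-- In an irreducible finite Coxeter group the form of the Coxeter matrix is positive definite. -/
theorem coxeterForm_pos [Finite W]
    (hirr : ∀ A : Set B, (∀ a ∈ A, ∀ b ∈ Aᶜ, Commute (cs.simple a) (cs.simple b)) →
      A = ∅ ∨ A = Set.univ) {v : B → ℝ} (hv : v ≠ 0) : 0 < coxeterForm M v v := by
  have := Fintype.ofFinite W
  let Q : (B → ℝ) → (B → ℝ) → ℝ := fun u v => ∑ w : W, geomRep cs w u ⬝ᵥ geomRep cs w v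
  have Qcomm : ∀ u v, Q u v = Q v u := fun u v =>
    Finset.sum_congr rfl fun w _ => dotProduct_comm _ _
  have Qpos : ∀ u, u ≠ 0 → 0 < Q u u := by
    intro u hu
    refine Finset.sum_pos (fun w _ => ?_) ⟨1, Finset.mem_univ _⟩
    refine lt_of_le_of_ne (Finset.sum_nonneg fun i _ => mul_self_nonneg _) (Ne.symm ?_)
    rw [Ne, dotProduct_self_eq_zero]
    intro h
    apply hu
    rw [← geomRep_inv_apply_self cs w u, h, map_zero]
  have Qinv : ∀ x u v, Q (geomRep cs x u) (geomRep cs x v) = Q u v := by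
    intro x u v
    simp only [Q, ← geomRep_mul_apply]
    exact Fintype.sum_equiv (Equiv.mulRight x) _ _ fun w => rfl
  have Qadd : ∀ u v w, Q u (v + w) = Q u v + Q u w := by
    intro u v w
    simp only [Q, map_add, dotProduct_add, Finset.sum_add_distrib]
  have Qsmul : ∀ u (a : ℝ) v, Q u (a • v) = a * Q u v := by
    intro u a v
    simp only [Q, map_smul, dotProduct_smul, Finset.mul_sum, smul_eq_mul]
  have Qneg : ∀ u v, Q (-u) v = - Q u v := by
    intro u v
    simp only [Q, map_neg, neg_dotProduct, Finset.sum_neg_distrib]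
  have ne0 : ∀ i : B, (simpleRoot i : B → ℝ) ≠ 0 := by
    intro i h
    have := congrFun h i
    simp [simpleRoot] at this
  let k : B → ℝ := fun i => Q (simpleRoot i) (simpleRoot i) / 2
  have kpos : ∀ i, 0 < k i := fun i => half_pos (Qpos _ (ne0 i))
  have Qroot : ∀ i v, Q (simpleRoot i) v = k i * coxeterForm M (simpleRoot i) v := by
    intro i v
    have h1 := Qinv (cs.simple i) (simpleRoot i) v
    have e1 : geomRep cs (cs.simple i) (simpleRoot i) = - simpleRoot i := by
      rw [geomRep_simple, formReflection_apply, coxeterForm_simpleRoot_self, two_smul]; abel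
    have e2 : geomRep cs (cs.simple i) v
        = v + (-coxeterForm M (simpleRoot i) v) • simpleRoot i := by
      rw [geomRep_simple, formReflection_apply]; module
    rw [e1, e2, Qneg, Qadd, Qsmul] at h1
    simp only [k]
    linarith
  have keq : ∀ i j, coxeterForm M (simpleRoot i) (simpleRoot j) ≠ 0 → k i = k j := by
    intro i j h
    have h1 := Qcomm (simpleRoot i) (simpleRoot j)
    rw [Qroot, Qroot, coxeterForm_comm M (simpleRoot j)] at h1
    exact mul_right_cancel₀ h h1
  obtain ⟨i₀, -⟩ : ∃ i, v i ≠ 0 := Function.ne_iff.1 hv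
  have kall : ∀ i, k i = k i₀ := by
    rcases hirr {i | k i = k i₀} fun a ha b hb => commute_simple_of_coxeterForm_eq_zero cs <| by
      by_contra h
      exact hb ((keq a b h).symm.trans ha) with h | h
    · exact absurd (show i₀ ∈ {i | k i = k i₀} from rfl) (by rw [h]; simp)
    · intro i
      have : i ∈ {i | k i = k i₀} := by rw [h]; trivial
      exact this
  have h1 : Q v v = k i₀ * coxeterForm M v v := by
    have e1 : ∀ u, Q u v = ∑ i, u i * Q (simpleRoot i) v := by
      intro u
      simp_rw [Qcomm _ v, ← Qsmul]
      conv_lhs => rw [← sum_smul_simpleRoot u]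
      simp only [Q, map_sum, map_smul, dotProduct_sum]
      rw [Finset.sum_comm]
    rw [e1, coxeterForm_eq_sum, Finset.mul_sum]
    refine Finset.sum_congr rfl fun i _ => ?_
    rw [Qroot, kall]; ring
  have h2 := Qpos v hv
  rw [h1] at h2
  exact pos_of_mul_pos_right h2 (kpos i₀).le

end GeometricRepresentation

section SignTheorem

open Real

variable {B : Type*} [Fintype B] [DecidableEq B] {M : CoxeterMatrix B} {W : Type*} [Group W]
  (cs : CoxeterSystem M W)

theorem coxeterMatrix_ne_zero (hpos : ∀ v ≠ 0, 0 < coxeterForm M v v) (i j : B) : M i j ≠ 0 := by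
  rcases eq_or_ne i j with rfl | hij
  · simp
  intro h
  have hne : (simpleRoot i + simpleRoot j : B → ℝ) ≠ 0 := by
    intro h
    have := congrFun h i
    simp [simpleRoot, hij] at this
  have h1 := hpos _ hne
  simp [h, M.symmetric j i] at h1

theorem geomRep_alternatingWord (i j : B) (m : ℕ) :
    sin (π / M i j) • geomRep cs (cs.wordProd (CoxeterSystem.alternatingWord i j m)) (simpleRoot i) =
      if Even m then sin ((m + 1) * (π / M i j)) • simpleRoot i
          + sin (m * (π / M i j)) • simpleRoot j
        else sin (m * (π / M i j)) • simpleRoot i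
          + sin ((m + 1) * (π / M i j)) • simpleRoot j := by
  set θ := π / M i j with hθ
  have hij : coxeterForm M (simpleRoot i) (simpleRoot j) = -2 * cos θ := coxeterForm_simpleRoot M i j
  have hji : coxeterForm M (simpleRoot j) (simpleRoot i) = -2 * cos θ := by
    rw [coxeterForm_comm, hij]
  induction m with
  | zero => simp [CoxeterSystem.alternatingWord]
  | succ m ih =>
    have hs : sin ((m + 1 + 1) * θ) = 2 * cos θ * sin ((m + 1) * θ) - sin (m * θ) := by
      rw [show (m + 1 + 1 : ℝ) * θ = (m + 1) * θ + θ by ring,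
        show (m : ℝ) * θ = (m + 1) * θ - θ by ring, sin_add, sin_sub]
      ring
    rw [CoxeterSystem.alternatingWord_succ', cs.wordProd_cons, geomRep_mul_apply, ← map_smul, ih]
    by_cases hm : Even m
    · have hm' : ¬ Even (m + 1) := by simpa [Nat.even_add_one] using hm
      simp only [if_pos hm, if_neg hm', geomRep_simple, formReflection_apply, map_add, map_smul,
        hji, coxeterForm_simpleRoot_self, Nat.cast_add, Nat.cast_one, hs]
      module
    · have hm' : Even (m + 1) := by simpa [Nat.even_add_one] using hm
      simp only [if_neg hm, if_pos hm', geomRep_simple, formReflection_apply, map_add, map_smul,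
        hij, coxeterForm_simpleRoot_self, Nat.cast_add, Nat.cast_one, hs]
      module

/-- If `i` is not a right descent of `w`, then `w` sends the simple root of `i` to a nonnegative
combination of simple roots. -/
theorem geomRep_simpleRoot_nonneg (hpos : ∀ v ≠ 0, 0 < coxeterForm M v v) {w : W} {i : B}
    (hi : ¬ cs.IsRightDescent w i) : 0 ≤ geomRep cs w (simpleRoot i) := by
  induction hn : cs.length w using Nat.strong_induction_on generalizing w i with
  | _ n ih =>
  subst hn
  by_cases hw : w = 1
  · subst hw
    simp [simpleRoot]
  obtain ⟨j, hj⟩ := cs.exists_rightDescent_of_ne_one hw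
  have hij : i ≠ j := by rintro rfl; exact hi hj
  let Q : ℕ → Prop := fun m => ∃ v, w = v * cs.wordProd (CoxeterSystem.alternatingWord i j m) ∧
    cs.length w = cs.length v + m
  have hlen : ∀ k l m, cs.length (cs.wordProd (CoxeterSystem.alternatingWord k l m)) ≤ m := by
    intro k l m
    refine (cs.length_wordProd_le _).trans ?_
    rw [CoxeterSystem.length_alternatingWord]
  have hM0 := coxeterMatrix_ne_zero hpos i j
  have hQ1 : Q 1 := by
    refine ⟨w * cs.simple j, ?_, ((cs.isRightDescent_iff).1 hj).symm⟩
    simp [CoxeterSystem.alternatingWord, mul_assoc]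
  have hQM : ¬ Q (M i j) := by
    rintro ⟨v, hv, hl⟩
    rw [cs.prod_alternatingWord_eq_prod_alternatingWord_sub i j _ (by omega)] at hv
    rw [show M i j * 2 - M i j = (M i j - 1) + 1 by omega,
      CoxeterSystem.alternatingWord_succ, cs.wordProd_concat] at hv
    have h1 : w * cs.simple i = v * cs.wordProd (CoxeterSystem.alternatingWord i j (M i j - 1)) := by
      rw [hv, ← mul_assoc, mul_assoc, cs.simple_mul_simple_self, mul_one]
    have h2 := (cs.not_isRightDescent_iff).1 hi
    have h3 := cs.length_mul_le v (cs.wordProd (CoxeterSystem.alternatingWord i j (M i j - 1)))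
    have h4 := hlen i j (M i j - 1)
    rw [← h1] at h3
    omega
  obtain ⟨m, hm1, hmM, ⟨v, hv, hl⟩, hmQ⟩ : ∃ m, 1 ≤ m ∧ m < M i j ∧ Q m ∧ ¬ Q (m + 1) := by
    by_contra! hcon
    have : ∀ m, 1 ≤ m → m ≤ M i j → Q m := by
      intro m h1
      induction m, h1 using Nat.le_induction with
      | base => exact fun _ => hQ1
      | succ m h1 ihm => exact fun h2 => hcon m h1 h2 (ihm (by omega))
    exact hQM (this _ (by omega) le_rfl)
  have hnext : ¬ cs.IsRightDescent v (if Even m then j else i) := by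
    intro h
    refine hmQ ⟨v * cs.simple (if Even m then j else i), ?_, ?_⟩
    · rw [CoxeterSystem.alternatingWord_succ', cs.wordProd_cons, mul_assoc,
        cs.simple_mul_simple_cancel_left, ← hv]
    · have := (cs.isRightDescent_iff).1 h
      omega
  have hprev : ¬ cs.IsRightDescent v (if Even m then i else j) := by
    intro h
    obtain ⟨k, rfl⟩ : ∃ k, m = k + 1 := ⟨m - 1, by omega⟩
    have e1 : (if Even (k + 1) then i else j) = if Even k then j else i := by
      by_cases hk : Even k <;> simp [hk, Nat.even_add_one]
    rw [e1] at h
    rw [CoxeterSystem.alternatingWord_succ', cs.wordProd_cons, ← mul_assoc] at hv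
    have h1 := (cs.isRightDescent_iff).1 h
    have h2 := cs.length_mul_le (v * cs.simple (if Even k then j else i))
      (cs.wordProd (CoxeterSystem.alternatingWord i j k))
    have h3 := hlen i j k
    rw [← hv] at h2
    omega
  have hvi : ¬ cs.IsRightDescent v i := by
    by_cases hm : Even m
    · simpa [hm] using hprev
    · simpa [hm] using hnext
  have hvj : ¬ cs.IsRightDescent v j := by
    by_cases hm : Even m
    · simpa [hm] using hnext
    · simpa [hm] using hprev
  have pi' := ih _ (by omega) hvi rfl
  have pj' := ih _ (by omega) hvj rfl
  have key := congrArg (geomRep cs v) (geomRep_alternatingWord cs i j m)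
  rw [map_smul, ← geomRep_mul_apply, ← hv] at key
  have hMpos : (0 : ℝ) < M i j := by exact_mod_cast Nat.pos_of_ne_zero hM0
  have hM2 : 2 ≤ M i j := by have := M.off_diagonal i j hij; omega
  have hM2' : (2 : ℝ) ≤ M i j := by exact_mod_cast hM2
  have hθ : 0 < π / M i j := by positivity
  have hθπ : M i j * (π / M i j) = π := by field_simp
  have hs : 0 < sin (π / M i j) := sin_pos_of_pos_of_lt_pi hθ (by nlinarith)
  have hmM' : (m : ℝ) + 1 ≤ M i j := by exact_mod_cast hmM
  have s1 : 0 ≤ sin (m * (π / M i j)) := sin_nonneg_of_nonneg_of_le_pi (by positivity) (by nlinarith)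
  have s2 : 0 ≤ sin ((m + 1) * (π / M i j)) :=
    sin_nonneg_of_nonneg_of_le_pi (by positivity) (by nlinarith)
  have hnn : 0 ≤ sin (π / M i j) • geomRep cs w (simpleRoot i) := by
    rw [key]
    split_ifs <;> rw [map_add, map_smul, map_smul] <;>
      exact add_nonneg (smul_nonneg ‹_› ‹_›) (smul_nonneg ‹_› ‹_›)
  intro x
  have := hnn x
  simp only [Pi.smul_apply, smul_eq_mul, Pi.zero_apply] at this ⊢
  exact nonneg_of_mul_nonneg_right this hs

theorem geomRep_simple_simpleRoot_self (i : B) :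
    geomRep cs (cs.simple i) (simpleRoot i) = - simpleRoot i := by
  rw [geomRep_simple, formReflection_apply, coxeterForm_simpleRoot_self, two_smul]; abel

theorem geomRep_simpleRoot_nonpos (hpos : ∀ v ≠ 0, 0 < coxeterForm M v v) {w : W} {i : B}
    (hi : cs.IsRightDescent w i) : geomRep cs w (simpleRoot i) ≤ 0 := by
  have h1 := geomRep_simpleRoot_nonneg cs hpos ((cs.isRightDescent_iff_not_isRightDescent_mul).1 hi)
  rw [geomRep_mul_apply, geomRep_simple_simpleRoot_self, map_neg] at h1
  exact neg_nonneg.1 h1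

/-- The roots of the geometric representation. -/
def coxeterRoots : Set (B → ℝ) := {β | ∃ w i, β = geomRep cs w (simpleRoot i)}

theorem simpleRoot_mem_coxeterRoots (i : B) : simpleRoot i ∈ coxeterRoots cs :=
  ⟨1, i, by simp⟩

theorem geomRep_mem_coxeterRoots (w : W) {β : B → ℝ} (hβ : β ∈ coxeterRoots cs) :
    geomRep cs w β ∈ coxeterRoots cs := by
  obtain ⟨x, i, rfl⟩ := hβ
  exact ⟨w * x, i, by rw [geomRep_mul_apply]⟩

theorem neg_mem_coxeterRoots {β : B → ℝ} (hβ : β ∈ coxeterRoots cs) :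
    -β ∈ coxeterRoots cs := by
  obtain ⟨x, i, rfl⟩ := hβ
  exact ⟨x * cs.simple i, i, by rw [geomRep_mul_apply, geomRep_simple_simpleRoot_self, map_neg]⟩

theorem coxeterForm_root_self {β : B → ℝ} (hβ : β ∈ coxeterRoots cs) : coxeterForm M β β = 2 := by
  obtain ⟨x, i, rfl⟩ := hβ
  rw [coxeterForm_geomRep, coxeterForm_simpleRoot_self]

theorem coxeterRoots_finite [Finite W] : (coxeterRoots cs).Finite := by
  refine (Set.finite_range fun p : W × B => geomRep cs p.1 (simpleRoot p.2)).subset ?_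
  rintro _ ⟨w, i, rfl⟩
  exact ⟨(w, i), rfl⟩

theorem coxeterRoots_nonneg_or_nonpos (hpos : ∀ v ≠ 0, 0 < coxeterForm M v v) {β : B → ℝ}
    (hβ : β ∈ coxeterRoots cs) : 0 ≤ β ∨ β ≤ 0 := by
  obtain ⟨w, i, rfl⟩ := hβ
  by_cases h : cs.IsRightDescent w i
  · exact Or.inr (geomRep_simpleRoot_nonpos cs hpos h)
  · exact Or.inl (geomRep_simpleRoot_nonneg cs hpos h)

theorem geomRep_conj_simple (w : W) (i : B) :
    geomRep cs (w * cs.simple i * w⁻¹) =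
      formReflection (coxeterForm M) (geomRep cs w (simpleRoot i)) := by
  refine LinearMap.ext fun v => ?_
  rw [geomRep_mul_apply, geomRep_mul_apply, geomRep_simple, formReflection_apply, map_sub,
    map_smul, geomRep_apply_inv_self, formReflection_apply, coxeterForm_geomRep_left]

theorem eq_one_of_geomRep_nonneg (hpos : ∀ v ≠ 0, 0 < coxeterForm M v v) {w : W}
    (h : ∀ i, 0 ≤ geomRep cs w (simpleRoot i)) : w = 1 := by
  by_contra hw
  obtain ⟨i, hi⟩ := cs.exists_rightDescent_of_ne_one hw
  have h0 := le_antisymm (geomRep_simpleRoot_nonpos cs hpos hi) (h i)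
  have h1 := geomRep_inv_apply_self cs w (simpleRoot i)
  rw [h0, map_zero] at h1
  have := congrFun h1 i
  simp [simpleRoot] at this

theorem geomRep_injective (hpos : ∀ v ≠ 0, 0 < coxeterForm M v v) :
    Function.Injective (geomRep cs) := by
  rw [injective_iff_map_eq_one]
  intro w hw
  refine eq_one_of_geomRep_nonneg cs hpos fun i => ?_
  rw [hw]
  simp [simpleRoot]

theorem exists_dominant [Finite W] (a : B → ℝ) :
    ∃ g : W, ∀ i, 0 ≤ coxeterForm M (simpleRoot i) (geomRep cs g a) := by
  obtain ⟨g, hg⟩ := Finite.exists_max fun g : W => ∑ i, geomRep cs g a i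
  refine ⟨g, fun i => ?_⟩
  have h1 := hg (cs.simple i * g)
  simp only [geomRep_mul_apply, geomRep_simple, formReflection_apply, Pi.sub_apply, Pi.smul_apply,
    Finset.sum_sub_distrib, smul_eq_mul, ← Finset.mul_sum] at h1
  have h2 : ∑ k, (simpleRoot i : B → ℝ) k = 1 := by simp [simpleRoot]
  rw [h2] at h1
  linarith

/-- The stabilizer of a vector is generated by the reflections that it contains. -/
theorem mem_closure_reflections_of_fixed [Finite W] (hpos : ∀ v ≠ 0, 0 < coxeterForm M v v)
    {x : W} {a : B → ℝ} (hx : geomRep cs x a = a) :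
    x ∈ Subgroup.closure {t : W | ∃ β ∈ coxeterRoots cs, coxeterForm M β a = 0 ∧
      geomRep cs t = formReflection (coxeterForm M) β} := by
  have dom : ∀ (a : B → ℝ), (∀ i, 0 ≤ coxeterForm M (simpleRoot i) a) → ∀ (n : ℕ) (x : W),
      cs.length x = n → geomRep cs x a = a →
      x ∈ Subgroup.closure {t : W | ∃ β ∈ coxeterRoots cs, coxeterForm M β a = 0 ∧
        geomRep cs t = formReflection (coxeterForm M) β} := by
    intro a ha n
    induction n using Nat.strong_induction_on with
    | _ n ih =>
    rintro x rfl hx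
    by_cases h1 : x = 1
    · rw [h1]; exact one_mem _
    obtain ⟨i, hi⟩ := cs.exists_rightDescent_of_ne_one h1
    have h2 := geomRep_simpleRoot_nonpos cs hpos hi
    have h3 : coxeterForm M (geomRep cs x (simpleRoot i)) a = coxeterForm M (simpleRoot i) a := by
      conv_lhs => rw [← hx]
      rw [coxeterForm_geomRep]
    have h4 : coxeterForm M (geomRep cs x (simpleRoot i)) a ≤ 0 := by
      rw [coxeterForm_eq_sum]
      exact Finset.sum_nonpos fun k _ => mul_nonpos_of_nonpos_of_nonneg (h2 k) (ha k)
    have h5 : coxeterForm M (simpleRoot i) a = 0 := le_antisymm (h3 ▸ h4) (ha i)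
    have h6 : geomRep cs (x * cs.simple i) a = a := by
      rw [geomRep_mul_apply, geomRep_simple, formReflection_apply, h5, zero_smul, sub_zero, hx]
    have h7 := ih _ hi (x * cs.simple i) rfl h6
    rw [← cs.simple_mul_simple_cancel_right (w := x) i]
    exact mul_mem h7 (Subgroup.subset_closure
      ⟨_, simpleRoot_mem_coxeterRoots cs i, h5, geomRep_simple cs i⟩)
  obtain ⟨g, hg⟩ := exists_dominant cs a
  have h1 := dom _ hg _ (g * x * g⁻¹) rfl (by
    rw [geomRep_mul_apply, geomRep_mul_apply, geomRep_inv_apply_self, hx])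
  have h2 : ∀ y ∈ Subgroup.closure {t : W | ∃ β ∈ coxeterRoots cs,
      coxeterForm M β (geomRep cs g a) = 0 ∧ geomRep cs t = formReflection (coxeterForm M) β},
      g⁻¹ * y * g ∈ Subgroup.closure {t : W | ∃ β ∈ coxeterRoots cs, coxeterForm M β a = 0 ∧
        geomRep cs t = formReflection (coxeterForm M) β} := by
    intro y hy
    induction hy using Subgroup.closure_induction with
    | mem y hy =>
      obtain ⟨β, hβ, h0, hy⟩ := hy
      refine Subgroup.subset_closure ⟨geomRep cs g⁻¹ β, geomRep_mem_coxeterRoots cs _ hβ, ?_, ?_⟩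
      · rw [coxeterForm_geomRep_left, inv_inv, h0]
      · refine LinearMap.ext fun v => ?_
        rw [geomRep_mul_apply, geomRep_mul_apply, hy, formReflection_apply, formReflection_apply,
          map_sub, map_smul, geomRep_inv_apply_self, coxeterForm_geomRep_left, inv_inv]
    | one => simp
    | mul y z _ _ hy hz =>
      have := mul_mem hy hz
      simpa [mul_assoc] using this
    | inv y _ hy =>
      have := inv_mem hy
      simpa [mul_assoc] using this
  have h3 := h2 _ h1
  simpa [mul_assoc] using h3

end SignTheorem

section ReflectionReps

open Module

/-- An orthogonal representation of a group `W` with generating set of involutions `S` in which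
the reflections of `W` act as the orthogonal reflections in a finite root system, and in which
stabilizers of vectors are generated by reflections. -/
structure ReflectionRep {W : Type*} [Group W] (S : Set W) (V : Type*) [AddCommGroup V]
    [Module ℝ V] where
  ρ : W →* Module.End ℝ V
  form : V →ₗ[ℝ] V →ₗ[ℝ] ℝ
  Φ : Set V
  refl : V → W
  form_comm : ∀ u v, form u v = form v u
  form_pos : ∀ v ≠ 0, 0 < form v v
  form_inv : ∀ w u v, form (ρ w u) (ρ w v) = form u v
  norm : ∀ β ∈ Φ, form β β = 2
  mem : ∀ w, ∀ β ∈ Φ, ρ w β ∈ Φ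
  neg_mem : ∀ β ∈ Φ, -β ∈ Φ
  finite : Φ.Finite
  injective : Function.Injective ρ
  isReflection : ∀ β ∈ Φ, IsReflectionOf S (refl β)
  ρ_refl : ∀ β ∈ Φ, ρ (refl β) = formReflection form β
  exists_root : ∀ t, IsReflectionOf S t → ∃ β ∈ Φ, t = refl β
  stab : ∀ x a, ρ x a = a →
    x ∈ Subgroup.closure {t | ∃ β ∈ Φ, form β a = 0 ∧ t = refl β}

namespace ReflectionRep

variable {W : Type*} [Group W] {S : Set W} {V : Type*} [AddCommGroup V] [Module ℝ V]
  [FiniteDimensional ℝ V] (R : ReflectionRep S V)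

theorem ρ_mul (w x : W) (v : V) : R.ρ (w * x) v = R.ρ w (R.ρ x v) := by
  rw [map_mul, Module.End.mul_apply]

theorem ρ_inv_self (w : W) (v : V) : R.ρ w⁻¹ (R.ρ w v) = v := by
  rw [← ρ_mul, inv_mul_cancel, map_one, Module.End.one_apply]

theorem ρ_self_inv (w : W) (v : V) : R.ρ w (R.ρ w⁻¹ v) = v := by
  rw [← ρ_mul, mul_inv_cancel, map_one, Module.End.one_apply]

theorem ne_zero {β : V} (hβ : β ∈ R.Φ) : β ≠ 0 := by
  rintro rfl
  have := R.norm 0 hβ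
  simp at this

theorem refl_apply {β : V} (hβ : β ∈ R.Φ) (v : V) :
    R.ρ (R.refl β) v = v - R.form β v • β := by
  rw [R.ρ_refl β hβ, formReflection_apply]

/-- The moved space of a group element. -/
def mov (w : W) : Submodule ℝ V := LinearMap.range (LinearMap.id - R.ρ w)

/-- The fixed space of a group element. -/
def fix (w : W) : Submodule ℝ V := LinearMap.ker (LinearMap.id - R.ρ w)

theorem mem_mov {w : W} {v : V} : v ∈ R.mov w ↔ ∃ a, a - R.ρ w a = v := by
  simp [mov]

theorem sub_mem_mov (w : W) (a : V) : a - R.ρ w a ∈ R.mov w := R.mem_mov.2 ⟨a, rfl⟩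

theorem mem_fix {w : W} {v : V} : v ∈ R.fix w ↔ R.ρ w v = v := by
  rw [fix, LinearMap.mem_ker, LinearMap.sub_apply, LinearMap.id_apply, sub_eq_zero, eq_comm]

theorem finrank_mov_add_finrank_fix (w : W) :
    finrank ℝ (R.mov w) + finrank ℝ (R.fix w) = finrank ℝ V :=
  LinearMap.finrank_range_add_finrank_ker _

theorem form_mov_fix {w : W} {u a : V} (hu : u ∈ R.mov w) (ha : a ∈ R.fix w) :
    R.form u a = 0 := by
  obtain ⟨b, rfl⟩ := R.mem_mov.1 hu
  have h := R.form_inv w b a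
  rw [R.mem_fix.1 ha] at h
  rw [map_sub, LinearMap.sub_apply, h, sub_self]

theorem eq_zero_of_form_self {v : V} (h : R.form v v = 0) : v = 0 := by
  by_contra hv
  exact (R.form_pos v hv).ne' h

theorem mov_sup_fix (w : W) : R.mov w ⊔ R.fix w = ⊤ := by
  refine Submodule.eq_top_of_disjoint _ _ (R.finrank_mov_add_finrank_fix w).ge ?_
  rw [Submodule.disjoint_def]
  exact fun v hm hf => R.eq_zero_of_form_self (R.form_mov_fix hm hf)

theorem mem_mov_of_form_fix {w : W} {v : V} (h : ∀ a ∈ R.fix w, R.form v a = 0) :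
    v ∈ R.mov w := by
  have hv : v ∈ R.mov w ⊔ R.fix w := by rw [mov_sup_fix]; trivial
  obtain ⟨m, hm, f, hf, rfl⟩ := Submodule.mem_sup.1 hv
  have h1 := h f hf
  rw [map_add, LinearMap.add_apply, R.form_mov_fix hm hf, zero_add] at h1
  rw [R.eq_zero_of_form_self h1, add_zero]
  exact hm

/-- A subspace contains a vector whose orthogonal roots are orthogonal to the whole subspace. -/
theorem exists_generic (U : Submodule ℝ V) :
    ∃ a ∈ U, ∀ β ∈ R.Φ, R.form β a = 0 → ∀ u ∈ U, R.form β u = 0 := by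
  classical
  let p : V → Submodule ℝ U := fun β => (LinearMap.ker (R.form β)).comap U.subtype
  let s : Finset (Submodule ℝ U) := (R.finite.toFinset.image p).filter (· ≠ ⊤)
  have hs : (⊤ : Submodule ℝ U) ∉ s := by simp [s]
  have h1 := Subspace.biUnion_ne_univ_of_top_notMem hs
  obtain ⟨a, ha⟩ := (Set.ne_univ_iff_exists_notMem _).1 h1
  refine ⟨a, a.2, fun β hβ h0 u hu => ?_⟩
  by_contra hne
  apply ha
  refine Set.mem_biUnion (x := p β) ?_ ?_
  · simp only [s, Finset.coe_filter, Finset.mem_image, Set.Finite.mem_toFinset, Set.mem_ofPred_eq]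
    refine ⟨⟨β, hβ, rfl⟩, fun h => hne ?_⟩
    have h2 : (⟨u, hu⟩ : U) ∈ p β := by rw [h]; trivial
    simpa [p] using h2
  · simpa [p] using h0

theorem mem_closure_refl_mov (w : W) :
    w ∈ Subgroup.closure {t | ∃ β ∈ R.Φ, β ∈ R.mov w ∧ t = R.refl β} := by
  obtain ⟨a, ha, hgen⟩ := R.exists_generic (R.fix w)
  refine Subgroup.closure_mono ?_ (R.stab w a (R.mem_fix.1 ha))
  rintro t ⟨β, hβ, h0, rfl⟩
  exact ⟨β, hβ, R.mem_mov_of_form_fix (hgen β hβ h0), rfl⟩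

theorem mov_le_span (w : W) : R.mov w ≤ Submodule.span ℝ {β | β ∈ R.Φ ∧ β ∈ R.mov w} := by
  have h : ∀ y ∈ Subgroup.closure {t | ∃ β ∈ R.Φ, β ∈ R.mov w ∧ t = R.refl β}, ∀ a : V,
      a - R.ρ y a ∈ Submodule.span ℝ {β | β ∈ R.Φ ∧ β ∈ R.mov w} := by
    intro y hy
    induction hy using Subgroup.closure_induction with
    | mem y hy =>
      obtain ⟨β, hβ, hm, rfl⟩ := hy
      intro a
      rw [R.refl_apply hβ, sub_sub_cancel]
      exact Submodule.smul_mem _ _ (Submodule.subset_span ⟨hβ, hm⟩)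
    | one => simp
    | mul y z _ _ hy hz =>
      intro a
      have := add_mem (hz a) (hy (R.ρ z a))
      rwa [sub_add_sub_cancel, ← ρ_mul] at this
    | inv y _ hy =>
      intro a
      have := Submodule.neg_mem _ (hy (R.ρ y⁻¹ a))
      rwa [neg_sub, ρ_self_inv] at this
  intro v hv
  obtain ⟨a, rfl⟩ := R.mem_mov.1 hv
  exact h w (R.mem_closure_refl_mov w) a

theorem exists_root_mem_mov {w : W} (hw : w ≠ 1) : ∃ β ∈ R.Φ, β ∈ R.mov w := by
  by_contra! h
  have h1 := R.mem_closure_refl_mov w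
  have h2 : {t | ∃ β ∈ R.Φ, β ∈ R.mov w ∧ t = R.refl β} = ∅ := by
    refine Set.eq_empty_of_forall_notMem ?_
    rintro t ⟨β, hβ, hm, -⟩
    exact h β hβ hm
  rw [h2, Subgroup.closure_empty, Subgroup.mem_bot] at h1
  exact hw h1

@[simp]
theorem mov_one : R.mov 1 = ⊥ := by
  rw [eq_bot_iff]
  intro v hv
  obtain ⟨a, rfl⟩ := R.mem_mov.1 hv
  simp

theorem mov_mul_le (x y : W) : R.mov (x * y) ≤ R.mov x ⊔ R.mov y := by
  intro v hv
  obtain ⟨a, rfl⟩ := R.mem_mov.1 hv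
  rw [ρ_mul, ← sub_add_sub_cancel a (R.ρ y a), add_comm]
  exact Submodule.add_mem_sup (R.sub_mem_mov _ _) (R.sub_mem_mov _ _)

theorem mov_refl {β : V} (hβ : β ∈ R.Φ) : R.mov (R.refl β) = Submodule.span ℝ {β} := by
  refine le_antisymm ?_ ?_
  · intro v hv
    obtain ⟨a, rfl⟩ := R.mem_mov.1 hv
    rw [R.refl_apply hβ, sub_sub_cancel]
    exact Submodule.smul_mem _ _ (Submodule.mem_span_singleton_self _)
  · rw [Submodule.span_singleton_le_iff_mem, R.mem_mov]
    refine ⟨(1 / 2 : ℝ) • β, ?_⟩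
    rw [R.refl_apply hβ, map_smul, R.norm β hβ]
    module

theorem finrank_mov_refl {β : V} (hβ : β ∈ R.Φ) : finrank ℝ (R.mov (R.refl β)) = 1 := by
  rw [R.mov_refl hβ, finrank_span_singleton (R.ne_zero hβ)]

theorem finrank_mov_mul_le (x y : W) :
    finrank ℝ (R.mov (x * y)) ≤ finrank ℝ (R.mov x) + finrank ℝ (R.mov y) :=
  (Submodule.finrank_mono (R.mov_mul_le x y)).trans
    (Submodule.finrank_add_le_finrank_add_finrank _ _)

theorem finrank_mov_prod_le (l : List W) (hl : ∀ t ∈ l, IsReflectionOf S t) :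
    finrank ℝ (R.mov l.prod) ≤ l.length := by
  induction l with
  | nil => rw [List.prod_nil, mov_one]; exact (finrank_bot ℝ V).le
  | cons t l ih =>
    obtain ⟨β, hβ, rfl⟩ := R.exists_root t (hl t (by simp))
    have h1 := ih fun s hs => hl s (by simp [hs])
    have h2 := R.finrank_mov_mul_le (R.refl β) l.prod
    rw [R.finrank_mov_refl hβ] at h2
    rw [List.prod_cons, List.length_cons]
    omega

theorem fix_lt_fix_refl_mul {w : W} {β : V} (hβ : β ∈ R.Φ) (hm : β ∈ R.mov w) :
    R.fix w < R.fix (R.refl β * w) := by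
  obtain ⟨a, ha⟩ := R.mem_mov.1 hm
  refine SetLike.lt_iff_le_and_exists.2 ⟨fun f hf => ?_, a, ?_, ?_⟩
  · have h1 := R.form_mov_fix hm hf
    rw [mem_fix, ρ_mul, R.mem_fix.1 hf, R.refl_apply hβ, h1, zero_smul, sub_zero]
  · have e : R.ρ w a = a - β := by rw [← ha]; abel
    have h1 := R.form_inv w a a
    have h2 := R.norm β hβ
    rw [e] at h1
    simp only [map_sub, LinearMap.sub_apply, R.form_comm a β, h2] at h1
    have h3 : R.form β a = 1 := by linarith
    rw [mem_fix, ρ_mul, R.refl_apply hβ, e, map_sub, h2, h3]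
    module
  · intro h
    rw [R.mem_fix.1 h, sub_self] at ha
    exact R.ne_zero hβ ha.symm

theorem finrank_mov_refl_mul_lt {w : W} {β : V} (hβ : β ∈ R.Φ) (hm : β ∈ R.mov w) :
    finrank ℝ (R.mov (R.refl β * w)) < finrank ℝ (R.mov w) := by
  have h1 := Submodule.finrank_lt_finrank_of_lt (R.fix_lt_fix_refl_mul hβ hm)
  have h2 := R.finrank_mov_add_finrank_fix w
  have h3 := R.finrank_mov_add_finrank_fix (R.refl β * w)
  omega

theorem refl_mul_refl {β : V} (hβ : β ∈ R.Φ) : R.refl β * R.refl β = 1 := by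
  apply R.injective
  rw [map_mul, map_one, R.ρ_refl β hβ]
  exact formReflection_mul_self _ (R.norm β hβ)

theorem exists_list (w : W) : ∃ l : List W, (∀ t ∈ l, IsReflectionOf S t) ∧
    l.length = finrank ℝ (R.mov w) ∧ l.prod = w := by
  induction hn : finrank ℝ (R.mov w) using Nat.strong_induction_on generalizing w with
  | _ n ih =>
  subst hn
  by_cases hw : w = 1
  · subst hw
    exact ⟨[], by simp, by rw [mov_one]; exact (finrank_bot ℝ V).symm, rfl⟩
  obtain ⟨β, hβ, hm⟩ := R.exists_root_mem_mov hw
  have h1 := R.finrank_mov_refl_mul_lt hβ hm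
  obtain ⟨l, hl, hlen, hprod⟩ := ih _ h1 _ rfl
  have hl' : ∀ t ∈ R.refl β :: l, IsReflectionOf S t := by
    intro t ht
    rcases List.mem_cons.1 ht with rfl | ht
    · exact R.isReflection β hβ
    · exact hl t ht
  have hp : (R.refl β :: l).prod = w := by
    rw [List.prod_cons, hprod, ← mul_assoc, R.refl_mul_refl hβ, one_mul]
  have h2 := R.finrank_mov_prod_le _ hl'
  rw [hp] at h2
  rw [List.length_cons] at h2
  exact ⟨_, hl', by rw [List.length_cons]; omega, hp⟩

/-- **Carter's lemma**: the absolute length is the dimension of the moved space. -/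
theorem absLength_eq (w : W) : absLength S w = finrank ℝ (R.mov w) := by
  obtain ⟨l, hl, hlen, hp⟩ := R.exists_list w
  refine le_antisymm (Nat.sInf_le ⟨l, hl, hlen, hp⟩) ?_
  obtain ⟨l', hl', hlen', hp'⟩ := Nat.sInf_mem
    (s := {k | ∃ l : List W, (∀ t ∈ l, IsReflectionOf S t) ∧ l.length = k ∧ l.prod = w})
    ⟨_, l, hl, hlen, hp⟩
  rw [absLength, ← hlen', ← hp']
  exact R.finrank_mov_prod_le l' hl'

theorem absLength_eq_one_iff (w : W) : absLength S w = 1 ↔ ∃ β ∈ R.Φ, w = R.refl β := by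
  constructor
  · intro h
    obtain ⟨l, hl, hlen, hp⟩ := R.exists_list w
    rw [← R.absLength_eq, h] at hlen
    obtain ⟨t, rfl⟩ := List.length_eq_one_iff.1 hlen
    rw [List.prod_singleton] at hp
    subst hp
    exact R.exists_root t (hl t (by simp))
  · rintro ⟨β, hβ, rfl⟩
    rw [R.absLength_eq, R.finrank_mov_refl hβ]

end ReflectionRep

end ReflectionReps

section NoncrossingEuler

open Module Submodule

namespace ReflectionRep

variable {W : Type*} [Group W] {S : Set W} {V : Type*} [AddCommGroup V] [Module ℝ V]
  [FiniteDimensional ℝ V] (R : ReflectionRep S V) {c : W} {D : Module.End ℝ V}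
  (hD : ∀ v, D v - R.ρ c (D v) = v)

include hD

theorem apply_sub_coxeter (v : V) : D (v - R.ρ c v) = v := by
  have hs : Function.Surjective (LinearMap.id - R.ρ c : V →ₗ[ℝ] V) := fun v => ⟨D v, hD v⟩
  have hi := LinearMap.injective_iff_surjective.2 hs
  exact hi (hD (v - R.ρ c v))

theorem apply_coxeter (v : V) : D (R.ρ c v) = R.ρ c (D v) := by
  have h := R.apply_sub_coxeter hD (R.ρ c (D v))
  rwa [← map_sub, hD] at h

theorem mov_eq_top : R.mov c = ⊤ :=
  eq_top_iff.2 fun v _ => R.mem_mov.2 ⟨D v, hD v⟩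

omit hD

variable (D) in
/-- The Euler form attached to an inverse `D` of `1 - c`. -/
def euler : V →ₗ[ℝ] V →ₗ[ℝ] ℝ := R.form.comp D

theorem euler_apply (u v : V) : R.euler D u v = R.form (D u) v := rfl

include hD

theorem euler_add (u v : V) : R.euler D u v + R.euler D v u = R.form u v := by
  have hu := hD u
  have hv := hD v
  generalize D u = a at hu
  generalize D v = b at hv
  have ha := R.apply_sub_coxeter hD a
  have hb := R.apply_sub_coxeter hD b
  subst hu hv
  rw [euler_apply, euler_apply, ha, hb]
  have h1 := R.form_inv c a b
  simp only [map_sub, LinearMap.sub_apply, h1, R.form_comm b]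
  ring

theorem euler_left (u v : V) : R.euler D u v = R.form u v - R.euler D v u := by
  linarith [R.euler_add hD u v]

theorem euler_self (v : V) : R.euler D v v = R.form v v / 2 := by
  linarith [R.euler_add hD v v]

theorem euler_root {β : V} (hβ : β ∈ R.Φ) : R.euler D β β = 1 := by
  rw [R.euler_self hD, R.norm β hβ]; norm_num

theorem euler_pos (v : V) (hv : v ≠ 0) : 0 < R.euler D v v := by
  rw [R.euler_self hD]
  exact half_pos (R.form_pos v hv)

theorem euler_coxeter (u v : V) : R.euler D (R.ρ c u) v = -R.euler D v u := by
  rw [euler_apply, R.apply_coxeter hD, euler_apply]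
  have hv := hD v
  have hu := hD u
  generalize D u = a at hu
  generalize D v = b at hv
  subst hu hv
  have h1 := R.form_inv c a b
  simp only [map_sub, LinearMap.sub_apply, R.form_comm b, h1]
  ring

theorem euler_coxeter_coxeter (u v : V) :
    R.euler D (R.ρ c u) (R.ρ c v) = R.euler D u v := by
  rw [R.euler_coxeter hD, R.euler_coxeter hD, neg_neg]

omit hD

variable (D) in
/-- The group element `w` is the noncrossing element with moved space `U`: for every `a` the
vector `a - w a` represents the functional of `a` on `U` under the Euler form. -/
def IsNC (w : W) (U : Submodule ℝ V) : Prop :=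
  ∀ a, a - R.ρ w a ∈ U ∧ ∀ v ∈ U, R.euler D (a - R.ρ w a) v = R.form a v

variable {R}

include hD

theorem euler_ext {U : Submodule ℝ V} {g h : V} (hg : g ∈ U) (hh : h ∈ U)
    (H : ∀ v ∈ U, R.euler D g v = R.euler D h v) : g = h := by
  by_contra hne
  have h1 := R.euler_pos hD (g - h) (sub_ne_zero.2 hne)
  have h2 := H _ (sub_mem hg hh)
  rw [map_sub (R.euler D), LinearMap.sub_apply, h2, sub_self] at h1
  exact h1.false

theorem IsNC.mov_eq {w : W} {U : Submodule ℝ V} (h : R.IsNC D w U) : R.mov w = U := by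
  refine le_antisymm ?_ fun g hg => ?_
  · intro v hv
    obtain ⟨a, rfl⟩ := R.mem_mov.1 hv
    exact (h a).1
  · obtain ⟨a, -, ha⟩ := exists_repr_left R.form_pos ⊤ (R.euler D g)
    have h1 : g = a - R.ρ w a := euler_ext hD hg (h a).1 fun v hv => by
      rw [(h a).2 v hv, ha v trivial]
    rw [h1]
    exact R.sub_mem_mov w a

theorem IsNC.unique {w w' : W} {U : Submodule ℝ V} (h : R.IsNC D w U) (h' : R.IsNC D w' U) :
    w = w' := by
  refine R.injective (LinearMap.ext fun a => ?_)
  have h1 := euler_ext hD (h a).1 (h' a).1 fun v hv => by rw [(h a).2 v hv, (h' a).2 v hv]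
  exact sub_right_injective h1

theorem D_injective : Function.Injective D := fun u v h => by
  rw [← hD u, ← hD v, h]

theorem IsNC.absLe {w : W} {U : Submodule ℝ V} (h : R.IsNC D w U) : absLe S w c := by
  have hU := h.mov_eq hD
  have h1 : U.map D ≤ R.fix (w⁻¹ * c) := by
    rintro - ⟨u, hu, rfl⟩
    have e := hD u
    have h2 : u = D u - R.ρ w (D u) := euler_ext hD hu (h (D u)).1 fun v hv => by
      rw [(h (D u)).2 v hv, euler_apply]
    have h3 : R.ρ w (D u) = R.ρ c (D u) := by
      apply sub_right_injective (b := D u)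
      show D u - _ = D u - _
      rw [e, ← h2]
    rw [mem_fix, ρ_mul, ← h3, ρ_inv_self]
  have h2 := Submodule.finrank_mono h1
  rw [← (Submodule.equivMapOfInjective D (D_injective hD) U).finrank_eq] at h2
  have h3 := R.finrank_mov_add_finrank_fix (w⁻¹ * c)
  have h4 := R.finrank_mov_mul_le w (w⁻¹ * c)
  rw [mul_inv_cancel_left, R.mov_eq_top hD, finrank_top] at h4
  rw [_root_.absLe, R.absLength_eq, R.absLength_eq, R.absLength_eq, R.mov_eq_top hD, finrank_top]
  rw [hU] at h4 ⊢
  omega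

theorem isNC_of_absLe {w : W} (h : absLe S w c) : R.IsNC D w (R.mov w) := by
  rw [_root_.absLe, R.absLength_eq, R.absLength_eq, R.absLength_eq, R.mov_eq_top hD,
    finrank_top] at h
  have h3 := R.finrank_mov_add_finrank_fix (w⁻¹ * c)
  have h1 : ∀ a ∈ R.fix (w⁻¹ * c), R.ρ c a = R.ρ w a := fun a ha => by
    have := R.mem_fix.1 ha
    rw [ρ_mul] at this
    rw [← R.ρ_self_inv w (R.ρ c a), this]
  have hi : Function.Injective (LinearMap.id - R.ρ c : V →ₗ[ℝ] V) := fun u v e =>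
    (R.apply_sub_coxeter hD u).symm.trans ((congrArg D e).trans (R.apply_sub_coxeter hD v))
  have h2 : (R.fix (w⁻¹ * c)).map (LinearMap.id - R.ρ c : V →ₗ[ℝ] V) = R.mov w := by
    refine Submodule.eq_of_le_of_finrank_eq ?_ ?_
    · rintro - ⟨a, ha, rfl⟩
      rw [LinearMap.sub_apply, LinearMap.id_apply, h1 a ha]
      exact R.sub_mem_mov w a
    · rw [← (Submodule.equivMapOfInjective _ hi _).finrank_eq]
      omega
  intro a
  refine ⟨R.sub_mem_mov w a, fun v hv => ?_⟩
  have h4 := R.sub_mem_mov w a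
  rw [← h2] at h4
  obtain ⟨a', ha', e⟩ := h4
  rw [LinearMap.sub_apply, LinearMap.id_apply] at e
  rw [← e, euler_apply, R.apply_sub_coxeter hD]
  rw [h1 a' ha'] at e
  have h5 : a - a' ∈ R.fix w := by
    rw [mem_fix, map_sub]
    have := congrArg (fun t => a - t) e
    rw [sub_sub_cancel] at this
    rw [← this]; abel
  have h6 := R.form_mov_fix hv h5
  rw [map_sub, R.form_comm v, R.form_comm v] at h6
  linarith

theorem IsNC.inf_right {w : W} {U : Submodule ℝ V} (h : R.IsNC D w U) {β : V} (hβ : β ∈ R.Φ)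
    (hU : β ∈ U) : R.IsNC D (R.refl β * w) (U ⊓ LinearMap.ker (R.euler D β)) := by
  intro a
  obtain ⟨h1, h2⟩ := h a
  have e : a - R.ρ (R.refl β * w) a =
      (a - R.ρ w a) - R.euler D β (a - R.ρ w a) • β := by
    have h3 := h2 β hU
    have h4 : R.form β (R.ρ w a) = -R.euler D β (a - R.ρ w a) := by
      rw [R.euler_left hD β, h3, map_sub, R.form_comm a]; ring
    rw [ρ_mul, R.refl_apply hβ, h4]
    module
  rw [e]
  refine ⟨⟨sub_mem h1 (U.smul_mem _ hU), ?_⟩, ?_⟩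
  · rw [SetLike.mem_coe, LinearMap.mem_ker, map_sub, map_smul, R.euler_root hD hβ, smul_eq_mul,
      mul_one, sub_self]
  · rintro v ⟨hv, hv0⟩
    rw [SetLike.mem_coe, LinearMap.mem_ker] at hv0
    rw [map_sub, map_smul, LinearMap.sub_apply, LinearMap.smul_apply, hv0, smul_zero, sub_zero,
      h2 v hv]

theorem IsNC.inf_left {w : W} {U : Submodule ℝ V} (h : R.IsNC D w U) {β : V} (hβ : β ∈ R.Φ)
    (hU : β ∈ U) : R.IsNC D (w * R.refl β) (U ⊓ LinearMap.ker ((R.euler D).flip β)) := by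
  intro a
  obtain ⟨h1, h2⟩ := h (R.ρ (R.refl β) a)
  have e : a - R.ρ (w * R.refl β) a =
      (R.ρ (R.refl β) a - R.ρ w (R.ρ (R.refl β) a)) + R.form β a • β := by
    rw [ρ_mul]
    nth_rw 2 [R.refl_apply hβ]
    module
  rw [e]
  refine ⟨⟨add_mem h1 (U.smul_mem _ hU), ?_⟩, ?_⟩
  · rw [SetLike.mem_coe, LinearMap.mem_ker, LinearMap.flip_apply, map_add, LinearMap.add_apply,
      h2 β hU, map_smul, LinearMap.smul_apply, R.euler_root hD hβ, R.refl_apply hβ, map_sub,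
      map_smul, LinearMap.sub_apply, LinearMap.smul_apply, R.norm β hβ, R.form_comm a]
    simp only [smul_eq_mul]; ring
  · rintro v ⟨hv, hv0⟩
    rw [SetLike.mem_coe, LinearMap.mem_ker, LinearMap.flip_apply] at hv0
    rw [map_add, LinearMap.add_apply, h2 v hv, map_smul, LinearMap.smul_apply,
      R.euler_left hD β, hv0, R.refl_apply hβ, map_sub, map_smul, LinearMap.sub_apply,
      LinearMap.smul_apply]
    simp only [smul_eq_mul]; ring

theorem IsNC.sup_right {w : W} {U : Submodule ℝ V} (h : R.IsNC D w U) {β : V} (hβ : β ∈ R.Φ)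
    (hU : ∀ u ∈ U, R.euler D β u = 0) : R.IsNC D (R.refl β * w) (span ℝ {β} ⊔ U) := by
  intro a
  obtain ⟨h1, h2⟩ := h a
  have hβU : β ∈ span ℝ {β} ⊔ U := mem_sup_left (mem_span_singleton_self _)
  have e : a - R.ρ (R.refl β * w) a = (a - R.ρ w a) + R.form β (R.ρ w a) • β := by
    rw [ρ_mul, R.refl_apply hβ]
    module
  rw [e]
  refine ⟨add_mem (mem_sup_right h1) (Submodule.smul_mem _ _ hβU), ?_⟩
  intro v hv
  obtain ⟨p, hp, u, hu, rfl⟩ := mem_sup.1 hv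
  obtain ⟨r, rfl⟩ := mem_span_singleton.1 hp
  have h3 : R.euler D (a - R.ρ w a) β = R.form β (a - R.ρ w a) := by
    rw [R.euler_left hD, hU _ h1, R.form_comm, sub_zero]
  simp only [map_add, map_smul, LinearMap.add_apply, LinearMap.smul_apply, h2 u hu, h3,
    hU u hu, R.euler_root hD hβ, R.form_comm a β, smul_eq_mul]
  simp only [map_sub]
  ring

theorem IsNC.dual {w : W} {U : Submodule ℝ V} (h : R.IsNC D w U) {P : V} (hP : P ∈ U) :
    -R.ρ w⁻¹ P ∈ U ∧ ∀ v ∈ U, R.euler D P v = R.euler D v (-R.ρ w⁻¹ P) := by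
  obtain ⟨h1, h2⟩ := h (R.ρ w⁻¹ P)
  rw [ρ_self_inv] at h1 h2
  have h3 : R.ρ w⁻¹ P ∈ U := by simpa using add_mem h1 hP
  refine ⟨Submodule.neg_mem _ h3, fun v hv => ?_⟩
  have h4 := h2 v hv
  rw [map_sub, LinearMap.sub_apply, R.euler_left hD] at h4
  rw [map_neg]
  linarith

theorem IsNC.compl_right {x z : W} {X Z : Submodule ℝ V} (hX : R.IsNC D x X)
    (hZ : R.IsNC D z Z) (hZX : Z ≤ X) {Y : Submodule ℝ V}
    (hY : ∀ v, v ∈ Y ↔ v ∈ X ∧ ∀ ζ ∈ Z, R.euler D ζ v = 0) : R.IsNC D (z⁻¹ * x) Y := by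
  intro a
  obtain ⟨h1, h2⟩ := hX a
  obtain ⟨h3, h4⟩ := hZ (R.ρ (z⁻¹ * x) a)
  have e1 : R.ρ z (R.ρ (z⁻¹ * x) a) = R.ρ x a := by rw [← ρ_mul, mul_inv_cancel_left]
  rw [e1] at h3 h4
  have e : a - R.ρ (z⁻¹ * x) a = (a - R.ρ x a) - (R.ρ (z⁻¹ * x) a - R.ρ x a) := by abel
  rw [e]
  constructor
  · rw [hY]
    refine ⟨sub_mem h1 (hZX h3), fun ζ hζ => ?_⟩
    rw [map_sub, R.euler_left hD ζ, R.euler_left hD ζ, h2 ζ (hZX hζ), h4 ζ hζ, map_sub, map_sub,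
      R.form_comm a, R.form_comm (R.ρ (z⁻¹ * x) a)]
    ring
  · intro v hv
    obtain ⟨hv1, hv2⟩ := (hY v).1 hv
    rw [map_sub, LinearMap.sub_apply, h2 v hv1, hv2 _ h3, sub_zero]

theorem IsNC.compl_left {x z : W} {X Z : Submodule ℝ V} (hX : R.IsNC D x X)
    (hZ : R.IsNC D z Z) (hZX : Z ≤ X) {Y : Submodule ℝ V}
    (hY : ∀ v, v ∈ Y ↔ v ∈ X ∧ ∀ ζ ∈ Z, R.euler D v ζ = 0) : R.IsNC D (x * z⁻¹) Y := by
  intro a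
  obtain ⟨h1, h2⟩ := hX (R.ρ z⁻¹ a)
  obtain ⟨h3, h4⟩ := hZ (R.ρ z⁻¹ a)
  rw [ρ_self_inv] at h3 h4
  have e : a - R.ρ (x * z⁻¹) a =
      (R.ρ z⁻¹ a - R.ρ x (R.ρ z⁻¹ a)) - (R.ρ z⁻¹ a - a) := by rw [ρ_mul]; abel
  rw [e]
  constructor
  · rw [hY]
    refine ⟨sub_mem h1 (hZX h3), fun ζ hζ => ?_⟩
    rw [map_sub, LinearMap.sub_apply, h2 ζ (hZX hζ), h4 ζ hζ, sub_self]
  · intro v hv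
    obtain ⟨hv1, hv2⟩ := (hY v).1 hv
    have h5 := hv2 _ h3
    rw [map_sub, LinearMap.sub_apply, h2 v hv1, R.euler_left hD (_ - a), h5, map_sub,
      LinearMap.sub_apply]
    ring

theorem IsNC.map_coxeter {w : W} {U : Submodule ℝ V} (h : R.IsNC D w U) :
    R.IsNC D (c * w * c⁻¹) (U.map (R.ρ c)) := by
  intro a
  obtain ⟨h1, h2⟩ := h (R.ρ c⁻¹ a)
  have e : a - R.ρ (c * w * c⁻¹) a = R.ρ c (R.ρ c⁻¹ a - R.ρ w (R.ρ c⁻¹ a)) := by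
    rw [map_sub, ρ_self_inv, ρ_mul, ρ_mul]
  rw [e]
  refine ⟨mem_map_of_mem h1, ?_⟩
  rintro - ⟨v, hv, rfl⟩
  rw [R.euler_coxeter_coxeter hD, h2 v hv, ← R.form_inv c, ρ_self_inv]

theorem isNC_coxeter : R.IsNC D c ⊤ := fun a =>
  ⟨trivial, fun v _ => by rw [euler_apply, R.apply_sub_coxeter hD]⟩

omit hD in
theorem isNC_one : R.IsNC D 1 ⊥ := fun a => by
  refine ⟨by simp, fun v hv => ?_⟩
  rw [(mem_bot ℝ).1 hv]; simp

omit hD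

open scoped Classical in
variable (R c) in
/-- The moved spaces of the noncrossing elements. -/
noncomputable def ncLat [Fintype W] : Finset (Submodule ℝ V) :=
  (Finset.univ.filter fun w => absLe S w c).image R.mov

include hD

variable [Fintype W]

theorem mem_ncLat {U : Submodule ℝ V} : U ∈ R.ncLat c ↔ ∃ w, R.IsNC D w U := by
  classical
  simp only [ncLat, Finset.mem_image, Finset.mem_filter, Finset.mem_univ, true_and]
  constructor
  · rintro ⟨w, hw, rfl⟩
    exact ⟨w, isNC_of_absLe hD hw⟩
  · rintro ⟨w, hw⟩
    exact ⟨w, hw.absLe hD, hw.mov_eq hD⟩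

variable (R) in
/-- The Euler system of a Coxeter element. -/
noncomputable def eulerSystem : EulerSystem V where
  E := R.euler D
  Φ := R.Φ
  lat := R.ncLat c
  E_pos := R.euler_pos hD
  E_root := fun _ => R.euler_root hD
  neg_mem := R.neg_mem
  refl_mem := fun β hβ γ hγ => by
    rw [R.euler_add hD, R.form_comm, ← R.refl_apply hβ]
    exact R.mem _ γ hγ
  top_mem := (mem_ncLat hD).2 ⟨c, isNC_coxeter hD⟩
  bot_mem := (mem_ncLat hD).2 ⟨1, isNC_one⟩
  inf_right := fun U hU β hβ hβU => by
    obtain ⟨w, hw⟩ := (mem_ncLat hD).1 hU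
    exact (mem_ncLat hD).2 ⟨_, hw.inf_right hD hβ hβU⟩
  inf_left := fun U hU β hβ hβU => by
    obtain ⟨w, hw⟩ := (mem_ncLat hD).1 hU
    exact (mem_ncLat hD).2 ⟨_, hw.inf_left hD hβ hβU⟩
  sup_right := fun U hU β hβ hβU => by
    obtain ⟨w, hw⟩ := (mem_ncLat hD).1 hU
    exact (mem_ncLat hD).2 ⟨_, hw.sup_right hD hβ hβU⟩
  span_roots := fun U hU => by
    obtain ⟨w, hw⟩ := (mem_ncLat hD).1 hU
    have := R.mov_le_span w
    rwa [hw.mov_eq hD] at this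
  dual := fun U hU P hP hPU => by
    obtain ⟨w, hw⟩ := (mem_ncLat hD).1 hU
    exact ⟨_, R.neg_mem _ (R.mem _ _ hP), hw.dual hD hPU⟩
  compl_right := fun X hX Z hZ hZX => by
    obtain ⟨x, hx⟩ := (mem_ncLat hD).1 hX
    obtain ⟨z, hz⟩ := (mem_ncLat hD).1 hZ
    let Y : Submodule ℝ V :=
      { carrier := {v | v ∈ X ∧ ∀ ζ ∈ Z, R.euler D ζ v = 0}
        add_mem' := fun {a b} ha hb =>
          ⟨add_mem ha.1 hb.1, fun ζ hζ => by rw [map_add, ha.2 ζ hζ, hb.2 ζ hζ, add_zero]⟩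
        zero_mem' := ⟨zero_mem _, fun ζ _ => map_zero _⟩
        smul_mem' := fun r a ha =>
          ⟨X.smul_mem r ha.1, fun ζ hζ => by rw [map_smul, ha.2 ζ hζ, smul_zero]⟩ }
    exact ⟨Y, (mem_ncLat hD).2 ⟨_, hx.compl_right hD hz hZX fun _ => Iff.rfl⟩, fun _ => Iff.rfl⟩
  compl_left := fun X hX Z hZ hZX => by
    obtain ⟨x, hx⟩ := (mem_ncLat hD).1 hX
    obtain ⟨z, hz⟩ := (mem_ncLat hD).1 hZ
    let Y : Submodule ℝ V :=
      { carrier := {v | v ∈ X ∧ ∀ ζ ∈ Z, (R.euler D).flip ζ v = 0}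
        add_mem' := fun {a b} ha hb =>
          ⟨add_mem ha.1 hb.1, fun ζ hζ => by rw [map_add, ha.2 ζ hζ, hb.2 ζ hζ, add_zero]⟩
        zero_mem' := ⟨zero_mem _, fun ζ _ => map_zero _⟩
        smul_mem' := fun r a ha =>
          ⟨X.smul_mem r ha.1, fun ζ hζ => by rw [map_smul, ha.2 ζ hζ, smul_zero]⟩ }
    exact ⟨Y, (mem_ncLat hD).2 ⟨_, hx.compl_left hD hz hZX fun _ => Iff.rfl⟩, fun _ => Iff.rfl⟩

theorem mov_injOn : Set.InjOn R.mov {w | absLe S w c} := fun w hw w' hw' e => by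
  have h := isNC_of_absLe (R := R) hD hw
  rw [e] at h
  exact h.unique hD (isNC_of_absLe hD hw')

theorem ncCount_eq_card_ncLat : ncCount S c = (R.ncLat c).card := by
  classical
  rw [ncLat, Finset.card_image_of_injOn ((mov_injOn hD).mono (by simp)), ncCount,
    Nat.card_eq_fintype_card, Fintype.card_subtype]

open scoped Classical in
theorem card_filter_mem_mov (β : V) :
    (Finset.univ.filter fun w => absLe S w c ∧ β ∈ R.mov w).card =
      ((R.ncLat c).filter fun U => β ∈ U).card := by
  rw [ncLat, Finset.filter_image, Finset.filter_filter,
    Finset.card_image_of_injOn ((mov_injOn hD).mono fun w hw => by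
      simp only [Finset.coe_filter, Finset.mem_univ, true_and] at hw
      exact hw.1)]

theorem absLe_mul_refl {y : W} (hy : absLe S y c) {β : V} (hβ : β ∈ R.Φ) (hm : β ∈ R.mov y) :
    absLe S (y * R.refl β) c ∧ absLe S (y * R.refl β) y ∧
      absLength S y = absLength S (y * R.refl β) + 1 := by
  have h := (isNC_of_absLe hD hy).inf_left hD hβ hm
  have h1 := h.mov_eq hD
  have e : (y * R.refl β)⁻¹ * y = R.refl β := by
    rw [mul_inv_rev, inv_mul_cancel_right]
    exact inv_eq_of_mul_eq_one_left (R.refl_mul_refl hβ)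
  have h2 : absLength S y = absLength S (y * R.refl β) + 1 := by
    rw [R.absLength_eq, R.absLength_eq]
    apply le_antisymm
    · have h3 := R.finrank_mov_mul_le (y * R.refl β) (R.refl β)
      rwa [R.finrank_mov_refl hβ, mul_assoc, R.refl_mul_refl hβ, mul_one] at h3
    · have h4 : R.mov (y * R.refl β) < R.mov y := by
        rw [h1]
        refine inf_lt_left.2 fun hle => ?_
        have h5 := hle hm
        rw [LinearMap.mem_ker, LinearMap.flip_apply, R.euler_root hD hβ] at h5
        exact one_ne_zero h5
      exact Submodule.finrank_lt_finrank_of_lt h4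
  refine ⟨h.absLe hD, ?_, h2⟩
  rw [_root_.absLe, e, (R.absLength_eq_one_iff _).2 ⟨β, hβ, rfl⟩, h2]

omit hD in
theorem exists_root_of_cover {x y : W} (hxy : absLe S x y)
    (hl : absLength S y = absLength S x + 1) :
    ∃ β ∈ R.Φ, β ∈ R.mov y ∧ x = y * R.refl β := by
  have h1 : absLength S (x⁻¹ * y) = 1 := by rw [_root_.absLe] at hxy; omega
  obtain ⟨β, hβ, e⟩ := (R.absLength_eq_one_iff _).1 h1
  have e1 : y = x * R.refl β := by rw [← e, mul_inv_cancel_left]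
  have h2 := R.mov_mul_le x (R.refl β)
  rw [← e1] at h2
  have h3 : R.mov y = R.mov x ⊔ R.mov (R.refl β) := by
    refine Submodule.eq_of_le_of_finrank_le h2 ?_
    have := Submodule.finrank_add_le_finrank_add_finrank (R.mov x) (R.mov (R.refl β))
    rw [R.finrank_mov_refl hβ, ← R.absLength_eq, ← hl, R.absLength_eq] at this
    exact this
  refine ⟨β, hβ, ?_, by rw [e1, mul_assoc, R.refl_mul_refl hβ, mul_one]⟩
  rw [h3, R.mov_refl hβ]
  exact mem_sup_right (mem_span_singleton_self _)

omit hD in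
theorem refl_neg {β : V} (hβ : β ∈ R.Φ) : R.refl (-β) = R.refl β := by
  refine R.injective (LinearMap.ext fun v => ?_)
  rw [R.refl_apply (R.neg_mem β hβ), R.refl_apply hβ, map_neg, LinearMap.neg_apply]
  module

omit hD in
theorem eq_or_eq_neg_of_refl_eq {β γ : V} (hβ : β ∈ R.Φ) (hγ : γ ∈ R.Φ)
    (h : R.refl β = R.refl γ) : β = γ ∨ β = -γ := by
  have h1 := R.refl_apply hβ β
  rw [h, R.refl_apply hγ, R.norm β hβ] at h1
  obtain ⟨r, hr⟩ : ∃ r : ℝ, β = r • γ := by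
    refine ⟨R.form γ β / 2, ?_⟩
    have h2 : R.form γ β • γ = (2 : ℝ) • β := sub_right_injective h1
    rw [div_eq_inv_mul, mul_smul, h2, smul_smul]
    norm_num
  have h3 := R.norm β hβ
  rw [hr, map_smul, map_smul, LinearMap.smul_apply, R.norm γ hγ] at h3
  have h4 : r * r = 1 := by simp only [smul_eq_mul] at h3; linarith
  rcases mul_self_eq_one_iff.1 h4 with rfl | rfl
  · left; simpa using hr
  · right; simpa using hr

open scoped Classical in
theorem edgeCount_eq_sum {L : List V} (hL : (R.eulerSystem hD).IsPosList L) :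
    edgeCount S c = (L.map fun β => ((R.ncLat c).filter fun U => β ∈ U).card).sum := by
  have hΦ : ∀ β ∈ L, β ∈ R.Φ := fun β hβ => (hL.mem β).2 (Or.inl hβ)
  rw [← List.sum_toFinset _ hL.nodup, edgeCount, Nat.card_eq_fintype_card, Fintype.card_subtype]
  simp only [← card_filter_mem_mov hD]
  rw [← Finset.card_sigma]
  symm
  refine Finset.card_bij (fun p _ => (p.2 * R.refl p.1, p.2)) ?_ ?_ ?_
  · rintro ⟨β, y⟩ h
    simp only [Finset.mem_sigma, List.mem_toFinset, Finset.mem_filter, Finset.mem_univ,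
      true_and] at h ⊢
    obtain ⟨h1, h2, h3⟩ := absLe_mul_refl hD h.2.1 (hΦ β h.1) h.2.2
    exact ⟨h1, h.2.1, h2, h3⟩
  · rintro ⟨β, y⟩ h ⟨β', y'⟩ h' e
    simp only [Finset.mem_sigma, List.mem_toFinset, Prod.mk.injEq] at h h' e
    obtain ⟨e1, rfl⟩ := e
    rcases eq_or_eq_neg_of_refl_eq (hΦ β h.1) (hΦ β' h'.1) (mul_left_cancel e1) with rfl | rfl
    · rfl
    · exact absurd h.1 (hL.disj _ h'.1)
  · rintro ⟨x, y⟩ h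
    simp only [Finset.mem_filter, Finset.mem_univ, true_and] at h
    obtain ⟨hx, hy, hxy, hl⟩ := h
    obtain ⟨β, hβ, hm, rfl⟩ := exists_root_of_cover (R := R) hxy hl
    rcases (hL.mem β).1 hβ with h | h
    · exact ⟨⟨β, y⟩, by simp [h, hy, hm], rfl⟩
    · exact ⟨⟨-β, y⟩, by simp [h, hy, hm], by simp [refl_neg hβ]⟩

end ReflectionRep

end NoncrossingEuler

section CoxeterRep

open Real

variable {B : Type*} [Fintype B] [DecidableEq B] {M : CoxeterMatrix B} {W : Type*} [Group W]
  (cs : CoxeterSystem M W)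

open scoped Classical in
/-- The reflection of a Coxeter group attached to a root. -/
noncomputable def rootReflection (β : B → ℝ) : W :=
  if h : β ∈ coxeterRoots cs then h.choose * cs.simple h.choose_spec.choose * h.choose⁻¹ else 1

theorem geomRep_rootReflection {β : B → ℝ} (hβ : β ∈ coxeterRoots cs) :
    geomRep cs (rootReflection cs β) = formReflection (coxeterForm M) β := by
  rw [rootReflection, dif_pos hβ, geomRep_conj_simple, ← hβ.choose_spec.choose_spec]

variable [Finite W]

/-- The geometric representation of a finite Coxeter group as a reflection representation. -/
noncomputable def coxeterRep (hpos : ∀ v ≠ 0, 0 < coxeterForm M v v) :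
    ReflectionRep (simpleSet cs) (B → ℝ) where
  ρ := geomRep cs
  form := coxeterForm M
  Φ := coxeterRoots cs
  refl := rootReflection cs
  form_comm := coxeterForm_comm M
  form_pos := hpos
  form_inv := coxeterForm_geomRep cs
  norm := fun _ => coxeterForm_root_self cs
  mem := fun w _ => geomRep_mem_coxeterRoots cs w
  neg_mem := fun _ => neg_mem_coxeterRoots cs
  finite := coxeterRoots_finite cs
  injective := geomRep_injective cs hpos
  isReflection := fun β hβ => by
    rw [rootReflection, dif_pos hβ]
    exact ⟨_, _, ⟨_, rfl⟩, rfl⟩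
  ρ_refl := fun _ => geomRep_rootReflection cs
  exists_root := by
    rintro t ⟨g, s, ⟨i, rfl⟩, rfl⟩
    refine ⟨_, ⟨g, i, rfl⟩, geomRep_injective cs hpos ?_⟩
    rw [geomRep_rootReflection cs ⟨g, i, rfl⟩, geomRep_conj_simple]
  stab := fun x a hx => by
    refine Subgroup.closure_mono ?_ (mem_closure_reflections_of_fixed cs hpos hx)
    rintro t ⟨β, hβ, h0, ht⟩
    refine ⟨β, hβ, h0, geomRep_injective cs hpos ?_⟩
    rw [geomRep_rootReflection cs hβ, ht]

omit [Finite W] in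
theorem geomRep_wordProd_apply_of_notMem {l : List B} {i : B} (hi : i ∉ l) (v : B → ℝ) :
    geomRep cs (cs.wordProd l) v i = v i := by
  induction l with
  | nil => simp
  | cons j l ih =>
    simp only [List.mem_cons, not_or] at hi
    rw [cs.wordProd_cons, geomRep_mul_apply, geomRep_simple, formReflection_apply, Pi.sub_apply,
      ih hi.2, Pi.smul_apply]
    simp [simpleRoot, hi.1]

omit [Finite W] in
theorem coxeterForm_eq_zero_of_geomRep_wordProd {l : List B} (hl : l.Nodup) {v : B → ℝ}
    (h : geomRep cs (cs.wordProd l) v = v) : ∀ i ∈ l, coxeterForm M (simpleRoot i) v = 0 := by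
  induction l with
  | nil => simp
  | cons j l ih =>
    rw [List.nodup_cons] at hl
    rw [cs.wordProd_cons, geomRep_mul_apply, geomRep_simple, formReflection_apply] at h
    have h1 := congrFun h j
    rw [Pi.sub_apply, geomRep_wordProd_apply_of_notMem cs hl.1, Pi.smul_apply] at h1
    have h2 : coxeterForm M (simpleRoot j) (geomRep cs (cs.wordProd l) v) = 0 := by
      simpa [simpleRoot] using h1
    rw [h2, zero_smul, sub_zero] at h
    rw [h] at h2
    intro i hi
    rcases List.mem_cons.1 hi with rfl | hi
    · exact h2
    · exact ih hl.2 h i hi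

omit [Finite W] in
/-- A Coxeter element has no nonzero fixed vector. -/
theorem eq_zero_of_geomRep_wordProd (hpos : ∀ v ≠ 0, 0 < coxeterForm M v v) {l : List B}
    (hl : l.Nodup) (hB : ∀ i, i ∈ l) {v : B → ℝ}
    (h : geomRep cs (cs.wordProd l) v = v) : v = 0 := by
  by_contra hv
  have h1 := hpos v hv
  rw [coxeterForm_eq_sum, Finset.sum_eq_zero fun i _ => by
    rw [coxeterForm_eq_zero_of_geomRep_wordProd cs hl h i (hB i), mul_zero]] at h1
  exact h1.false

omit [Finite W] in
theorem exists_euler_inverse (hpos : ∀ v ≠ 0, 0 < coxeterForm M v v) {l : List B}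
    (hl : l.Nodup) (hB : ∀ i, i ∈ l) : ∃ D : Module.End ℝ (B → ℝ), ∀ v,
      D v - geomRep cs (cs.wordProd l) (D v) = v := by
  let f : (B → ℝ) →ₗ[ℝ] (B → ℝ) := LinearMap.id - geomRep cs (cs.wordProd l)
  have hf : Function.Injective f := by
    rw [← LinearMap.ker_eq_bot, LinearMap.ker_eq_bot']
    intro v hv
    exact eq_zero_of_geomRep_wordProd cs hpos hl hB (sub_eq_zero.1 hv).symm
  exact ⟨(LinearEquiv.ofInjectiveEndo f hf).symm.toLinearMap, fun v =>
    (LinearEquiv.ofInjectiveEndo f hf).apply_symm_apply v⟩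

omit [Finite W] in
theorem coxeterSystem_simple_injective :
    Function.Injective cs.simple := by
  intro i j h
  by_contra hij
  have hi := geomRep_simple_simpleRoot_self cs i
  have hj := geomRep_wordProd_apply_of_notMem cs (l := [j]) (by simpa using hij) (simpleRoot i)
  rw [cs.wordProd_singleton, ← h, hi] at hj
  simp [simpleRoot] at hj
  linarith

omit [Finite W] in
theorem exists_word_of_isCoxeterElementOf {c : W}
    (hc : IsCoxeterElementOf (simpleSet cs) c) :
    ∃ l : List B, l.Nodup ∧ (∀ i, i ∈ l) ∧ c = cs.wordProd l := by
  obtain ⟨l, hl, hm, rfl⟩ := hc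
  have h1 : ∃ l' : List B, l'.map cs.simple = l :=
    (Set.ext_iff.1 (Set.range_list_map cs.simple) l).2 fun x hx => (hm x).1 hx
  obtain ⟨l', rfl⟩ := h1
  refine ⟨l', hl.of_map _, fun i => ?_, rfl⟩
  have h2 := (hm (cs.simple i)).2 ⟨i, rfl⟩
  rwa [List.mem_map_of_injective (coxeterSystem_simple_injective cs)] at h2

end CoxeterRep

section Conjugacy

open Real

variable {B : Type*} [Fintype B] [DecidableEq B] {M : CoxeterMatrix B}

theorem coxeterForm_le_neg_one (hpos : ∀ v ≠ 0, 0 < coxeterForm M v v) {i j : B} (hij : i ≠ j)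
    (h : M i j ≠ 2) : coxeterForm M (simpleRoot i) (simpleRoot j) ≤ -1 := by
  rw [coxeterForm_simpleRoot]
  have h0 := coxeterMatrix_ne_zero hpos i j
  have h1 := M.off_diagonal i j hij
  have h3 : (3 : ℝ) ≤ M i j := by
    have : 3 ≤ M i j := by omega
    exact_mod_cast this
  have h4 : cos (π / 3) ≤ cos (π / M i j) := by
    apply cos_le_cos_of_nonneg_of_le_pi
    · positivity
    · linarith [pi_pos]
    · gcongr
  rw [cos_pi_div_three] at h4
  linarith

theorem coxeterForm_nonpos {i j : B} (hij : i ≠ j) :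
    coxeterForm M (simpleRoot i) (simpleRoot j) ≤ 0 := by
  rw [coxeterForm_simpleRoot]
  linarith [cos_pi_div_nonneg (M.off_diagonal i j hij)]

/-- Every nonempty subgraph of the Coxeter graph of a positive definite form has a vertex with at
most one neighbour. -/
theorem exists_leaf (hpos : ∀ v ≠ 0, 0 < coxeterForm M v v) {A : Finset B} (hA : A.Nonempty) :
    ∃ i ∈ A, (A.filter fun j => j ≠ i ∧ M i j ≠ 2).card ≤ 1 := by
  by_contra! h
  have hv : (∑ i ∈ A, simpleRoot i : B → ℝ) ≠ 0 := by
    obtain ⟨i, hi⟩ := hA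
    intro h0
    have := congrFun h0 i
    simp [simpleRoot, Finset.sum_apply, Pi.single_apply, hi] at this
  refine (hpos _ hv).not_ge ?_
  rw [map_sum (coxeterForm M), LinearMap.sum_apply]
  refine Finset.sum_nonpos fun i hi => ?_
  rw [map_sum, ← Finset.add_sum_erase _ _ hi, coxeterForm_simpleRoot_self]
  have h1 : ∑ j ∈ A.erase i, coxeterForm M (simpleRoot i) (simpleRoot j) ≤
      ∑ j ∈ A.filter (fun j => j ≠ i ∧ M i j ≠ 2), (-1 : ℝ) := by
    have hs : A.filter (fun j => j ≠ i ∧ M i j ≠ 2) ⊆ A.erase i := fun j hj => by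
      simp only [Finset.mem_filter] at hj
      exact Finset.mem_erase.2 ⟨hj.2.1, hj.1⟩
    rw [← Finset.sum_sdiff hs]
    have h2 : ∑ j ∈ A.erase i \ A.filter (fun j => j ≠ i ∧ M i j ≠ 2),
        coxeterForm M (simpleRoot i) (simpleRoot j) ≤ 0 := Finset.sum_nonpos fun j hj => by
      simp only [Finset.mem_sdiff, Finset.mem_erase] at hj
      exact coxeterForm_nonpos (Ne.symm hj.1.1)
    have h3 : ∑ j ∈ A.filter (fun j => j ≠ i ∧ M i j ≠ 2),
        coxeterForm M (simpleRoot i) (simpleRoot j) ≤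
        ∑ j ∈ A.filter (fun j => j ≠ i ∧ M i j ≠ 2), (-1 : ℝ) := Finset.sum_le_sum fun j hj => by
      simp only [Finset.mem_filter] at hj
      exact coxeterForm_le_neg_one hpos (Ne.symm hj.2.1) hj.2.2
    linarith
  rw [Finset.sum_const, nsmul_eq_mul] at h1
  have h4 : (2 : ℝ) ≤ (A.filter fun j => j ≠ i ∧ M i j ≠ 2).card := by exact_mod_cast h i hi
  linarith

theorem exists_leaf_of_card (hpos : ∀ v ≠ 0, 0 < coxeterForm M v v) {A : Finset B}
    (hA : 2 ≤ A.card) :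
    ∃ i ∈ A, ∃ j ∈ A, j ≠ i ∧ ∀ k ∈ A, k ≠ i → k ≠ j → M i k = 2 := by
  obtain ⟨i, hi, h⟩ := exists_leaf hpos (Finset.card_pos.1 (by omega : 0 < A.card))
  refine ⟨i, hi, ?_⟩
  rcases (A.filter fun j => j ≠ i ∧ M i j ≠ 2).eq_empty_or_nonempty with h0 | ⟨j, hj⟩
  · obtain ⟨j, hj, hne⟩ := Finset.exists_mem_ne (by omega : 1 < A.card) i
    refine ⟨j, hj, hne, fun k hk hki _ => ?_⟩
    by_contra h2
    have : k ∈ A.filter fun j => j ≠ i ∧ M i j ≠ 2 := Finset.mem_filter.2 ⟨hk, hki, h2⟩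
    rw [h0] at this
    simp at this
  · have hj' := Finset.mem_filter.1 hj
    refine ⟨j, hj'.1, hj'.2.1, fun k hk hki hkj => ?_⟩
    by_contra h2
    exact hkj (Finset.card_le_one.1 h k (Finset.mem_filter.2 ⟨hk, hki, h2⟩) j hj)

theorem exists_coloring_on (hpos : ∀ v ≠ 0, 0 < coxeterForm M v v) (A : Finset B) :
    ∃ col : B → Bool, ∀ i ∈ A, ∀ j ∈ A, i ≠ j → M i j ≠ 2 → col i ≠ col j := by
  induction hn : A.card generalizing A with
  | zero => exact ⟨fun _ => true, by simp [Finset.card_eq_zero.1 hn]⟩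
  | succ n ih =>
    by_cases h2 : 2 ≤ A.card
    · obtain ⟨i, hi, j, hj, hji, hk⟩ := exists_leaf_of_card hpos h2
      obtain ⟨col, hcol⟩ := ih (A.erase i) (by rw [Finset.card_erase_of_mem hi]; omega)
      refine ⟨Function.update col i (!col j), fun k hkA l hlA hkl hM => ?_⟩
      by_cases hki : k = i
      · subst hki
        have hlj : l = j := by
          by_contra hlj
          exact hM (hk l hlA (Ne.symm hkl) hlj)
        subst hlj
        simp [Function.update_of_ne hji]
      · by_cases hli : l = i
        · subst hli
          have hkj : k = j := by
            by_contra hkj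
            exact hM ((M.symmetric k l).trans (hk k hkA hki hkj))
          subst hkj
          simp [Function.update_of_ne hji]
        · rw [Function.update_of_ne hki, Function.update_of_ne hli]
          exact hcol k (Finset.mem_erase.2 ⟨hki, hkA⟩) l (Finset.mem_erase.2 ⟨hli, hlA⟩) hkl hM
    · refine ⟨fun _ => true, fun i hi j hj hij => ?_⟩
      exact absurd (Finset.card_le_one.1 (by omega : A.card ≤ 1) i hi j hj) hij

/-- The Coxeter graph of a positive definite form is bipartite. -/
theorem exists_coloring (hpos : ∀ v ≠ 0, 0 < coxeterForm M v v) :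
    ∃ col : B → Bool, ∀ i j, i ≠ j → col i = col j → M i j = 2 := by
  obtain ⟨col, h⟩ := exists_coloring_on hpos (Finset.univ : Finset B)
  refine ⟨col, fun i j hij hc => ?_⟩
  by_contra hM
  exact h i (Finset.mem_univ i) j (Finset.mem_univ j) hij hM hc

variable {G : Type*} [Group G]

omit [Fintype B] in
theorem mul_prod_map_update (f : B → G) {i j : B} {m : List B} (hm : m.Nodup) (hj : j ∈ m)
    (hc : ∀ k ∈ m, k ≠ j → Commute (f i) (f k)) :
    f i * (m.map f).prod = (m.map (Function.update f j (f i * f j))).prod := by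
  induction m with
  | nil => simp at hj
  | cons k m ih =>
    rw [List.nodup_cons] at hm
    rw [List.map_cons, List.map_cons, List.prod_cons, List.prod_cons]
    by_cases hkj : k = j
    · subst hkj
      rw [Function.update_self, mul_assoc]
      congr 3
      refine List.map_congr_left fun l hl => ?_
      rw [Function.update_of_ne]
      rintro rfl
      exact hm.1 hl
    · have hj' : j ∈ m := by
        rcases List.mem_cons.1 hj with h | h
        · exact absurd h.symm hkj
        · exact h
      rw [Function.update_of_ne hkj, ← ih hm.2 hj' fun l hl => hc l (List.mem_cons_of_mem _ hl),
        ← mul_assoc, (hc k List.mem_cons_self hkj).eq, mul_assoc]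

omit [Fintype B] [DecidableEq B] in
theorem isConj_prod_rotate (f : B → G) {l : List B} {i : B} (hi : i ∈ l) :
    ∃ m : List B, l.Perm (i :: m) ∧ IsConj (l.map f).prod (f i * (m.map f).prod) := by
  obtain ⟨a, b, rfl⟩ := List.append_of_mem hi
  refine ⟨b ++ a, ?_, ?_⟩
  · exact List.perm_middle.trans (List.Perm.cons _ List.perm_append_comm)
  · rw [isConj_iff]
    refine ⟨(a.map f).prod⁻¹, ?_⟩
    simp [mul_assoc]

/-- Products of the same commuting-when-nonadjacent elements along a forest, taken in any two
orders, are conjugate. -/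
theorem isConj_prod_of_perm (hpos : ∀ v ≠ 0, 0 < coxeterForm M v v) (f : B → G) {l l' : List B}
    (hl : l.Nodup) (hp : l.Perm l')
    (hf : ∀ i ∈ l, ∀ j ∈ l, i ≠ j → M i j = 2 → Commute (f i) (f j)) :
    IsConj (l.map f).prod (l'.map f).prod := by
  induction hn : l.length generalizing l l' f with
  | zero =>
    rw [List.length_eq_zero_iff] at hn
    subst hn
    rw [List.nil_perm] at hp
    subst hp
    exact IsConj.refl _
  | succ n ih =>
    by_cases h2 : 2 ≤ l.toFinset.card
    · obtain ⟨i, hi, j, hj, hji, hk⟩ := exists_leaf_of_card hpos h2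
      simp only [List.mem_toFinset] at hi hj hk
      obtain ⟨m, hm, hc⟩ := isConj_prod_rotate f hi
      obtain ⟨m', hm', hc'⟩ := isConj_prod_rotate f (hp.mem_iff.1 hi)
      have hmm : m.Perm m' := ((hm.symm.trans hp).trans hm').cons_inv
      have hnd := hm.nodup_iff.1 hl
      rw [List.nodup_cons] at hnd
      have hjm : j ∈ m := by
        rcases List.mem_cons.1 (hm.mem_iff.1 hj) with h | h
        · exact absurd h hji
        · exact h
      have hml : ∀ k ∈ m, k ∈ l := fun k hk => hm.mem_iff.2 (List.mem_cons_of_mem _ hk)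
      have hne : ∀ k ∈ m, k ≠ i := by rintro k hkm rfl; exact hnd.1 hkm
      have hcomm : ∀ k ∈ m, k ≠ j → Commute (f i) (f k) := fun k hkm hkj =>
        hf i hi k (hml k hkm) (hne k hkm).symm (hk k (hml k hkm) (hne k hkm) hkj)
      refine hc.trans (IsConj.trans ?_ hc'.symm)
      rw [mul_prod_map_update f hnd.2 hjm hcomm, mul_prod_map_update f (hmm.nodup_iff.1 hnd.2)
        (hmm.mem_iff.1 hjm) fun k hk => hcomm k (hmm.mem_iff.2 hk)]
      refine ih _ hnd.2 hmm (fun k hkm q hqm hkq hM => ?_) ?_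
      · have hfkq := hf k (hml k hkm) q (hml q hqm) hkq hM
        by_cases hkj : k = j
        · subst hkj
          rw [Function.update_self, Function.update_of_ne hkq.symm]
          exact (hcomm q hqm hkq.symm).mul_left hfkq
        · rw [Function.update_of_ne hkj]
          by_cases hqj : q = j
          · subst hqj
            rw [Function.update_self]
            exact (hcomm k hkm hkj).symm.mul_right hfkq
          · rw [Function.update_of_ne hqj]
            exact hfkq
      · have := hm.length_eq
        rw [List.length_cons] at this
        omega
    · rw [List.toFinset_card_of_nodup hl] at h2
      have h1 : l.length = 1 := by omega
      obtain ⟨a, rfl⟩ := List.length_eq_one_iff.1 h1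
      rw [List.singleton_perm] at hp
      subst hp
      exact IsConj.refl _

end Conjugacy

section ConjInvariance

variable {G : Type*} [Group G] {S : Set G}

theorem isReflectionOf_conj {t : G} (g : G) (h : IsReflectionOf S t) :
    IsReflectionOf S (g * t * g⁻¹) := by
  obtain ⟨x, s, hs, rfl⟩ := h
  exact ⟨g * x, s, hs, by group⟩

theorem absLength_conj (g w : G) : absLength S (g * w * g⁻¹) = absLength S w := by
  have key : ∀ g w k, (∃ l : List G, (∀ t ∈ l, IsReflectionOf S t) ∧ l.length = k ∧ l.prod = w) →
      ∃ l : List G, (∀ t ∈ l, IsReflectionOf S t) ∧ l.length = k ∧ l.prod = g * w * g⁻¹ := by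
    rintro g w k ⟨l, hl, rfl, rfl⟩
    refine ⟨l.map (MulAut.conj g), ?_, by simp, ?_⟩
    · intro t ht
      obtain ⟨s, hs, rfl⟩ := List.mem_map.1 ht
      exact isReflectionOf_conj g (hl s hs)
    · rw [← map_list_prod, MulAut.conj_apply]
  unfold absLength
  congr 1
  ext k
  refine ⟨fun h => ?_, key g w k⟩
  have := key g⁻¹ _ k h
  rwa [show g⁻¹ * (g * w * g⁻¹) * g⁻¹⁻¹ = w by group] at this

theorem absLe_conj (g u v : G) : absLe S (g * u * g⁻¹) (g * v * g⁻¹) ↔ absLe S u v := by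
  unfold absLe
  rw [show (g * u * g⁻¹)⁻¹ * (g * v * g⁻¹) = g * (u⁻¹ * v) * g⁻¹ by group]
  simp only [absLength_conj]

theorem ncCount_eq_of_isConj {c d : G} (h : IsConj c d) : ncCount S c = ncCount S d := by
  obtain ⟨g, rfl⟩ := isConj_iff.1 h
  refine Nat.card_congr ((MulAut.conj g).toEquiv.subtypeEquiv fun w => ?_)
  exact (absLe_conj g w c).symm

theorem edgeCount_eq_of_isConj {c d : G} (h : IsConj c d) : edgeCount S c = edgeCount S d := by
  obtain ⟨g, rfl⟩ := isConj_iff.1 h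
  refine Nat.card_congr (((MulAut.conj g).toEquiv.prodCongr
    (MulAut.conj g).toEquiv).subtypeEquiv fun w => ?_)
  simp only [Equiv.prodCongr_apply, Prod.map, MulEquiv.toEquiv_eq_coe, EquivLike.coe_coe,
    MulAut.conj_apply, absLe_conj, absLength_conj]

theorem orderOf_eq_of_isConj {c d : G} (h : IsConj c d) : orderOf c = orderOf d := by
  obtain ⟨g, rfl⟩ := isConj_iff.1 h
  exact ((MulAut.conj g).orderOf_eq c).symm

end ConjInvariance

section Perron

open Real

variable {B : Type*} [Fintype B] [DecidableEq B] {M : CoxeterMatrix B}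

theorem coxeterForm_abs_le (v : B → ℝ) : coxeterForm M |v| |v| ≤ coxeterForm M v v := by
  rw [coxeterForm_eq_sum, coxeterForm_eq_sum]
  refine Finset.sum_le_sum fun i _ => ?_
  rw [coxeterForm_comm, coxeterForm_comm M _ v, coxeterForm_eq_sum, coxeterForm_eq_sum,
    Finset.mul_sum, Finset.mul_sum]
  refine Finset.sum_le_sum fun j _ => ?_
  rcases eq_or_ne j i with rfl | hij
  · rw [coxeterForm_simpleRoot_self, Pi.abs_apply, ← mul_assoc, ← mul_assoc, abs_mul_abs_self]
  · have h := coxeterForm_nonpos (M := M) hij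
    rw [Pi.abs_apply, Pi.abs_apply, ← mul_assoc, ← mul_assoc, ← abs_mul]
    exact mul_le_mul_of_nonpos_right (le_abs_self _) h

theorem exists_min_ratio [Nonempty B] :
    ∃ p : B → ℝ, p ⬝ᵥ p = 1 ∧
      ∀ v, coxeterForm M p p * (v ⬝ᵥ v) ≤ coxeterForm M v v := by
  have hdot : Continuous fun v : B → ℝ => v ⬝ᵥ v := by
    unfold dotProduct; fun_prop
  have hform : Continuous fun v : B → ℝ => coxeterForm M v v := by
    have e : (fun v : B → ℝ => coxeterForm M v v) =
        fun v => ∑ i, v i * ∑ j, v j * coxeterForm M (simpleRoot j) (simpleRoot i) := by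
      funext v
      rw [coxeterForm_eq_sum]
      refine Finset.sum_congr rfl fun i _ => ?_
      rw [coxeterForm_comm, coxeterForm_eq_sum]
    rw [e]
    fun_prop
  have hK : IsCompact {v : B → ℝ | v ⬝ᵥ v = 1} := by
    refine Metric.isCompact_of_isClosed_isBounded (isClosed_eq hdot continuous_const) ?_
    refine (Metric.isBounded_closedBall (x := (0 : B → ℝ)) (r := 1)).subset fun v hv => ?_
    rw [mem_closedBall_zero_iff, pi_norm_le_iff_of_nonneg zero_le_one]
    intro i
    have h1 : v i * v i ≤ v ⬝ᵥ v :=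
      Finset.single_le_sum (f := fun i => v i * v i) (fun j _ => mul_self_nonneg _)
        (Finset.mem_univ i)
    rw [show v ⬝ᵥ v = 1 from hv] at h1
    rw [Real.norm_eq_abs]
    exact abs_le_one_iff_mul_self_le_one.2 h1
  obtain ⟨p, hp, hmin⟩ := hK.exists_isMinOn
    ⟨simpleRoot (Classical.arbitrary B), by simp [simpleRoot]⟩ hform.continuousOn
  refine ⟨p, hp, fun v => ?_⟩
  rcases eq_or_ne v 0 with rfl | hv
  · simp
  have h0 : 0 < v ⬝ᵥ v := by
    refine lt_of_le_of_ne (Finset.sum_nonneg fun i _ => mul_self_nonneg (v i)) fun h => hv ?_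
    exact dotProduct_self_eq_zero.1 h.symm
  have hr : 0 < √(v ⬝ᵥ v) := sqrt_pos.2 h0
  have h1 : (√(v ⬝ᵥ v))⁻¹ * (√(v ⬝ᵥ v))⁻¹ * (v ⬝ᵥ v) = 1 := by
    rw [← mul_inv, mul_self_sqrt h0.le, inv_mul_cancel₀ h0.ne']
  have h2 : coxeterForm M p p ≤
      coxeterForm M ((√(v ⬝ᵥ v))⁻¹ • v) ((√(v ⬝ᵥ v))⁻¹ • v) := by
    refine hmin ?_
    rw [Set.mem_ofPred_eq, smul_dotProduct, dotProduct_smul, smul_eq_mul, smul_eq_mul, ← mul_assoc,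
      h1]
  rw [map_smul, map_smul, LinearMap.smul_apply, smul_eq_mul, smul_eq_mul, ← mul_assoc, ← mul_inv,
    mul_self_sqrt h0.le] at h2
  rw [mul_comm]
  calc v ⬝ᵥ v * coxeterForm M p p ≤ v ⬝ᵥ v * ((v ⬝ᵥ v)⁻¹ * coxeterForm M v v) :=
        mul_le_mul_of_nonneg_left h2 h0.le
    _ = coxeterForm M v v := by rw [mul_inv_cancel_left₀ h0.ne']

/-- The Coxeter matrix of an irreducible system has a positive eigenvector. -/
theorem exists_perron [Nonempty B] (hpos : ∀ v ≠ 0, 0 < coxeterForm M v v)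
    (hirr : ∀ A : Set B, (∀ a ∈ A, ∀ b ∈ Aᶜ, M a b = 2) → A = ∅ ∨ A = Set.univ) :
    ∃ (p : B → ℝ) (μ : ℝ), (∀ i, 0 < p i) ∧ 0 < μ ∧
      ∀ i, coxeterForm M (simpleRoot i) p = μ * p i := by
  obtain ⟨q, hq, hmin⟩ := exists_min_ratio (M := M)
  set μ := coxeterForm M q q with hμ
  have hq0 : q ≠ 0 := by rintro rfl; simp at hq
  have hpdot : |q| ⬝ᵥ |q| = 1 := by
    rw [← hq]
    exact Finset.sum_congr rfl fun i _ => abs_mul_abs_self (q i)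
  have hp : coxeterForm M |q| |q| = μ := by
    refine le_antisymm (coxeterForm_abs_le q) ?_
    have := hmin |q|
    rwa [hpdot, mul_one] at this
  have heig : ∀ i, coxeterForm M (simpleRoot i) |q| = μ * |q| i := by
    intro i
    have key : ∀ t : ℝ, 0 ≤ (2 - μ) * (t * t) +
        2 * (coxeterForm M (simpleRoot i) |q| - μ * |q| i) * t + 0 := by
      intro t
      have h1 := hmin (|q| + t • simpleRoot i)
      have h2 : (|q| + t • simpleRoot i) ⬝ᵥ (|q| + t • simpleRoot i) =
          1 + 2 * t * |q| i + t * t := by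
        rw [add_dotProduct, dotProduct_add, dotProduct_add, hpdot, smul_dotProduct, dotProduct_smul,
          smul_dotProduct, dotProduct_smul]
        simp only [simpleRoot, dotProduct_single, single_dotProduct, Pi.single_eq_same, smul_eq_mul]
        ring
      rw [h2] at h1
      simp only [map_add, map_smul, LinearMap.add_apply, LinearMap.smul_apply, hp,
        coxeterForm_simpleRoot_self, smul_eq_mul, coxeterForm_comm M |q|] at h1
      nlinarith [h1]
    have h3 := discrim_le_zero key
    rw [discrim] at h3
    have h4 : (2 * (coxeterForm M (simpleRoot i) |q| - μ * |q| i)) ^ 2 = 0 :=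
      le_antisymm (by linarith) (sq_nonneg _)
    have h5 := pow_eq_zero_iff (two_ne_zero) |>.1 h4
    linarith
  refine ⟨|q|, μ, ?_, hpos q hq0, heig⟩
  have hZ := hirr {i | |q| i = 0} ?_
  · rcases hZ with h | h
    · intro i
      refine lt_of_le_of_ne (abs_nonneg _) fun h0 => ?_
      have : i ∈ {i | |q| i = 0} := h0.symm
      rw [h] at this
      exact this
    · refine absurd (funext fun i => ?_) hq0
      have : i ∈ {i | |q| i = 0} := by rw [h]; trivial
      simpa using this
  · intro i hi j hj
    have hi0 : |q| i = 0 := hi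
    have hj0 : |q| j ≠ 0 := hj
    by_contra hM
    have hij : j ≠ i := by rintro rfl; exact hj0 hi0
    have h1 := heig i
    rw [hi0, mul_zero, coxeterForm_comm, coxeterForm_eq_sum] at h1
    have h2 : ∀ k ∈ Finset.univ, |q| k * coxeterForm M (simpleRoot k) (simpleRoot i) ≤ 0 := by
      intro k _
      rcases eq_or_ne k i with rfl | hk
      · rw [hi0, zero_mul]
      · exact mul_nonpos_of_nonneg_of_nonpos (abs_nonneg _) (coxeterForm_nonpos hk)
    have h3 := (Finset.sum_eq_zero_iff_of_nonpos h2).1 h1 j (Finset.mem_univ j)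
    have h4 := coxeterForm_le_neg_one hpos hij (by rwa [M.symmetric j i])
    rcases mul_eq_zero.1 h3 with h | h
    · exact hj0 h
    · linarith

end Perron

section Bipartite

open Real

variable {B : Type*} [Fintype B] [DecidableEq B] {M : CoxeterMatrix B} {W : Type*} [Group W]
  (cs : CoxeterSystem M W) (col : B → Bool)

/-- The colour in position `k` of the alternating sequence of colours starting with `s`. -/
def alt (s : Bool) : ℕ → Bool
  | 0 => s
  | k + 1 => !alt s k

theorem alt_zero (s : Bool) : alt s 0 = s := rfl

theorem alt_succ (s : Bool) (k : ℕ) : alt s (k + 1) = !alt s k := rfl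

theorem alt_add (s : Bool) (k m : ℕ) : alt s (k + m) = alt (alt s k) m := by
  induction m with
  | zero => rfl
  | succ m ih => rw [← add_assoc, alt_succ, alt_succ, ih]

theorem alt_not (s : Bool) (k : ℕ) : alt (!s) k = !alt s k := by
  induction k with
  | zero => rfl
  | succ m ih => rw [alt_succ, alt_succ, ih]

theorem alt_two (s : Bool) : alt s 2 = s := by simp [alt]

theorem alt_add_two (s : Bool) (k : ℕ) : alt s (k + 2) = alt s k := by simp [alt]

theorem exists_alt_eq (k : ℕ) (t : Bool) : ∃ s, alt s k = t := by
  by_cases h : alt true k = t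
  · exact ⟨true, h⟩
  · exact ⟨!true, by rw [alt_not]; exact (Bool.eq_not.2 (Ne.symm h)).symm⟩

/-- The list of all vertices of a given colour. -/
noncomputable def colorList (s : Bool) : List B := (Finset.univ.filter fun i => col i = s).toList

theorem mem_colorList {s : Bool} {i : B} : i ∈ colorList col s ↔ col i = s := by
  simp [colorList]

theorem nodup_colorList (s : Bool) : (colorList col s).Nodup := Finset.nodup_toList _

/-- The product of the simple reflections of a given colour. -/
noncomputable def colorProd (s : Bool) : W := cs.wordProd (colorList col s)

/-- The alternating product of the two colour products with `k` factors. -/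
noncomputable def altProd (s : Bool) : ℕ → W
  | 0 => 1
  | k + 1 => altProd s k * colorProd cs col (alt s k)

theorem altProd_zero (s : Bool) : altProd cs col s 0 = 1 := rfl

theorem altProd_succ (s : Bool) (k : ℕ) :
    altProd cs col s (k + 1) = altProd cs col s k * colorProd cs col (alt s k) := rfl

theorem altProd_add (s : Bool) (k m : ℕ) :
    altProd cs col s (k + m) = altProd cs col s k * altProd cs col (alt s k) m := by
  induction m with
  | zero => simp [altProd_zero]
  | succ m ih => rw [← add_assoc, altProd_succ, altProd_succ, ih, alt_add, mul_assoc]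

theorem altProd_one (s : Bool) : altProd cs col s 1 = colorProd cs col s := by
  rw [altProd_succ, altProd_zero, one_mul, alt_zero]

theorem altProd_two (s : Bool) :
    altProd cs col s 2 = colorProd cs col s * colorProd cs col (!s) := by
  rw [altProd_succ, altProd_one]; rfl

theorem altProd_add_two (s : Bool) (k : ℕ) :
    altProd cs col s (k + 2) = altProd cs col s 2 * altProd cs col s k := by
  rw [add_comm, altProd_add, alt_two]

theorem altProd_two_mul (s : Bool) (m : ℕ) :
    altProd cs col s (2 * m) = altProd cs col s 2 ^ m := by
  induction m with
  | zero => simp [altProd_zero]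
  | succ m ih => rw [Nat.mul_succ, altProd_add_two, ih, pow_succ']

/-- The root attached to position `k` and the vertex `j`. -/
noncomputable def altRoot (s : Bool) (k : ℕ) (j : B) : B → ℝ :=
  geomRep cs (altProd cs col s k) (simpleRoot j)

theorem altRoot_zero (s : Bool) (j : B) : altRoot cs col s 0 j = simpleRoot j := by
  simp [altRoot, altProd_zero]

theorem altRoot_mem (s : Bool) (k : ℕ) (j : B) : altRoot cs col s k j ∈ coxeterRoots cs :=
  ⟨_, _, rfl⟩

theorem altRoot_add (s : Bool) (k m : ℕ) (j : B) : altRoot cs col s (k + m) j =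
    geomRep cs (altProd cs col s k) (altRoot cs col (alt s k) m j) := by
  rw [altRoot, altProd_add, geomRep_mul_apply, altRoot]

theorem geomRep_apply_injective (w : W) : Function.Injective (geomRep cs w) := fun u v h => by
  rw [← geomRep_inv_apply_self cs w u, h, geomRep_inv_apply_self]

theorem altRoot_injective (s : Bool) (k : ℕ) : Function.Injective (altRoot cs col s k) := by
  intro i j h
  have h1 := congrFun (geomRep_apply_injective cs _ h) j
  by_contra hij
  simp [simpleRoot, Ne.symm hij] at h1

theorem geomRep_wordProd_of_pairwise {l : List B}
    (hl : l.Pairwise fun i j => coxeterForm M (simpleRoot i) (simpleRoot j) = 0) (v : B → ℝ) :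
    geomRep cs (cs.wordProd l) v =
      v - (l.map fun i => coxeterForm M (simpleRoot i) v • simpleRoot i).sum := by
  induction l with
  | nil => simp
  | cons i l ih =>
    rw [List.pairwise_cons] at hl
    rw [cs.wordProd_cons, geomRep_mul_apply, geomRep_simple, formReflection_apply, ih hl.2]
    have h1 : coxeterForm M (simpleRoot i)
        (l.map fun i => coxeterForm M (simpleRoot i) v • simpleRoot i).sum = 0 := by
      rw [map_list_sum, List.map_map]
      refine List.sum_eq_zero fun x hx => ?_
      obtain ⟨j, hj, rfl⟩ := List.mem_map.1 hx
      rw [Function.comp_apply, map_smul, hl.1 j hj, smul_zero]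
    rw [map_sub, h1, sub_zero, List.map_cons, List.sum_cons]
    abel

variable {col} (hcol : ∀ i j, i ≠ j → col i = col j → M i j = 2)

include hcol

theorem coxeterForm_eq_zero_of_col_eq {i j : B} (hij : i ≠ j) (h : col i = col j) :
    coxeterForm M (simpleRoot i) (simpleRoot j) = 0 := by
  rw [coxeterForm_simpleRoot, hcol i j hij h]
  simp

theorem geomRep_colorProd (s : Bool) (v : B → ℝ) : geomRep cs (colorProd cs col s) v =
    v - ∑ i with col i = s, coxeterForm M (simpleRoot i) v • simpleRoot i := by
  rw [colorProd, geomRep_wordProd_of_pairwise]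
  · rw [colorList, Finset.sum_map_toList]
  · refine (nodup_colorList col s).imp_of_mem fun hi hj hij => ?_
    rw [mem_colorList] at hi hj
    exact coxeterForm_eq_zero_of_col_eq hcol hij (hi.trans hj.symm)

theorem geomRep_colorProd_apply (s : Bool) (v : B → ℝ) (i : B) :
    geomRep cs (colorProd cs col s) v i =
      if col i = s then v i - coxeterForm M (simpleRoot i) v else v i := by
  rw [geomRep_colorProd cs hcol, Pi.sub_apply, Finset.sum_apply]
  simp only [Pi.smul_apply, simpleRoot, Pi.single_apply, smul_eq_mul, mul_ite, mul_one, mul_zero]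
  rw [Finset.sum_ite_eq]
  simp only [Finset.mem_filter, Finset.mem_univ, true_and]
  split_ifs <;> simp

theorem coxeterForm_geomRep_colorProd {s : Bool} {i : B} (hi : col i = s) (v : B → ℝ) :
    coxeterForm M (simpleRoot i) (geomRep cs (colorProd cs col s) v) =
      -coxeterForm M (simpleRoot i) v := by
  rw [geomRep_colorProd cs hcol, map_sub, map_sum, Finset.sum_eq_single i]
  · rw [map_smul, coxeterForm_simpleRoot_self, smul_eq_mul]; ring
  · intro j hj hji
    rw [Finset.mem_filter] at hj
    rw [map_smul, coxeterForm_eq_zero_of_col_eq hcol hji.symm (hi.trans hj.2.symm), smul_zero]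
  · intro h
    exact absurd (Finset.mem_filter.2 ⟨Finset.mem_univ i, hi⟩) h

theorem geomRep_colorProd_simpleRoot {s : Bool} {j : B} (hj : col j = s) :
    geomRep cs (colorProd cs col s) (simpleRoot j) = -simpleRoot j := by
  rw [geomRep_colorProd cs hcol, Finset.sum_eq_single j]
  · rw [coxeterForm_simpleRoot_self]; module
  · intro i hi hij
    rw [Finset.mem_filter] at hi
    rw [coxeterForm_eq_zero_of_col_eq hcol hij (hi.2.trans hj.symm), zero_smul]
  · intro h
    exact absurd (Finset.mem_filter.2 ⟨Finset.mem_univ j, hj⟩) h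

/-- The root of a vertex whose colour is opposite to that of the block is the negative of a root
of the preceding block. -/
theorem altRoot_succ_of_col {s : Bool} {k : ℕ} {j : B} (hj : col j = alt s k) :
    altRoot cs col s (k + 1) j = -altRoot cs col s k j := by
  rw [altRoot, altProd_succ, geomRep_mul_apply, geomRep_colorProd_simpleRoot cs hcol hj, map_neg,
    altRoot]

omit hcol in
theorem eq_simpleRoot_of_support (hpos : ∀ v ≠ 0, 0 < coxeterForm M v v) {β : B → ℝ}
    (hβ : β ∈ coxeterRoots cs) (h0 : 0 ≤ β) {s : Bool}
    (hcol : ∀ i j, i ≠ j → col i = col j → M i j = 2) (hs : ∀ i, col i ≠ s → β i = 0) :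
    ∃ j, col j = s ∧ β = simpleRoot j := by
  have hself := coxeterForm_root_self cs hβ
  obtain ⟨i, hi⟩ : ∃ i, β i ≠ 0 := by
    by_contra! h
    have : β = 0 := funext h
    rw [this] at hself
    simp at hself
  have his : col i = s := by
    by_contra h
    exact hi (hs i h)
  have hform : coxeterForm M (simpleRoot i) β = 2 * β i := by
    rw [coxeterForm_comm, coxeterForm_eq_sum, Finset.sum_eq_single i]
    · rw [coxeterForm_simpleRoot_self, mul_comm]
    · intro j _ hji
      by_cases hj : col j = s
      · rw [coxeterForm_eq_zero_of_col_eq hcol hji (hj.trans his.symm), mul_zero]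
      · rw [hs j hj, zero_mul]
    · intro h
      exact absurd (Finset.mem_univ i) h
  have hr := geomRep_mem_coxeterRoots cs (cs.simple i) hβ
  rw [geomRep_simple, formReflection_apply, hform] at hr
  have hneg : β - (2 * β i) • simpleRoot i ≤ 0 := by
    refine (coxeterRoots_nonneg_or_nonpos cs hpos hr).resolve_left fun h => ?_
    have h1 := h i
    simp only [Pi.zero_apply, Pi.sub_apply, Pi.smul_apply, simpleRoot, Pi.single_eq_same,
      smul_eq_mul, mul_one] at h1
    exact hi (le_antisymm (by linarith) (h0 i))
  have hβ' : β = β i • simpleRoot i := by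
    funext j
    by_cases hji : j = i
    · subst hji; simp [simpleRoot]
    · have h1 := hneg j
      simp only [Pi.zero_apply, Pi.sub_apply, Pi.smul_apply, simpleRoot, Pi.single_eq_of_ne hji,
        smul_zero, sub_zero] at h1
      simp only [Pi.smul_apply, simpleRoot, Pi.single_eq_of_ne hji, smul_zero]
      exact le_antisymm h1 (h0 j)
  refine ⟨i, his, ?_⟩
  rw [hβ', map_smul, map_smul, LinearMap.smul_apply, coxeterForm_simpleRoot_self] at hself
  simp only [smul_eq_mul] at hself
  have h2 : β i * β i = 1 := by
    linarith
  have h3 : β i = 1 := by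
    rcases mul_self_eq_one_iff.1 h2 with h | h
    · exact h
    · have := h0 i
      simp only [Pi.zero_apply] at this
      linarith
  rw [hβ', h3, one_smul]

end Bipartite

section Wave

open Real

variable {B : Type*} [Fintype B] [DecidableEq B] {M : CoxeterMatrix B} {W : Type*} [Group W]
  (cs : CoxeterSystem M W) {col : B → Bool} (hcol : ∀ i j, i ≠ j → col i = col j → M i j = 2)

variable (col) in
/-- The linear functional taking the root of a vertex `j` in position `k` to
`p j * sin (k * θ + φ)`. -/
noncomputable def wave (p : B → ℝ) (θ φ : ℝ) (s : Bool) (v : B → ℝ) : ℝ :=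
  ∑ i, v i * (p i * if col i = s then sin φ else sin (θ - φ))

variable {p : B → ℝ} {θ φ : ℝ} {s : Bool}

theorem wave_add (u v : B → ℝ) :
    wave col p θ φ s (u + v) = wave col p θ φ s u + wave col p θ φ s v := by
  simp only [wave, ← Finset.sum_add_distrib, Pi.add_apply, add_mul]

theorem wave_smul (r : ℝ) (v : B → ℝ) :
    wave col p θ φ s (r • v) = r * wave col p θ φ s v := by
  simp only [wave, Finset.mul_sum, Pi.smul_apply, smul_eq_mul, mul_assoc]

variable (col p θ φ s) in
/-- The wave functional as a linear map. -/
noncomputable def waveLin : (B → ℝ) →ₗ[ℝ] ℝ where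
  toFun := wave col p θ φ s
  map_add' := wave_add
  map_smul' := wave_smul

theorem waveLin_simpleRoot (j : B) : waveLin col p θ φ s (simpleRoot j) =
    p j * if col j = s then sin φ else sin (θ - φ) := by
  show wave col p θ φ s (simpleRoot j) = _
  rw [wave, Finset.sum_eq_single j]
  · rw [simpleRoot, Pi.single_eq_same, one_mul]
  · intro i _ hij
    rw [simpleRoot, Pi.single_eq_of_ne hij, zero_mul]
  · intro h
    exact absurd (Finset.mem_univ j) h

theorem waveLin_pos (hp : ∀ i, 0 < p i) (h0 : 0 < φ) (h1 : φ < θ) (hθ : θ < π) {v : B → ℝ}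
    (hv : 0 ≤ v) (hv0 : v ≠ 0) : 0 < waveLin col p θ φ s v := by
  show 0 < wave col p θ φ s v
  obtain ⟨i, hi⟩ := Function.ne_iff.1 hv0
  have hpos : ∀ j, 0 < p j * if col j = s then sin φ else sin (θ - φ) := fun j => by
    refine mul_pos (hp j) ?_
    split_ifs
    · exact sin_pos_of_pos_of_lt_pi h0 (h1.trans hθ)
    · exact sin_pos_of_pos_of_lt_pi (by linarith) (by linarith)
  refine Finset.sum_pos' (fun j _ => mul_nonneg (hv j) (hpos j).le) ⟨i, Finset.mem_univ i, ?_⟩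
  exact mul_pos (lt_of_le_of_ne (hv i) (Ne.symm hi)) (hpos i)

include hcol

theorem waveLin_altRoot
    (hp : ∀ i, coxeterForm M (simpleRoot i) p = (2 - 2 * cos θ) * p i) (k : ℕ) (j : B) :
    waveLin col p θ φ s (altRoot cs col s k j) =
      if col j = alt s k then p j * sin (k * θ + φ) else -(p j * sin ((k - 1) * θ + φ)) := by
  induction k generalizing j with
  | zero =>
    rw [altRoot_zero, waveLin_simpleRoot, alt_zero]
    split_ifs
    · simp
    · rw [← mul_neg, ← sin_neg]
      congr 2
      push_cast; ring
  | succ k ih =>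
    by_cases hj : col j = alt s k
    · rw [altRoot_succ_of_col cs hcol hj, map_neg, ih, if_pos hj, if_neg (by
        rw [alt_succ, hj]; simp)]
      push_cast
      rw [add_sub_cancel_right]
    · have hj' : col j = alt s (k + 1) := by
        rw [alt_succ]; exact Bool.eq_not.2 hj
      rw [if_pos hj', altRoot, altProd_succ, geomRep_mul_apply, geomRep_colorProd cs hcol, map_sub,
        map_sub, map_sum, map_sum]
      have e1 : waveLin col p θ φ s (geomRep cs (altProd cs col s k) (simpleRoot j)) =
          -(p j * sin ((k - 1) * θ + φ)) := by
        have := ih j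
        rwa [if_neg hj] at this
      have e2 : ∑ i with col i = alt s k, waveLin col p θ φ s (geomRep cs (altProd cs col s k)
          (coxeterForm M (simpleRoot i) (simpleRoot j) • simpleRoot i)) =
          sin (k * θ + φ) * ∑ i with col i = alt s k,
            p i * coxeterForm M (simpleRoot i) (simpleRoot j) := by
        rw [Finset.mul_sum]
        refine Finset.sum_congr rfl fun i hi => ?_
        rw [Finset.mem_filter] at hi
        have := ih i
        rw [if_pos hi.2, altRoot] at this
        rw [map_smul, map_smul, this, smul_eq_mul]
        ring
      have e3 : ∑ i with col i = alt s k, p i * coxeterForm M (simpleRoot i) (simpleRoot j) =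
          -2 * cos θ * p j := by
        have h1 := hp j
        rw [coxeterForm_comm, coxeterForm_eq_sum,
          ← Finset.sum_filter_add_sum_filter_not _ (fun i => col i = alt s k),
          Finset.sum_eq_single (s := Finset.univ.filter fun i => ¬col i = alt s k) j,
          coxeterForm_simpleRoot_self] at h1
        · linarith
        · intro i hi hij
          rw [Finset.mem_filter] at hi
          rw [coxeterForm_eq_zero_of_col_eq hcol hij, mul_zero]
          have h2 := hi.2
          revert h2 hj
          cases col i <;> cases col j <;> cases alt s k <;> simp
        · intro h
          exact absurd (Finset.mem_filter.2 ⟨Finset.mem_univ j, hj⟩) h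
      rw [e1, e2, e3]
      have h2 : sin ((k + 1 : ℕ) * θ + φ) + sin ((k - 1) * θ + φ) =
          2 * cos θ * sin (k * θ + φ) := by
        push_cast
        rw [show (k + 1 : ℝ) * θ + φ = (k * θ + φ) + θ by ring,
          show (k - 1 : ℝ) * θ + φ = (k * θ + φ) - θ by ring, sin_add, sin_sub]
        ring
      have h3 : sin ((k + 1 : ℕ) * θ + φ) =
          2 * cos θ * sin (k * θ + φ) - sin ((k - 1) * θ + φ) := by linarith
      rw [h3]
      ring

end Wave

section CoxeterNumber

open Real

variable {B : Type*} [Fintype B] [DecidableEq B] {M : CoxeterMatrix B} {W : Type*} [Group W]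
  (cs : CoxeterSystem M W)

theorem coxeterRoot_ne_zero {β : B → ℝ} (hβ : β ∈ coxeterRoots cs) : β ≠ 0 := by
  rintro rfl
  have := coxeterForm_root_self cs hβ
  simp at this

include cs in
/-- The eigenvalue of a positive eigenvector of the form is `2 - 2 * cos (π / H)` for a natural
number `H`. -/
theorem exists_angle [Nonempty B] (hpos : ∀ v ≠ 0, 0 < coxeterForm M v v) {col : B → Bool}
    (hcol : ∀ i j, i ≠ j → col i = col j → M i j = 2) {p : B → ℝ} {μ : ℝ}
    (hp0 : ∀ i, 0 < p i) (hμ : 0 < μ) (hp : ∀ i, coxeterForm M (simpleRoot i) p = μ * p i) :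
    ∃ (H : ℕ) (θ : ℝ), 2 ≤ H ∧ H * θ = π ∧ μ = 2 - 2 * cos θ := by
  obtain ⟨j⟩ := ‹Nonempty B›
  have hμ2 : μ ≤ 2 := by
    have h1 := hp j
    rw [coxeterForm_comm, coxeterForm_eq_sum, ← Finset.add_sum_erase _ _ (Finset.mem_univ j),
      coxeterForm_simpleRoot_self] at h1
    have h2 : ∑ i ∈ Finset.univ.erase j, p i * coxeterForm M (simpleRoot i) (simpleRoot j) ≤ 0 :=
      Finset.sum_nonpos fun i hi => mul_nonpos_of_nonneg_of_nonpos (hp0 i).le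
        (coxeterForm_nonpos (Finset.ne_of_mem_erase hi))
    nlinarith [hp0 j]
  set θ := arccos ((2 - μ) / 2) with hθ
  have hcos : cos θ = (2 - μ) / 2 := cos_arccos (by linarith) (by linarith)
  have hθ0 : 0 < θ := arccos_pos.2 (by linarith)
  have hθ2 : θ ≤ π / 2 := arccos_le_pi_div_two.2 (by linarith)
  have hμθ : μ = 2 - 2 * cos θ := by rw [hcos]; ring
  have hex : ∃ N : ℕ, π ≤ N * θ := by
    obtain ⟨N, hN⟩ := exists_nat_ge (π / θ)
    exact ⟨N, by rwa [div_le_iff₀ hθ0] at hN⟩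
  classical
  have hN := Nat.find_spec hex
  have hmin := fun m => Nat.find_min hex (m := m)
  set N := Nat.find hex
  have h2 : 2 ≤ N := by
    by_contra h
    have : (N : ℝ) ≤ 1 := by exact_mod_cast (by omega : N ≤ 1)
    nlinarith [pi_pos]
  refine ⟨N, θ, h2, ?_, hμθ⟩
  refine le_antisymm (le_of_not_gt fun hlt => ?_) hN
  have h3 := hmin (N - 1) (by omega)
  rw [not_le, Nat.cast_sub (by omega), Nat.cast_one] at h3
  obtain ⟨s, hs⟩ := exists_alt_eq (N - 1) (col j)
  have h4 := waveLin_altRoot cs (s := s) (φ := π - (N - 1) * θ) hcol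
    (fun i => by rw [hp i, hμθ]) (N - 1) j
  rw [if_pos hs.symm, Nat.cast_sub (by omega), Nat.cast_one, add_sub_cancel, sin_pi,
    mul_zero] at h4
  have hroot := altRoot_mem cs col s (N - 1) j
  have h0 := coxeterRoot_ne_zero cs hroot
  have hφ : 0 < π - (N - 1) * θ := by linarith
  have hφθ : π - (N - 1) * θ < θ := by linarith
  have hθπ : θ < π := by linarith [pi_pos]
  rcases coxeterRoots_nonneg_or_nonpos cs hpos hroot with h | h
  · exact (waveLin_pos (s := s) (col := col) hp0 hφ hφθ hθπ h h0).ne' h4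
  · have := waveLin_pos (s := s) (col := col) hp0 hφ hφθ hθπ (neg_nonneg.2 h) (neg_ne_zero.2 h0)
    rw [map_neg, h4, neg_zero] at this
    exact lt_irrefl _ this

end CoxeterNumber

section Blocks

open Real

variable {B : Type*} [Fintype B] [DecidableEq B] {M : CoxeterMatrix B} {W : Type*} [Group W]
  (cs : CoxeterSystem M W) (col : B → Bool)

/-- The list of the roots in position `k`. -/
noncomputable def rootBlock (s : Bool) (k : ℕ) : List (B → ℝ) :=
  (colorList col (alt s k)).map (altRoot cs col s k)

theorem mem_rootBlock {s : Bool} {k : ℕ} {β : B → ℝ} :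
    β ∈ rootBlock cs col s k ↔ ∃ j, col j = alt s k ∧ altRoot cs col s k j = β := by
  simp [rootBlock, mem_colorList]

theorem rootBlock_add (s : Bool) (k m : ℕ) : rootBlock cs col s (k + m) =
    (rootBlock cs col (alt s k) m).map (geomRep cs (altProd cs col s k)) := by
  rw [rootBlock, rootBlock, List.map_map, alt_add]
  exact List.map_congr_left fun j _ => altRoot_add cs col s k m j

theorem rootBlock_add_two (s : Bool) (k : ℕ) : rootBlock cs col s (k + 2) =
    (rootBlock cs col s k).map (geomRep cs (altProd cs col s 2)) := by
  rw [add_comm, rootBlock_add, alt_two]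

theorem rootBlock_subset {s : Bool} {k : ℕ} {β : B → ℝ} (h : β ∈ rootBlock cs col s k) :
    β ∈ coxeterRoots cs := by
  obtain ⟨j, -, rfl⟩ := (mem_rootBlock cs col).1 h
  exact altRoot_mem cs col s k j

theorem nodup_rootBlock (s : Bool) (k : ℕ) : (rootBlock cs col s k).Nodup :=
  (nodup_colorList col _).map (altRoot_injective cs col s k)

theorem alt_add_self (s : Bool) (k : ℕ) : alt s (k + k) = s := by
  induction k with
  | zero => rfl
  | succ k ih => rw [show k + 1 + (k + 1) = k + k + 2 by ring, alt_add_two, ih]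

variable {col} (hcol : ∀ i j, i ≠ j → col i = col j → M i j = 2)
  (hpos : ∀ v ≠ 0, 0 < coxeterForm M v v) {p : B → ℝ} {θ : ℝ} {H : ℕ} (hp0 : ∀ i, 0 < p i)
  (hp : ∀ i, coxeterForm M (simpleRoot i) p = (2 - 2 * cos θ) * p i) (hH : 2 ≤ H)
  (hθ : H * θ = π)

theorem angle_pos (hH : 2 ≤ H) (hθ : H * θ = π) : 0 < θ := by
  have h : (0 : ℝ) < H := by exact_mod_cast (by omega : 0 < H)
  exact pos_of_mul_pos_right (hθ ▸ pi_pos) h.le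

theorem angle_lt_pi (hH : 2 ≤ H) (hθ : H * θ = π) : θ < π := by
  have h : (2 : ℝ) ≤ H := by exact_mod_cast hH
  nlinarith [angle_pos hH hθ]

include hcol hpos hp0 hp hH hθ

theorem rootBlock_nonneg {s : Bool} {k : ℕ} (hk : k < H) {β : B → ℝ}
    (hβ : β ∈ rootBlock cs col s k) : 0 ≤ β := by
  obtain ⟨j, hj, rfl⟩ := (mem_rootBlock cs col).1 hβ
  have hθ0 := angle_pos hH hθ
  have hθπ := angle_lt_pi hH hθ
  have hroot := altRoot_mem cs col s k j
  refine (coxeterRoots_nonneg_or_nonpos cs hpos hroot).resolve_right fun h => ?_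
  have h1 := waveLin_pos (s := s) (col := col) hp0 (half_pos hθ0) (half_lt_self hθ0) hθπ
    (neg_nonneg.2 h) (neg_ne_zero.2 (coxeterRoot_ne_zero cs hroot))
  rw [map_neg, waveLin_altRoot cs hcol hp, if_pos hj] at h1
  have hk' : (k : ℝ) + 1 ≤ H := by exact_mod_cast hk
  have h2 : 0 < sin (k * θ + θ / 2) :=
    sin_pos_of_pos_of_lt_pi (by positivity) (by nlinarith)
  nlinarith [hp0 j]

theorem neg_mem_rootBlock_zero {s : Bool} {β : B → ℝ} (hβ : β ∈ rootBlock cs col s H) :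
    -β ∈ rootBlock cs col s 0 := by
  obtain ⟨j, hj, rfl⟩ := (mem_rootBlock cs col).1 hβ
  have hθ0 := angle_pos hH hθ
  have hθπ := angle_lt_pi hH hθ
  have hroot := altRoot_mem cs col s H j
  have hneg : altRoot cs col s H j ≤ 0 := by
    refine (coxeterRoots_nonneg_or_nonpos cs hpos hroot).resolve_left fun h => ?_
    have h1 := waveLin_pos (s := s) (col := col) hp0 (half_pos hθ0) (half_lt_self hθ0) hθπ
      h (coxeterRoot_ne_zero cs hroot)
    rw [waveLin_altRoot cs hcol hp, if_pos hj, hθ, add_comm, sin_add_pi] at h1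
    have h2 : 0 < sin (θ / 2) := sin_pos_of_pos_of_lt_pi (by positivity) (by linarith)
    nlinarith [hp0 j]
  have h0 := waveLin_altRoot (s := s) (φ := 0) cs hcol hp H j
  rw [if_pos hj, add_zero, hθ, sin_pi, mul_zero] at h0
  change ∑ i, _ = _ at h0
  have hsin := sin_pos_of_pos_of_lt_pi hθ0 hθπ
  have h1 := (Finset.sum_eq_zero_iff_of_nonpos fun i _ =>
    mul_nonpos_of_nonpos_of_nonneg (hneg i) (mul_nonneg (hp0 i).le (by
      split_ifs
      · rw [sin_zero]
      · rw [sub_zero]; exact hsin.le))).1 h0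
  obtain ⟨i, hi, h2⟩ := eq_simpleRoot_of_support cs hpos (neg_mem_coxeterRoots cs hroot)
    (neg_nonneg.2 hneg) (s := s) hcol fun i hi => by
      have h3 := h1 i (Finset.mem_univ i)
      rw [if_neg hi, sub_zero] at h3
      have h4 := (mul_eq_zero.1 h3).resolve_right (mul_pos (hp0 i) hsin).ne'
      rw [Pi.neg_apply, h4, neg_zero]
  exact (mem_rootBlock cs col).2 ⟨i, hi, by rw [altRoot_zero, h2]⟩

theorem rootBlock_half_zero (s : Bool) :
    (rootBlock cs col s H).Perm ((rootBlock cs col s 0).map Neg.neg) := by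
  have key : ∀ s, (rootBlock cs col s H).Subperm ((rootBlock cs col s 0).map Neg.neg) := fun s =>
    (nodup_rootBlock cs col s H).subperm fun β hβ => List.mem_map.2
      ⟨-β, neg_mem_rootBlock_zero cs hcol hpos hp0 hp hH hθ hβ, neg_neg β⟩
  refine (key s).perm_of_length_le ?_
  have h := (key (alt s H)).length_le
  simp only [rootBlock, List.length_map, alt_zero] at h ⊢
  rwa [← alt_add, alt_add_self] at h

theorem rootBlock_half (s : Bool) (k : ℕ) :
    (rootBlock cs col s (k + H)).Perm ((rootBlock cs col s k).map Neg.neg) := by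
  rw [rootBlock_add]
  have h := (rootBlock_half_zero cs hcol hpos hp0 hp hH hθ (alt s k)).map
    (geomRep cs (altProd cs col s k))
  refine h.trans (List.Perm.of_eq ?_)
  conv_rhs => rw [← add_zero k, rootBlock_add, List.map_map]
  rw [List.map_map]
  exact List.map_congr_left fun v _ => map_neg _ v

theorem neg_mem_rootBlock_half {s : Bool} {k : ℕ} {β : B → ℝ} :
    -β ∈ rootBlock cs col s (k + H) ↔ β ∈ rootBlock cs col s k := by
  rw [(rootBlock_half cs hcol hpos hp0 hp hH hθ s k).mem_iff, List.mem_map]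
  exact ⟨fun ⟨v, hv, h⟩ => neg_injective h ▸ hv, fun h => ⟨β, h, rfl⟩⟩

theorem altProd_pow_eq_one (s : Bool) : altProd cs col s 2 ^ H = 1 := by
  rw [← altProd_two_mul]
  refine eq_one_of_geomRep_nonneg cs hpos fun j => ?_
  change 0 ≤ altRoot cs col s (2 * H) j
  by_cases hj : col j = s
  · have h1 : altRoot cs col s (2 * H) j ∈ rootBlock cs col s (0 + H + H) := by
      rw [zero_add, ← two_mul]
      exact (mem_rootBlock cs col).2 ⟨j, by rw [two_mul, alt_add_self, hj], rfl⟩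
    rw [← neg_neg (altRoot cs col s (2 * H) j),
      neg_mem_rootBlock_half cs hcol hpos hp0 hp hH hθ,
      neg_mem_rootBlock_half cs hcol hpos hp0 hp hH hθ] at h1
    exact rootBlock_nonneg cs hcol hpos hp0 hp hH hθ (by omega) h1
  · have hj' : col j = alt s (H - 1 + H) := by
      have h2 : alt s (H + H) = !alt s (H - 1 + H) := by
        rw [← alt_succ]; congr 1; omega
      rw [alt_add_self] at h2
      rw [← Bool.not_not (alt s _), ← h2]
      exact Bool.eq_not.2 hj
    have h1 : altRoot cs col s (2 * H) j = -altRoot cs col s (H - 1 + H) j := by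
      rw [← altRoot_succ_of_col cs hcol hj']; congr 1; omega
    have h2 : altRoot cs col s (H - 1 + H) j ∈ rootBlock cs col s (H - 1 + H) :=
      (mem_rootBlock cs col).2 ⟨j, hj', rfl⟩
    rw [← neg_neg (altRoot cs col s (H - 1 + H) j),
      neg_mem_rootBlock_half cs hcol hpos hp0 hp hH hθ, ← h1] at h2
    exact rootBlock_nonneg cs hcol hpos hp0 hp hH hθ (by omega) h2

theorem dvd_of_altProd_pow_eq_one [Nonempty B] {s : Bool} {m : ℕ}
    (hm : altProd cs col s 2 ^ m = 1) : H ∣ m := by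
  obtain ⟨j⟩ := ‹Nonempty B›
  have hθ0 := angle_pos hH hθ
  rw [← altProd_two_mul] at hm
  have h1 : altRoot cs col s (2 * m) j = simpleRoot j := by
    rw [altRoot, hm, map_one]; rfl
  have h2 : cos (2 * m * θ) = 1 := by
    have hpj := (hp0 j).ne'
    have hw := fun φ => waveLin_altRoot (s := s) (φ := φ) cs hcol hp (2 * m) j
    simp only [h1] at hw
    simp only [waveLin_simpleRoot, two_mul m, alt_add_self] at hw
    by_cases hj : col j = s
    · have := hw (π / 2)
      rw [if_pos hj, if_pos hj, sin_add_pi_div_two, sin_pi_div_two] at this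
      have := mul_left_cancel₀ hpj this
      refine Eq.trans ?_ this.symm
      push_cast; ring_nf
    · have := hw (θ + π / 2)
      rw [if_neg hj, if_neg hj, sub_add_cancel_left, sin_neg, sin_pi_div_two,
        show ((m + m : ℕ) - 1 : ℝ) * θ + (θ + π / 2) = 2 * m * θ + π / 2 by push_cast; ring,
        sin_add_pi_div_two] at this
      have h3 : p j * cos (2 * m * θ) = p j * 1 := by linarith
      exact mul_left_cancel₀ hpj h3
  obtain ⟨n, hn⟩ := (cos_eq_one_iff _).1 h2
  rw [← hθ] at hn
  have h3 : (n * H : ℝ) = m := by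
    have : (n * H : ℝ) * (2 * θ) = m * (2 * θ) := by linarith
    exact mul_right_cancel₀ (by positivity) this
  have h4 : n * (H : ℤ) = m := by exact_mod_cast h3
  exact Int.natCast_dvd_natCast.1 ⟨n, by rw [← h4, mul_comm]⟩

theorem orderOf_altProd_two [Nonempty B] (s : Bool) : orderOf (altProd cs col s 2) = H :=
  Nat.dvd_antisymm
    (orderOf_dvd_of_pow_eq_one (altProd_pow_eq_one cs hcol hpos hp0 hp hH hθ s))
    (dvd_of_altProd_pow_eq_one cs hcol hpos hp0 hp hH hθ (pow_orderOf_eq_one _))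

end Blocks

section BlockEuler

variable {B : Type*} [Fintype B] [DecidableEq B] {M : CoxeterMatrix B} {W : Type*} [Group W]
  (cs : CoxeterSystem M W) {col : B → Bool} (hcol : ∀ i j, i ≠ j → col i = col j → M i j = 2)
  (hpos : ∀ v ≠ 0, 0 < coxeterForm M v v) [Finite W] {D : Module.End ℝ (B → ℝ)}
  (hD : ∀ v, D v - (coxeterRep cs hpos).ρ (altProd cs col true 2) (D v) = v)

include hcol hD

theorem euler_simpleRoot {i : B} (hi : col i = true) (v : B → ℝ) :
    (coxeterRep cs hpos).euler D (simpleRoot i) v = v i := by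
  have hv : D v - geomRep cs (altProd cs col true 2) (D v) = v := hD v
  have h := (coxeterRep cs hpos).euler_left hD (simpleRoot i) v
  change _ = coxeterForm M (simpleRoot i) v - coxeterForm M (D v) (simpleRoot i) at h
  generalize D v = a at hv h
  rw [h, coxeterForm_comm M a, ← hv, map_sub, sub_sub_cancel_left, altProd_two, geomRep_mul_apply,
    coxeterForm_geomRep_colorProd cs hcol hi, Pi.sub_apply, geomRep_colorProd_apply cs hcol,
    if_pos hi, geomRep_colorProd_apply cs hcol, if_neg (by simp [hi])]
  ring

theorem euler_altRoot_one {i : B} (hi : col i = false) (v : B → ℝ) :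
    (coxeterRep cs hpos).euler D (altRoot cs col true 1 i) v = v i := by
  have hv : D v - geomRep cs (altProd cs col true 2) (D v) = v := hD v
  have h := (coxeterRep cs hpos).euler_left hD (altRoot cs col true 1 i) v
  change _ = coxeterForm M (altRoot cs col true 1 i) v -
    coxeterForm M (D v) (altRoot cs col true 1 i) at h
  generalize D v = a at hv h
  rw [h, coxeterForm_comm M a, ← hv, map_sub, sub_sub_cancel_left, altProd_two, geomRep_mul_apply,
    altRoot, altProd_one, coxeterForm_geomRep, Bool.not_true,
    coxeterForm_geomRep_colorProd cs hcol hi, Pi.sub_apply, geomRep_colorProd_apply cs hcol, if_neg (by simp [hi]),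
    geomRep_colorProd_apply cs hcol, if_pos (by simp [hi])]
  ring

theorem euler_altRoot (k : ℕ) {i : B} (hi : col i = alt true k) (v : B → ℝ) :
    (coxeterRep cs hpos).euler D (altRoot cs col true k i)
      (geomRep cs (altProd cs col true k) v) = v i := by
  induction k using Nat.twoStepInduction with
  | zero =>
    rw [altRoot_zero, euler_simpleRoot cs hcol hpos hD hi, altProd_zero, map_one]
    rfl
  | one =>
    have hi' : col i = false := hi
    rw [euler_altRoot_one cs hcol hpos hD hi', altProd_one, geomRep_colorProd_apply cs hcol,
      if_neg (by simp [hi'])]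
  | more k ih _ =>
    rw [altRoot, altProd_add_two, geomRep_mul_apply, geomRep_mul_apply]
    rw [alt_add_two] at hi
    exact ((coxeterRep cs hpos).euler_coxeter_coxeter hD _ _).trans (ih hi)

theorem euler_altRoot_altRoot (k m : ℕ) {i : B} (hi : col i = alt true k) (j : B) :
    (coxeterRep cs hpos).euler D (altRoot cs col true k i) (altRoot cs col true (k + m) j) =
      altRoot cs col (alt true k) m j i := by
  rw [altRoot_add, euler_altRoot cs hcol hpos hD k hi]

theorem rootBlock_euler_eq_zero (k : ℕ) : (rootBlock cs col true k).Pairwise fun γ δ =>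
    (coxeterRep cs hpos).euler D γ δ = 0 ∧ (coxeterRep cs hpos).euler D δ γ = 0 := by
  rw [rootBlock, List.pairwise_map]
  refine (nodup_colorList col _).imp_of_mem fun {i j} hi hj hij => ?_
  rw [mem_colorList] at hi hj
  have h1 := euler_altRoot_altRoot cs hcol hpos hD k 0 hi j
  have h2 := euler_altRoot_altRoot cs hcol hpos hD k 0 hj i
  rw [add_zero, altRoot_zero, simpleRoot] at h1 h2
  rw [h1, h2]
  exact ⟨Pi.single_eq_of_ne hij _, Pi.single_eq_of_ne hij.symm _⟩

theorem rootBlock_append_pairwise : (rootBlock cs col true 0 ++ rootBlock cs col true 1).Pairwise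
    fun γ δ => (coxeterRep cs hpos).euler D δ γ = 0 := by
  refine List.pairwise_append.2
    ⟨(rootBlock_euler_eq_zero cs hcol hpos hD 0).imp fun h => h.2,
      (rootBlock_euler_eq_zero cs hcol hpos hD 1).imp fun h => h.2, fun γ hγ δ hδ => ?_⟩
  obtain ⟨j, hj, rfl⟩ := (mem_rootBlock cs col).1 hγ
  obtain ⟨i, hi, rfl⟩ := (mem_rootBlock cs col).1 hδ
  rw [euler_altRoot_one cs hcol hpos hD hi, altRoot_zero, simpleRoot]
  refine Pi.single_eq_of_ne ?_ _
  rintro rfl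
  rw [hi] at hj
  simp [alt] at hj

end BlockEuler

section PositiveBlocks

open Real

variable {B : Type*} [Fintype B] [DecidableEq B] {M : CoxeterMatrix B} {W : Type*} [Group W]
  (cs : CoxeterSystem M W) {col : B → Bool} (hcol : ∀ i j, i ≠ j → col i = col j → M i j = 2)
  (hpos : ∀ v ≠ 0, 0 < coxeterForm M v v) {p : B → ℝ} {θ : ℝ} {H : ℕ} (hp0 : ∀ i, 0 < p i)
  (hp : ∀ i, coxeterForm M (simpleRoot i) p = (2 - 2 * cos θ) * p i) (hH : 2 ≤ H)
  (hθ : H * θ = π)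

theorem perm_colorList (col : B → Bool) :
    (colorList col true ++ colorList col false).Perm (Finset.univ : Finset B).toList := by
  refine (List.perm_ext_iff_of_nodup (List.nodup_append.2
    ⟨nodup_colorList col _, nodup_colorList col _, ?_⟩) (Finset.nodup_toList _)).2 fun i => ?_
  · rintro i hi j hj rfl
    rw [mem_colorList] at hi hj
    rw [hi] at hj
    cases hj
  · simp [mem_colorList]

theorem length_rootBlock_add (col : B → Bool) :
    (rootBlock cs col true 0).length + (rootBlock cs col true 1).length = Fintype.card B := by
  have h := (perm_colorList col).length_eq
  rw [List.length_append, Finset.length_toList, Finset.card_univ] at h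
  simpa [rootBlock, alt] using h

theorem altProd_two_eq_wordProd (col : B → Bool) :
    altProd cs col true 2 = cs.wordProd (colorList col true ++ colorList col false) := by
  rw [altProd_two, cs.wordProd_append]; rfl

include hcol hpos hp0 hp hH hθ

theorem euler_rootBlock_nonneg [Finite W] {D : Module.End ℝ (B → ℝ)}
    (hD : ∀ v, D v - (coxeterRep cs hpos).ρ (altProd cs col true 2) (D v) = v) {k m : ℕ}
    (hm : m < H) {γ δ : B → ℝ} (hγ : γ ∈ rootBlock cs col true k)
    (hδ : δ ∈ rootBlock cs col true (k + m)) : 0 ≤ (coxeterRep cs hpos).euler D γ δ := by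
  obtain ⟨i, hi, rfl⟩ := (mem_rootBlock cs col).1 hγ
  obtain ⟨j, hj, rfl⟩ := (mem_rootBlock cs col).1 hδ
  rw [euler_altRoot_altRoot cs hcol hpos hD k m hi]
  rw [alt_add] at hj
  exact rootBlock_nonneg cs hcol hpos hp0 hp hH hθ hm ((mem_rootBlock cs col).2 ⟨j, hj, rfl⟩) i

theorem flatMap_rootBlock_pairwise [Finite W] {D : Module.End ℝ (B → ℝ)}
    (hD : ∀ v, D v - (coxeterRep cs hpos).ρ (altProd cs col true 2) (D v) = v) :
    ((List.range' 0 H).flatMap (rootBlock cs col true)).Pairwise fun γ δ =>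
      0 ≤ (coxeterRep cs hpos).euler D γ δ ∧ (coxeterRep cs hpos).euler D δ γ ≤ 0 := by
  refine List.pairwise_flatMap.2 ⟨fun k _ =>
    (rootBlock_euler_eq_zero cs hcol hpos hD k).imp fun h => ⟨h.1.ge, h.2.le⟩, ?_⟩
  refine (List.pairwise_lt_range' (s := 0) (n := H)).imp_of_mem fun {k l} hk hl hkl γ hγ δ hδ => ?_
  rw [List.mem_range'_1] at hk hl
  refine ⟨euler_rootBlock_nonneg cs hcol hpos hp0 hp hH hθ hD (m := l - k) (by omega) hγ
    (by rwa [Nat.add_sub_cancel' hkl.le]), ?_⟩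
  have h := euler_rootBlock_nonneg cs hcol hpos hp0 hp hH hθ hD (m := k + H - l) (by omega) hδ
    (by rw [Nat.add_sub_cancel' (by omega)]
        exact (neg_mem_rootBlock_half cs hcol hpos hp0 hp hH hθ).2 hγ)
  rw [map_neg] at h
  linarith

omit hp0 hp hH hθ in
/-- A positive root made negative by the inverse of the bipartite Coxeter element lies in one of
the first two blocks. -/
theorem mem_rootBlock_of_nonpos {β : B → ℝ} (hβ : β ∈ coxeterRoots cs) (h0 : β ≤ 0)
    (h1 : 0 ≤ geomRep cs (altProd cs col true 2) β) :
    ∃ k, geomRep cs (altProd cs col true 2) β ∈ rootBlock cs col true k := by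
  rw [altProd_two, geomRep_mul_apply] at h1 ⊢
  set δ := geomRep cs (colorProd cs col (!true)) β with hδ
  have hδr : δ ∈ coxeterRoots cs := geomRep_mem_coxeterRoots cs _ hβ
  have hγr := geomRep_mem_coxeterRoots cs (colorProd cs col true) hδr
  rcases coxeterRoots_nonneg_or_nonpos cs hpos hδr with h | h
  · obtain ⟨j, hj, h2⟩ := eq_simpleRoot_of_support cs hpos hδr h (s := false) hcol fun i hi => by
      refine le_antisymm ?_ (h i)
      rw [hδ, geomRep_colorProd_apply cs hcol, if_neg (by simpa using hi)]
      exact h0 i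
    refine ⟨1, (mem_rootBlock cs col).2 ⟨j, hj, ?_⟩⟩
    rw [h2, altRoot, altProd_one]
  · obtain ⟨j, hj, h2⟩ := eq_simpleRoot_of_support cs hpos hγr h1 (s := true) hcol fun i hi => by
      refine le_antisymm ?_ (h1 i)
      rw [geomRep_colorProd_apply cs hcol, if_neg hi]
      exact h i
    exact ⟨0, (mem_rootBlock cs col).2 ⟨j, hj, by rw [h2, altRoot_zero]⟩⟩

theorem exists_orbit_sign_change {β : B → ℝ} (hβ : β ∈ coxeterRoots cs) :
    ∃ m, geomRep cs (altProd cs col true 2 ^ m) β ≤ 0 ∧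
      0 ≤ geomRep cs (altProd cs col true 2 ^ (m + 1)) β := by
  set c := altProd cs col true 2 with hc
  have hcH : c ^ H = 1 := altProd_pow_eq_one cs hcol hpos hp0 hp hH hθ true
  have hroot : ∀ m, geomRep cs (c ^ m) β ∈ coxeterRoots cs :=
    fun m => geomRep_mem_coxeterRoots cs _ hβ
  have hsum : ∑ m ∈ Finset.range H, geomRep cs (c ^ m) β = 0 := by
    refine eq_zero_of_geomRep_wordProd cs hpos (l := colorList col true ++ colorList col false)
      ((perm_colorList col).nodup_iff.2 (Finset.nodup_toList _)) (fun i => ?_) ?_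
    · exact (perm_colorList col).mem_iff.2 (by simp)
    · rw [← altProd_two_eq_wordProd, ← hc, map_sum]
      have h1 := Finset.sum_range_succ (fun m => geomRep cs (c ^ m) β) H
      rw [Finset.sum_range_succ', hcH, pow_zero, add_left_inj] at h1
      rw [← h1]
      refine Finset.sum_congr rfl fun m _ => ?_
      rw [← geomRep_mul_apply, pow_succ']
  have hne : ∃ m, ¬0 ≤ geomRep cs (c ^ m) β := by
    by_contra! h
    exact coxeterRoot_ne_zero cs (hroot 0)
      ((Finset.sum_eq_zero_iff_of_nonneg fun m _ => h m).1 hsum 0 (Finset.mem_range.2 (by omega)))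
  have hnp : ∃ m, ¬geomRep cs (c ^ m) β ≤ 0 := by
    by_contra! h
    exact coxeterRoot_ne_zero cs (hroot 0)
      ((Finset.sum_eq_zero_iff_of_nonpos fun m _ => h m).1 hsum 0 (Finset.mem_range.2 (by omega)))
  obtain ⟨a, ha⟩ := hne
  obtain ⟨b, hb⟩ := hnp
  by_contra! h
  have key : ∀ n, geomRep cs (c ^ (a + n)) β ≤ 0 := by
    intro n
    induction n with
    | zero => exact (coxeterRoots_nonneg_or_nonpos cs hpos (hroot a)).resolve_left ha
    | succ n ih => exact (coxeterRoots_nonneg_or_nonpos cs hpos (hroot _)).resolve_left (h _ ih)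
  refine hb ?_
  have h2 := key (b + (H - 1) * a)
  have h3 : a + (b + (H - 1) * a) = b + H * a := by
    obtain ⟨H', rfl⟩ : ∃ H', H = H' + 1 := ⟨H - 1, by omega⟩
    rw [Nat.add_sub_cancel]; ring
  rwa [h3, pow_add, pow_mul, hcH, one_pow, mul_one] at h2

theorem exists_mem_rootBlock {β : B → ℝ} (hβ : β ∈ coxeterRoots cs) :
    ∃ k, β ∈ rootBlock cs col true k := by
  obtain ⟨m, h0, h1⟩ := exists_orbit_sign_change cs hcol hpos hp0 hp hH hθ hβ
  rw [pow_succ', geomRep_mul_apply] at h1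
  obtain ⟨k, hk⟩ := mem_rootBlock_of_nonpos cs hcol hpos (geomRep_mem_coxeterRoots cs _ hβ) h0 h1
  rw [← geomRep_mul_apply, ← pow_succ'] at hk
  have h2 : ∀ n, geomRep cs (altProd cs col true 2 ^ (n + (m + 1))) β ∈
      rootBlock cs col true (k + 2 * n) := by
    intro n
    induction n with
    | zero => simpa using hk
    | succ n ih =>
      rw [show k + 2 * (n + 1) = k + 2 * n + 2 by ring, rootBlock_add_two]
      refine List.mem_map.2 ⟨_, ih, ?_⟩
      rw [← geomRep_mul_apply, ← pow_succ']
      congr 3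
      ring
  have h3 := h2 ((H - 1) * (m + 1))
  have h4 : (H - 1) * (m + 1) + (m + 1) = H * (m + 1) := by
    obtain ⟨H', rfl⟩ : ∃ H', H = H' + 1 := ⟨H - 1, by omega⟩
    rw [Nat.add_sub_cancel]; ring
  rw [h4, pow_mul, altProd_pow_eq_one cs hcol hpos hp0 hp hH hθ, one_pow, map_one] at h3
  exact ⟨_, h3⟩

theorem exists_mem_rootBlock_lt {β : B → ℝ} (hβ : β ∈ coxeterRoots cs) :
    ∃ k < H, β ∈ rootBlock cs col true k ∨ -β ∈ rootBlock cs col true k := by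
  obtain ⟨k, hk⟩ := exists_mem_rootBlock cs hcol hpos hp0 hp hH hθ hβ
  clear hβ
  induction k using Nat.strong_induction_on generalizing β with
  | _ k ih =>
    by_cases hkH : k < H
    · exact ⟨k, hkH, Or.inl hk⟩
    · have h1 : -β ∈ rootBlock cs col true (k - H) := by
        rw [← neg_mem_rootBlock_half cs hcol hpos hp0 hp hH hθ, neg_neg,
          Nat.sub_add_cancel (by omega)]
        exact hk
      obtain ⟨l, hl, h⟩ := ih (k - H) (by omega) h1
      rw [neg_neg] at h
      exact ⟨l, hl, h.symm⟩

theorem isPosList_rootBlock [Fintype W] {D : Module.End ℝ (B → ℝ)}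
    (hD : ∀ v, D v - (coxeterRep cs hpos).ρ (altProd cs col true 2) (D v) = v) :
    ((coxeterRep cs hpos).eulerSystem hD).IsPosList
      ((List.range' 0 H).flatMap (rootBlock cs col true)) := by
  have hpw := flatMap_rootBlock_pairwise cs hcol hpos hp0 hp hH hθ hD
  have hmem : ∀ β, β ∈ (List.range' 0 H).flatMap (rootBlock cs col true) ↔
      ∃ k < H, β ∈ rootBlock cs col true k := fun β => by
    simp [List.mem_flatMap, List.mem_range'_1]
  refine ⟨?_, fun β => ⟨fun hβ => ?_, ?_⟩, fun β hβ hβ' => ?_, hpw⟩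
  · refine hpw.imp_of_mem fun {γ δ} hγ _ h heq => ?_
    subst heq
    obtain ⟨k, -, hk⟩ := (hmem γ).1 hγ
    have := (coxeterRep cs hpos).euler_root hD (β := γ) (rootBlock_subset cs col hk)
    linarith [h.2]
  · obtain ⟨k, hk, h⟩ := exists_mem_rootBlock_lt cs hcol hpos hp0 hp hH hθ hβ
    rw [hmem, hmem]
    exact h.imp (fun h => ⟨k, hk, h⟩) fun h => ⟨k, hk, h⟩
  · rw [hmem, hmem]
    rintro (⟨k, -, hk⟩ | ⟨k, -, hk⟩)
    · exact rootBlock_subset cs col hk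
    · rw [← neg_neg β]
      exact neg_mem_coxeterRoots cs (rootBlock_subset cs col hk)
  · obtain ⟨k, hk, h1⟩ := (hmem β).1 hβ
    obtain ⟨l, hl, h2⟩ := (hmem _).1 hβ'
    have h3 := rootBlock_nonneg cs hcol hpos hp0 hp hH hθ hk h1
    have h4 := rootBlock_nonneg cs hcol hpos hp0 hp hH hθ hl h2
    exact coxeterRoot_ne_zero cs (rootBlock_subset cs col h1)
      (le_antisymm (neg_nonneg.1 h4) h3)

omit hcol hH in
theorem card_eq_one_of_angle [Nonempty B]
    (hirr : ∀ A : Set B, (∀ a ∈ A, ∀ b ∈ Aᶜ, M a b = 2) → A = ∅ ∨ A = Set.univ)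
    (hH2 : H = 2) : Fintype.card B = 1 := by
  obtain ⟨i⟩ := ‹Nonempty B›
  have hθ2 : θ = π / 2 := by rw [hH2] at hθ; push_cast at hθ; linarith
  have h1 := hp i
  rw [hθ2, cos_pi_div_two, coxeterForm_comm, coxeterForm_eq_sum,
    ← Finset.add_sum_erase _ _ (Finset.mem_univ i), coxeterForm_simpleRoot_self] at h1
  have h2 : ∑ j ∈ Finset.univ.erase i, p j * coxeterForm M (simpleRoot j) (simpleRoot i) = 0 := by
    linarith
  have h3 := (Finset.sum_eq_zero_iff_of_nonpos fun j hj => mul_nonpos_of_nonneg_of_nonpos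
    (hp0 j).le (coxeterForm_nonpos (Finset.ne_of_mem_erase hj))).1 h2
  have h4 := hirr {i} fun a ha b hb => by
    obtain rfl : a = i := ha
    have hba : b ≠ a := hb
    by_contra hM
    have h5 := coxeterForm_le_neg_one hpos hba (by rwa [M.symmetric])
    have h6 := h3 b (Finset.mem_erase.2 ⟨hba, Finset.mem_univ b⟩)
    rcases mul_eq_zero.1 h6 with h | h
    · exact (hp0 b).ne' h
    · linarith
  rcases h4 with h | h
  · exact absurd h (Set.singleton_ne_empty i)
  · refine Fintype.card_eq_one_iff.2 ⟨i, fun j => ?_⟩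
    have : j ∈ ({i} : Set B) := h ▸ Set.mem_univ j
    exact this

theorem cyclicBlocks_rootBlock [Fintype W] [Nonempty B]
    (hirr : ∀ A : Set B, (∀ a ∈ A, ∀ b ∈ Aᶜ, M a b = 2) → A = ∅ ∨ A = Set.univ)
    {D : Module.End ℝ (B → ℝ)}
    (hD : ∀ v, D v - (coxeterRep cs hpos).ρ (altProd cs col true 2) (D v) = v) :
    ((coxeterRep cs hpos).eulerSystem hD).CyclicBlocks (geomRep cs (altProd cs col true 2)) H
      (rootBlock cs col true) where
  E_c := (coxeterRep cs hpos).euler_coxeter hD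
  c_lat := fun U hU => by
    obtain ⟨w, hw⟩ := (ReflectionRep.mem_ncLat hD).1 hU
    exact (ReflectionRep.mem_ncLat hD).2 ⟨_, hw.map_coxeter hD⟩
  step := rootBlock_add_two cs col true
  half := rootBlock_half cs hcol hpos hp0 hp hH hθ true
  orth := rootBlock_euler_eq_zero cs hcol hpos hD
  pos := isPosList_rootBlock cs hcol hpos hp0 hp hH hθ hD
  pw := rootBlock_append_pairwise cs hcol hpos hD
  card := by rw [length_rootBlock_add, Module.finrank_fintype_fun_eq_card]
  two_le := hH
  rank_of_two := fun h => by
    rw [Module.finrank_fintype_fun_eq_card]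
    exact card_eq_one_of_angle hpos hp0 hp hθ hirr h

end PositiveBlocks

section Formula

variable {B : Type*} [Fintype B] {M : CoxeterMatrix B} {W : Type*} [Group W]
  (cs : CoxeterSystem M W)

/-- The edge count formula for the bipartite Coxeter element of a colouring, together with the
order of this element. -/
theorem edgeCount_altProd [DecidableEq B] [Fintype W] [Nonempty B]
    (hpos : ∀ v ≠ 0, 0 < coxeterForm M v v)
    (hirr : ∀ A : Set B, (∀ a ∈ A, ∀ b ∈ Aᶜ, M a b = 2) → A = ∅ ∨ A = Set.univ)
    {col : B → Bool} (hcol : ∀ i j, i ≠ j → col i = col j → M i j = 2) :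
    (orderOf (altProd cs col true 2) + 2) * edgeCount (simpleSet cs) (altProd cs col true 2) =
      Fintype.card B * orderOf (altProd cs col true 2) *
        ncCount (simpleSet cs) (altProd cs col true 2) := by
  classical
  obtain ⟨p, μ, hp0, hμ, hp⟩ := exists_perron hpos hirr
  obtain ⟨H, θ, hH, hθ, rfl⟩ := exists_angle cs hpos hcol hp0 hμ hp
  obtain ⟨D, hD⟩ := exists_euler_inverse cs hpos
    (l := colorList col true ++ colorList col false)
    ((perm_colorList col).nodup_iff.2 (Finset.nodup_toList _))
    (fun i => (perm_colorList col).mem_iff.2 (by simp))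
  rw [← altProd_two_eq_wordProd] at hD
  have h := (cyclicBlocks_rootBlock cs hcol hpos hp0 hp hH hθ hirr hD).two_counts
  rw [orderOf_altProd_two cs hcol hpos hp0 hp hH hθ,
    ReflectionRep.edgeCount_eq_sum (R := coxeterRep cs hpos) hD
      (isPosList_rootBlock cs hcol hpos hp0 hp hH hθ hD),
    ReflectionRep.ncCount_eq_card_ncLat (R := coxeterRep cs hpos) hD,
    ← Module.finrank_fintype_fun_eq_card ℝ]
  exact h

theorem isConj_altProd [DecidableEq B] (hpos : ∀ v ≠ 0, 0 < coxeterForm M v v) (col : B → Bool)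
    {c : W} (hc : IsCoxeterElementOf (simpleSet cs) c) : IsConj c (altProd cs col true 2) := by
  obtain ⟨l, hl, hB, rfl⟩ := exists_word_of_isCoxeterElementOf cs hc
  rw [altProd_two_eq_wordProd]
  refine isConj_prod_of_perm hpos cs.simple hl ?_ fun i _ j _ _ h =>
    commute_simple_of_eq_two cs h
  refine List.Perm.trans ?_ (perm_colorList col).symm
  exact (List.perm_ext_iff_of_nodup hl (Finset.nodup_toList _)).2 fun i => by simp [hB i]

theorem coxeterMatrix_irreducible [DecidableEq B] (hirr : IsIrreducibleCS cs) (A : Set B)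
    (hA : ∀ a ∈ A, ∀ b ∈ Aᶜ, M a b = 2) : A = ∅ ∨ A = Set.univ :=
  hirr.2 A fun a ha b hb => commute_simple_of_eq_two cs (hA a ha b hb)

end Formula

/-- **Theorem (uniform formula for the number of edges).**
If `(W,S)` is a finite irreducible Coxeter system of rank `n` with Coxeter number `h`,
then `E(W) = n·h/(h+2) · NC(W)`, i.e. `(h + 2)·E(W) = n·h·NC(W)`. -/
theorem edge_count_formula
    {B : Type} [Fintype B] {W : Type} [Group W] [Fintype W]
    {M : CoxeterMatrix B} (cs : CoxeterSystem M W)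
    (hirr : IsIrreducibleCS cs)
    (c : W) (hc : IsCoxeterElementOf (simpleSet cs) c)
    (h : ℕ) (hh : h = orderOf c) :
    (h + 2) * edgeCount (simpleSet cs) c =
      Fintype.card B * h * ncCount (simpleSet cs) c := by
  classical
  subst hh
  have : Nonempty B := hirr.1
  have hpos : ∀ v ≠ 0, 0 < coxeterForm M v v := fun v hv => coxeterForm_pos cs hirr.2 hv
  obtain ⟨col, hcol⟩ := exists_coloring hpos
  have hconj := isConj_altProd cs hpos col hc
  rw [edgeCount_eq_of_isConj hconj, ncCount_eq_of_isConj hconj, orderOf_eq_of_isConj hconj]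
  exact edgeCount_altProd cs hpos (coxeterMatrix_irreducible cs hirr) hcol
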